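/- arXiv:2206.04660 — 3 statements merged into one kernel-verified Lean document; each statement's English description precedes it below -/
import Mathlib

section
/- Let σ ∈ S_k be a pattern. If (ν_r)_{r≥1} is a sequence of measures in 𝒫 converging weakly to ν_∞ ∈ ℳ, then t_σ(ν_r) → t_σ(ν_∞) as r → ∞. -/
open MeasureTheory Filter Topology
open scoped ENNReal

noncomputable section

/-- The plane `ℝ²`, carrier for measures on the unit square. -/
abbrev Ω2 : Type := ℝ × ℝ

/-- The unit square `[0,1]² ⊆ ℝ²`. -/
def unitSq : Set Ω2 := Set.Icc (0 : ℝ) 1 ×ˢ Set.Icc (0 : ℝ) 1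

/-- Lebesgue measure on the unit square. -/
def lebSq : Measure Ω2 := volume.restrict unitSq

/-- `𝒫`: Borel probability measures concentrated on the unit square. -/
def Pcal : Set (ProbabilityMeasure Ω2) := {μ | (μ : Measure Ω2) unitSq = 1}

/-- `ℳ`: members of `𝒫` whose two coordinate marginals are atomless
(equivalently, have continuous CDFs). -/
def Mcal : Set (ProbabilityMeasure Ω2) :=
  {μ | μ ∈ Pcal ∧ (∀ x : ℝ, (μ : Measure Ω2).map Prod.fst {x} = 0) ∧
      ∀ y : ℝ, (μ : Measure Ω2).map Prod.snd {y} = 0}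

/-- The uniform distribution on `[0,1]`. -/
def unif01 : Measure ℝ := volume.restrict (Set.Icc (0 : ℝ) 1)

/-- `ℳ̃`: permutons, i.e. members of `𝒫` with both marginals uniform on `[0,1]`. -/
def Mtilde : Set (ProbabilityMeasure Ω2) :=
  {μ | μ ∈ Pcal ∧ (μ : Measure Ω2).map Prod.fst = unif01 ∧
      (μ : Measure Ω2).map Prod.snd = unif01}

open scoped Classical in
/-- `h_σ`: indicator that the `k` points induce the pattern `σ`. -/
def hPat {k : ℕ} (σ : Equiv.Perm (Fin k)) (z : Fin k → Ω2) : ℝ :=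
  if ∃ τ : Equiv.Perm (Fin k),
      StrictMono (fun i => (z (τ i)).1) ∧ StrictMono (fun i => (z (τ (σ⁻¹ i))).2)
  then 1 else 0

/-- Pattern density `t_σ(ν) = ∫ h_σ dν^{⊗k}`. -/
def tPat {k : ℕ} (σ : Equiv.Perm (Fin k)) (ν : Measure Ω2) : ℝ :=
  ∫ z, hPat σ z ∂(Measure.pi fun _ : Fin k => ν)

open scoped Classical in
/-- The permutation induced by `n` labelled points of `ℝ²` (junk value `1` if the
coordinates are not in generic position). -/
def inducedPerm {n : ℕ} (z : Fin n → Ω2) : Equiv.Perm (Fin n) :=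
  if h : ∃ σ : Equiv.Perm (Fin n), hPat σ z = 1 then h.choose else 1

/-- Empirical measure `Em(π) = (1/n) ∑ δ_{(i/n, π(i)/n)}` of a permutation, as a measure. -/
def EmM {n : ℕ} (π : Equiv.Perm (Fin n)) : Measure Ω2 :=
  (n : ℝ≥0∞)⁻¹ • ∑ i : Fin n, Measure.dirac ((((i : ℕ) + 1 : ℝ)) / n, (((π i : ℕ) + 1 : ℝ)) / n)

open scoped Classical in
/-- Empirical measure of a permutation as a probability measure (junk value for `n = 0`). -/
def EmP {n : ℕ} (π : Equiv.Perm (Fin n)) : ProbabilityMeasure Ω2 :=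
  if h : IsProbabilityMeasure (EmM π) then ⟨EmM π, h⟩
  else ⟨Measure.dirac 0, by infer_instance⟩

/-- `t_σ(π) := t_σ(Em(π))`. -/
def tPerm {k n : ℕ} (σ : Equiv.Perm (Fin k)) (π : Equiv.Perm (Fin n)) : ℝ := tPat σ (EmM π)

open scoped Classical in
/-- Kullback–Leibler divergence `D(ν|μ) ∈ [0,∞]`; for probability measures with `ν ≪ μ`
it equals `∫ log(dν/dμ) dν`, written here through the nonnegative integrand
`g log g + 1 - g` of the density `g = dν/dμ` (the correction `∫ (1-g) dμ = 0`). -/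
def KL (ν μ : Measure Ω2) : ℝ≥0∞ :=
  if ν ≪ μ then
    ∫⁻ z, ENNReal.ofReal ((ν.rnDeriv μ z).toReal * Real.log ((ν.rnDeriv μ z).toReal)
      + 1 - (ν.rnDeriv μ z).toReal) ∂μ
  else ∞

/-- CDF of the first marginal. -/
def cdfX (μ : Measure Ω2) (x : ℝ) : ℝ := (μ {p : Ω2 | p.1 ≤ x}).toReal

/-- CDF of the second marginal. -/
def cdfY (μ : Measure Ω2) (y : ℝ) : ℝ := (μ {p : Ω2 | p.2 ≤ y}).toReal

/-- The map `𝒪`: pushforward of `μ` under `(x,y) ↦ (F₁(x), F₂(y))`. -/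
def Omap (μ : Measure Ω2) : Measure Ω2 := μ.map fun p => (cdfX μ p.1, cdfY μ p.2)

/-- The product measure `μ^{⊗n}` governing `n` i.i.d. samples. -/
def pmeas (μ : Measure Ω2) (n : ℕ) : Measure (Fin n → Ω2) := Measure.pi fun _ => μ

/-- Log-partition function `F_n(σ,μ,θ) = log E[exp(nθ t_σ(π_{n,μ}))]`. -/
def Fn {k : ℕ} (σ : Equiv.Perm (Fin k)) (μ : Measure Ω2) (θ : ℝ) (n : ℕ) : ℝ :=
  Real.log (∫ z, Real.exp (n * θ * tPerm σ (inducedPerm z)) ∂pmeas μ n)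

/-- The Gibbs measure `Q_{n,σ,μ,θ}` on `([0,1]²)ⁿ`. -/
def Qgibbs {k : ℕ} (σ : Equiv.Perm (Fin k)) (μ : Measure Ω2) (θ : ℝ) (n : ℕ) :
    Measure (Fin n → Ω2) :=
  (pmeas μ n).withDensity fun z =>
    ENNReal.ofReal (Real.exp (n * θ * tPerm σ (inducedPerm z) - Fn σ μ θ n))

/-- `F(σ,μ,θ) = sup_{ν ∈ ℳ} { θ t_σ(ν) − D(ν|μ) }`, valued in `EReal`. -/
def Fsup {k : ℕ} (σ : Equiv.Perm (Fin k)) (μ : Measure Ω2) (θ : ℝ) : EReal :=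
  ⨆ ν ∈ Mcal, (((θ * tPat σ (ν : Measure Ω2) : ℝ) : EReal) - ((KL (↑ν) μ : ℝ≥0∞) : EReal))

/-- `ℱ(σ,μ,θ)`: the set of maximizers of `ν ↦ θ t_σ(ν) − D(ν|μ)` over `ℳ`. -/
def Fset {k : ℕ} (σ : Equiv.Perm (Fin k)) (μ : Measure Ω2) (θ : ℝ) :
    Set (ProbabilityMeasure Ω2) :=
  {ν | ν ∈ Mcal ∧
    (((θ * tPat σ (ν : Measure Ω2) : ℝ) : EReal) - ((KL (↑ν) μ : ℝ≥0∞) : EReal)) = Fsup σ μ θ}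

/-- `G(σ,μ,δ) = inf { D(ν|μ) : ν ∈ ℳ, t_σ(ν) ≥ δ }`. -/
def Gfun {k : ℕ} (σ : Equiv.Perm (Fin k)) (μ : Measure Ω2) (δ : ℝ) : ℝ≥0∞ :=
  ⨅ ν ∈ {ν : ProbabilityMeasure Ω2 | ν ∈ Mcal ∧ δ ≤ tPat σ (ν : Measure Ω2)}, KL (↑ν) μ

/-- `𝒢(σ,μ,δ)`: the set of minimizers in the definition of `G(σ,μ,δ)`. -/
def Gset {k : ℕ} (σ : Equiv.Perm (Fin k)) (μ : Measure Ω2) (δ : ℝ) :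
    Set (ProbabilityMeasure Ω2) :=
  {ν | (ν ∈ Mcal ∧ δ ≤ tPat σ (ν : Measure Ω2)) ∧ KL (↑ν) μ = Gfun σ μ δ}

/-- `α_σ(μ) = inf {δ : G(σ,μ,δ) = ∞}`. -/
def alphaSig {k : ℕ} (σ : Equiv.Perm (Fin k)) (μ : Measure Ω2) : ℝ :=
  sInf {δ : ℝ | Gfun σ μ δ = ∞}

/-- `μ` is conditionally constant (CC) with respect to a pattern `σ` of size `k+1`:
the conditional probability `P(π_{X,Y} = σ | (X₁,Y₁))`, which for i.i.d. samples equals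
`z ↦ ∫ h_σ(z, w) dμ^{⊗k}(w)`, is `μ`-a.s. equal to a constant `c ∈ [0,1]`. -/
def IsCC {k : ℕ} (σ : Equiv.Perm (Fin (k + 1))) (μ : Measure Ω2) : Prop :=
  ∃ c ∈ Set.Icc (0 : ℝ) 1, ∀ᵐ z ∂μ,
    (∫ w : Fin k → Ω2, hPat σ (Fin.cons z w) ∂pmeas μ k) = c

/-- The inversion pattern `21 ∈ S₂`. -/
def inv2 : Equiv.Perm (Fin 2) := Equiv.swap 0 1

/-- Lévy–Prokhorov (extended) distance between measures on `ℝ²`. -/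
def dLPE (μ ν : Measure Ω2) : ℝ≥0∞ := levyProkhorovEDist μ ν

/-- The topological support of a measure: the points whose every open neighbourhood
has positive measure. -/
def msupport (μ : Measure Ω2) : Set Ω2 :=
  {z | ∀ U : Set Ω2, IsOpen U → z ∈ U → 0 < μ U}

/-- Independent samples from a measure almost surely take distinct values under a function whose
law is atomless. -/
lemma measure_pi_eval_eq_null {ι α β : Type*} [Fintype ι] [MeasurableSpace α] [MeasurableSpace β]
    [MeasurableEq β] (μ : Measure α) [IsProbabilityMeasure μ]
    {f : α → β} (hf : Measurable f) (hatom : ∀ b, μ.map f {b} = 0) {i j : ι} (hij : i ≠ j) :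
    (Measure.pi fun _ : ι => μ) {z | f (z i) = f (z j)} = 0 := by
  have hindep : ProbabilityTheory.IndepFun (fun z : ι → α => f (z i)) (fun z => f (z j))
      (Measure.pi fun _ : ι => μ) :=
    (ProbabilityTheory.iIndepFun_pi (X := fun _ : ι => f) fun _ => hf.aemeasurable).indepFun hij
  have hmeas (l : ι) : Measurable fun z : ι → α => f (z l) := hf.comp (measurable_pi_apply l)
  have hlaw (l : ι) : (Measure.pi fun _ : ι => μ).map (fun z => f (z l)) = μ.map f := by
    have := Measure.map_map (μ := Measure.pi fun _ : ι => μ) hf (measurable_pi_apply l)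
    exact this.symm.trans (congrArg _ (measurePreserving_eval (fun _ : ι => μ) l).map_eq)
  have hprod := (ProbabilityTheory.indepFun_iff_map_prod_eq_prod_map_map
    (hmeas i).aemeasurable (hmeas j).aemeasurable).1 hindep
  rw [hlaw i, hlaw j] at hprod
  have : IsProbabilityMeasure (μ.map f) := Measure.isProbabilityMeasure_map hf.aemeasurable
  have hdiag : ((μ.map f).prod (μ.map f)) (Set.diagonal β) = 0 := by
    refine Measure.measure_prod_null_of_ae_null measurableSet_diagonal (ae_of_all _ fun b => ?_)
    have : Prod.mk b ⁻¹' Set.diagonal β = {b} := by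
      ext c
      simp [eq_comm]
    simp [this, hatom b]
  rw [← hprod, Measure.map_apply ((hmeas i).prodMk (hmeas j)) measurableSet_diagonal] at hdiag
  exact hdiag

/-- Over a finite index type, the strictly monotone real families form an open set. -/
lemma isOpen_strictMono {ι : Type*} [Finite ι] [Preorder ι] :
    IsOpen {f : ι → ℝ | StrictMono f} := by
  have : {f : ι → ℝ | StrictMono f} = ⋂ (i) (j) (_ : i < j), {f | f i < f j} := by
    ext f
    simp [StrictMono]
  rw [this]
  exact isOpen_iInter_of_finite fun i => isOpen_iInter_of_finite fun j =>
    isOpen_iInter_of_finite fun _ => isOpen_lt (continuous_apply i) (continuous_apply j)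

/-- The configurations of `k` points that induce the pattern `σ`. -/
def patternSet {k : ℕ} (σ : Equiv.Perm (Fin k)) : Set (Fin k → Ω2) :=
  {z | ∃ τ : Equiv.Perm (Fin k),
    StrictMono (fun i => (z (τ i)).1) ∧ StrictMono (fun i => (z (τ (σ⁻¹ i))).2)}

lemma isOpen_patternSet {k : ℕ} (σ : Equiv.Perm (Fin k)) : IsOpen (patternSet σ) := by
  simp only [patternSet, Set.ofPred_exists]
  refine isOpen_iUnion fun τ => IsOpen.inter ?_ ?_
  · exact isOpen_strictMono.preimage
      (f := fun (z : Fin k → Ω2) i => (z (τ i)).1) (by fun_prop)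
  · exact isOpen_strictMono.preimage
      (f := fun (z : Fin k → Ω2) i => (z (τ (σ⁻¹ i))).2) (by fun_prop)

lemma exists_monotone_of_mem_closure_patternSet {k : ℕ} {σ : Equiv.Perm (Fin k)} {z : Fin k → Ω2}
    (hz : z ∈ closure (patternSet σ)) : ∃ τ : Equiv.Perm (Fin k),
      Monotone (fun i => (z (τ i)).1) ∧ Monotone (fun i => (z (τ (σ⁻¹ i))).2) := by
  refine closure_minimal (t := {z : Fin k → Ω2 | ∃ τ : Equiv.Perm (Fin k),
      Monotone (fun i => (z (τ i)).1) ∧ Monotone (fun i => (z (τ (σ⁻¹ i))).2)})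
    ?_ ?_ hz
  · rintro w ⟨τ, h₁, h₂⟩
    exact ⟨τ, h₁.monotone, h₂.monotone⟩
  simp only [Set.ofPred_exists]
  refine isClosed_iUnion_of_finite fun τ => IsClosed.inter ?_ ?_
  · exact isClosed_monotone.preimage
      (f := fun (z : Fin k → Ω2) i => (z (τ i)).1) (by fun_prop)
  · exact isClosed_monotone.preimage
      (f := fun (z : Fin k → Ω2) i => (z (τ (σ⁻¹ i))).2) (by fun_prop)

/-- On the boundary of `patternSet σ`, two of the points share a coordinate. -/
lemma frontier_patternSet_subset {k : ℕ} (σ : Equiv.Perm (Fin k)) :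
    frontier (patternSet σ) ⊆
      ⋃ (i) (j) (_ : i ≠ j), {z | (z i).1 = (z j).1} ∪ {z | (z i).2 = (z j).2} := by
  rw [(isOpen_patternSet σ).frontier_eq]
  rintro z ⟨hz, hz'⟩
  obtain ⟨τ, h₁, h₂⟩ := exists_monotone_of_mem_closure_patternSet hz
  by_contra hties
  simp only [Set.mem_iUnion, Set.mem_union, Set.mem_ofPred_eq, not_exists, not_or] at hties
  have inj₁ : Function.Injective fun i => (z i).1 := fun i j h =>
    by_contra fun hij => (hties i j hij).1 h
  have inj₂ : Function.Injective fun i => (z i).2 := fun i j h =>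
    by_contra fun hij => (hties i j hij).2 h
  exact hz' ⟨τ, h₁.strictMono_of_injective (inj₁.comp τ.injective),
    h₂.strictMono_of_injective (inj₂.comp (τ.injective.comp (σ⁻¹).injective))⟩

lemma measure_pi_frontier_patternSet {k : ℕ} (σ : Equiv.Perm (Fin k)) {μ : ProbabilityMeasure Ω2}
    (hμ : μ ∈ Mcal) :
    (Measure.pi fun _ : Fin k => (μ : Measure Ω2)) (frontier (patternSet σ)) = 0 := by
  refine measure_mono_null (frontier_patternSet_subset σ) ?_
  simp only [measure_iUnion_null_iff, measure_union_null_iff]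
  exact fun i j hij => ⟨measure_pi_eval_eq_null _ measurable_fst hμ.2.1 hij,
    measure_pi_eval_eq_null _ measurable_snd hμ.2.2 hij⟩

lemma tPat_eq_measureReal {k : ℕ} (σ : Equiv.Perm (Fin k)) (ν : Measure Ω2) :
    tPat σ ν = (Measure.pi fun _ : Fin k => ν).real (patternSet σ) := by
  have : hPat σ = (patternSet σ).indicator 1 := by
    ext z
    simp [hPat, patternSet, Set.indicator_apply]
  rw [tPat, this, integral_indicator_one (isOpen_patternSet σ).measurableSet]

/-- Lemma 2.1: if `ν_r ∈ 𝒫` converges weakly to `νlim ∈ ℳ`, then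
`t_σ(ν_r) → t_σ(νlim)` for every pattern `σ ∈ S_k`. -/
theorem pattern_density_weakly_continuous {k : ℕ} (σ : Equiv.Perm (Fin k))
    (ν : ℕ → ProbabilityMeasure Ω2) (νlim : ProbabilityMeasure Ω2)
    (hν : ∀ r, ν r ∈ Pcal) (hlim : νlim ∈ Mcal)
    (hconv : Tendsto ν atTop (𝓝 νlim)) :
    Tendsto (fun r => tPat σ (ν r : Measure Ω2)) atTop (𝓝 (tPat σ (νlim : Measure Ω2))) := by
  have hpi : Tendsto (fun r => ProbabilityMeasure.pi fun _ : Fin k => ν r) atTop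
      (𝓝 (ProbabilityMeasure.pi fun _ : Fin k => νlim)) :=
    (ProbabilityMeasure.continuous_pi.tendsto _).comp (tendsto_pi_nhds.2 fun _ => hconv)
  have hmeas := ProbabilityMeasure.tendsto_measure_of_null_frontier_of_tendsto' hpi
    (measure_pi_frontier_patternSet σ hlim)
  simp only [tPat_eq_measureReal]
  exact (ENNReal.tendsto_toReal (measure_ne_top _ _)).comp hmeas

end
end

section
/- For every μ ∈ ℳ, the function I_μ is a good rate function (lower semicontinuous with compact sublevel sets), and the μ-random permutations satisfy a large deviation principle with speed n and rate I_μ: for every Borel set A ⊆ 𝒫, −inf_{γ∈A°} I_μ(γ) ≤ liminf_{n→∞} (1/n) log P(Em(π_{n,μ}) ∈ A) ≤ limsup_{n→∞} (1/n) log P(Em(π_{n,μ}) ∈ A) ≤ −inf_{γ∈Ā} I_μ(γ), where A° and Ā denote the interior and closure of A in the weak topology. -/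
open MeasureTheory Filter Topology
open scoped ENNReal

noncomputable section

open scoped Classical in
/-- The rate function `I_μ`. -/
def Irate (μ γ : ProbabilityMeasure Ω2) : ℝ≥0∞ :=
  if γ ∈ Mtilde then
    ⨅ ν ∈ {ν : ProbabilityMeasure Ω2 | ν ∈ Mcal ∧ Omap ↑ν = (γ : Measure Ω2)}, KL (↑ν) ↑μ
  else ∞

section

open ProbabilityTheory InformationTheory BoundedContinuousFunction
open scoped NNReal

section Duality

variable {E : Type*} [MeasurableSpace E]

/-- Young's inequality for the convex conjugate pair `klFun`, `y ↦ exp y - 1`. -/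
lemma mul_sub_exp_sub_one_le_klFun {x : ℝ} (hx : 0 ≤ x) (y : ℝ) :
    x * y - (Real.exp y - 1) ≤ klFun x := by
  rw [klFun_apply]
  rcases hx.eq_or_lt with rfl | hx
  · have := Real.exp_pos y
    simp only [zero_mul]
    linarith
  · have h1 := Real.add_one_le_exp (y - Real.log x)
    rw [Real.exp_sub, Real.exp_log hx, le_div_iff₀ hx] at h1
    linarith

lemma abs_exp_sub_exp_le {M a b : ℝ} (ha : |a| ≤ M) (hb : |b| ≤ M) :
    |Real.exp a - Real.exp b| ≤ Real.exp M * |a - b| := by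
  wlog hab : b ≤ a generalizing a b
  · rw [abs_sub_comm, abs_sub_comm a]
    exact this hb ha (le_of_not_ge hab)
  rw [abs_of_nonneg (sub_nonneg.2 (Real.exp_le_exp.2 hab)), abs_of_nonneg (sub_nonneg.2 hab)]
  have h1 := Real.add_one_le_exp (b - a)
  rw [Real.exp_sub, le_div_iff₀ (Real.exp_pos a)] at h1
  have h2 : Real.exp a ≤ Real.exp M := Real.exp_le_exp.2 ((le_abs_self a).trans ha)
  nlinarith [sub_nonneg.2 hab]

lemma integrable_of_abs_le {ρ : Measure E} [IsFiniteMeasure ρ] {f : E → ℝ} (hf : Measurable f)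
    {M : ℝ} (hM : ∀ x, |f x| ≤ M) : Integrable f ρ :=
  Integrable.of_bound hf.aestronglyMeasurable M (ae_of_all _ hM)

lemma integrable_exp_sub_one_of_abs_le {ρ : Measure E} [IsFiniteMeasure ρ] {f : E → ℝ}
    (hf : Measurable f) {M : ℝ} (hM : ∀ x, |f x| ≤ M) :
    Integrable (fun x => Real.exp (f x) - 1) ρ := by
  refine Integrable.sub (integrable_of_abs_le (M := Real.exp M) (by fun_prop) fun x => ?_)
    (integrable_const 1)
  rw [abs_of_pos (Real.exp_pos _)]
  exact Real.exp_le_exp.2 ((le_abs_self _).trans (hM x))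

/-- The functional `ν ↦ ∫ f dν - ∫ (exp f - 1) dμ`, whose supremum over bounded `f` is the
Kullback–Leibler divergence of `ν` from `μ`. -/
def expDual (μ : Measure E) (f : E → ℝ) (ν : Measure E) : ℝ :=
  ∫ x, f x ∂ν - ∫ x, (Real.exp (f x) - 1) ∂μ

lemma integral_eq_integral_rnDeriv_mul {μ ν : Measure E} [IsFiniteMeasure μ] [IsFiniteMeasure ν]
    (h : ν ≪ μ) (f : E → ℝ) : ∫ x, f x ∂ν = ∫ x, (ν.rnDeriv μ x).toReal * f x ∂μ :=
  (integral_rnDeriv_smul h).symm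

lemma integrable_rnDeriv_mul {μ ν : Measure E} [IsFiniteMeasure μ] [IsFiniteMeasure ν]
    (h : ν ≪ μ) {f : E → ℝ} (hf : Integrable f ν) :
    Integrable (fun x => (ν.rnDeriv μ x).toReal * f x) μ :=
  (integrable_rnDeriv_smul_iff h).2 hf

lemma expDual_le_klDiv {μ ν : Measure E} [IsFiniteMeasure μ] [IsFiniteMeasure ν] {f : E → ℝ}
    (hf : Measurable f) {M : ℝ} (hM : ∀ x, |f x| ≤ M) :
    ENNReal.ofReal (expDual μ f ν) ≤ klDiv ν μ := by
  by_cases h : klDiv ν μ = ∞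
  · simp [h]
  obtain ⟨hac, hint⟩ := klDiv_ne_top_iff.1 h
  rw [← ENNReal.ofReal_toReal h, toReal_klDiv_eq_integral_klFun hac]
  refine ENNReal.ofReal_le_ofReal ?_
  have h1 := integrable_rnDeriv_mul hac (integrable_of_abs_le (ρ := ν) hf hM)
  have h2 := integrable_exp_sub_one_of_abs_le (ρ := μ) hf hM
  rw [expDual, integral_eq_integral_rnDeriv_mul hac, ← integral_sub h1 h2]
  exact integral_mono (h1.sub h2) ((integrable_klFun_rnDeriv_iff hac).2 hint)
    fun x => mul_sub_exp_sub_one_le_klFun ENNReal.toReal_nonneg _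

/-- `max (1 / (n + 1)) (min (n + 1) g)`. -/
def clampPos (n : ℕ) (g : ℝ) : ℝ := max ((n : ℝ) + 1)⁻¹ (min ((n : ℝ) + 1) g)

lemma inv_le_clampPos (n : ℕ) (g : ℝ) : ((n : ℝ) + 1)⁻¹ ≤ clampPos n g := le_max_left _ _

lemma clampPos_pos (n : ℕ) (g : ℝ) : 0 < clampPos n g :=
  lt_of_lt_of_le (by positivity) (inv_le_clampPos n g)

lemma clampPos_le (n : ℕ) (g : ℝ) : clampPos n g ≤ (n : ℝ) + 1 :=
  max_le ((inv_le_one_of_one_le₀ (by linarith [n.cast_nonneg (α := ℝ)])).trans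
    (by linarith [n.cast_nonneg (α := ℝ)])) (min_le_left _ _)

lemma abs_log_clampPos_le (n : ℕ) (g : ℝ) : |Real.log (clampPos n g)| ≤ Real.log ((n : ℝ) + 1) := by
  rw [abs_le]
  constructor
  · rw [← Real.log_inv]
    exact Real.log_le_log (by positivity) (inv_le_clampPos n g)
  · exact Real.log_le_log (clampPos_pos n g) (clampPos_le n g)

lemma mul_log_clampPos_nonneg (n : ℕ) (g : ℝ) :
    0 ≤ g * Real.log (clampPos n g) - (clampPos n g - 1) := by
  have h0 := klFun_nonneg (clampPos_pos n g).le
  rw [klFun_apply] at h0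
  have hn := n.cast_nonneg (α := ℝ)
  suffices 0 ≤ (g - clampPos n g) * Real.log (clampPos n g) by linarith
  have hinv : ((n : ℝ) + 1)⁻¹ ≤ 1 := inv_le_one_of_one_le₀ (by linarith)
  rcases le_total g (clampPos n g) with h | h
  · rcases h.eq_or_lt with h | h
    · simp [← h]
    · have hc : clampPos n g = ((n : ℝ) + 1)⁻¹ := by
        unfold clampPos at h ⊢
        grind
      have : Real.log (clampPos n g) ≤ 0 :=
        Real.log_nonpos (clampPos_pos n g).le (hc ▸ hinv)
      nlinarith
  · rcases h.eq_or_lt with h | h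
    · simp [h]
    · have hc : clampPos n g = (n : ℝ) + 1 := by
        unfold clampPos at h ⊢
        grind
      have : 0 ≤ Real.log (clampPos n g) := Real.log_nonneg (by linarith)
      nlinarith

lemma tendsto_clampPos {g : ℝ} (hg : 0 ≤ g) : Tendsto (fun n => clampPos n g) atTop (𝓝 g) := by
  have h1 : Tendsto (fun n : ℕ => ((n : ℝ) + 1)⁻¹) atTop (𝓝 0) := by
    simpa [one_div] using tendsto_one_div_add_atTop_nhds_zero_nat (𝕜 := ℝ)
  have h2 : Tendsto (fun n : ℕ => min ((n : ℝ) + 1) g) atTop (𝓝 g) := by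
    refine tendsto_const_nhds.congr' ?_
    obtain ⟨N, hN⟩ := exists_nat_ge g
    filter_upwards [eventually_ge_atTop N] with n hn
    rw [min_eq_right]
    have : (N : ℝ) ≤ n := by exact_mod_cast hn
    linarith
  simpa [max_eq_right hg, clampPos] using h1.max h2

lemma tendsto_mul_log_clampPos {g : ℝ} (hg : 0 ≤ g) :
    Tendsto (fun n => g * Real.log (clampPos n g) - (clampPos n g - 1)) atTop (𝓝 (klFun g)) := by
  have h := tendsto_clampPos hg
  have : klFun g = g * Real.log g - (g - 1) := by rw [klFun_apply]; ring
  rw [this]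
  refine Tendsto.sub ?_ (h.sub_const 1)
  rcases hg.eq_or_lt with rfl | hg
  · simp
  · exact ((Real.continuousAt_log hg.ne').tendsto.comp h).const_mul g

lemma exists_measurable_lt_expDual {μ ν : Measure E} [IsFiniteMeasure μ] [IsFiniteMeasure ν]
    {a : ℝ} (ha : ENNReal.ofReal a < klDiv ν μ) :
    ∃ f : E → ℝ, Measurable f ∧ (∃ M, ∀ x, |f x| ≤ M) ∧ a < expDual μ f ν := by
  by_cases hac : ν ≪ μ
  · set g : E → ℝ := fun x => (ν.rnDeriv μ x).toReal with hg
    have hgm : Measurable g := (Measure.measurable_rnDeriv ν μ).ennreal_toReal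
    have hcm : ∀ n, Measurable fun x => clampPos n (g x) := fun n => by
      unfold clampPos; fun_prop
    rw [klDiv_eq_lintegral_klFun_of_ac hac] at ha
    have hfatou := lintegral_liminf_le (μ := μ) (u := atTop) (f := fun (n : ℕ) x =>
      ENNReal.ofReal (g x * Real.log (clampPos n (g x)) - (clampPos n (g x) - 1)))
      (fun n => by fun_prop)
    have hlim : ∀ x, liminf (fun n : ℕ => ENNReal.ofReal
        (g x * Real.log (clampPos n (g x)) - (clampPos n (g x) - 1))) atTop
        = ENNReal.ofReal (klFun (g x)) := fun x =>
      (ENNReal.tendsto_ofReal (tendsto_mul_log_clampPos ENNReal.toReal_nonneg)).liminf_eq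
    simp_rw [hlim] at hfatou
    obtain ⟨n, hn⟩ := (eventually_lt_of_lt_liminf (ha.trans_le hfatou)).exists
    have hfm : Measurable fun x => Real.log (clampPos n (g x)) := by fun_prop
    refine ⟨fun x => Real.log (clampPos n (g x)), hfm,
      ⟨_, fun x => abs_log_clampPos_le n (g x)⟩, ?_⟩
    have h1 := integrable_rnDeriv_mul hac
      (integrable_of_abs_le (ρ := ν) hfm fun x => abs_log_clampPos_le n (g x))
    have h2 := integrable_exp_sub_one_of_abs_le (ρ := μ) hfm fun x => abs_log_clampPos_le n (g x)
    simp_rw [Real.exp_log (clampPos_pos _ _)] at h2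
    rw [expDual, integral_eq_integral_rnDeriv_mul hac]
    simp_rw [Real.exp_log (clampPos_pos _ _)]
    rw [← integral_sub h1 h2]
    have h3 := ofReal_integral_eq_lintegral_ofReal (h1.sub h2)
      (ae_of_all _ fun x => mul_log_clampPos_nonneg n (g x))
    exact (ENNReal.ofReal_lt_ofReal_iff'.1 (hn.trans_eq h3.symm)).1
  · obtain ⟨s, hs, hμ, hν⟩ : ∃ s, MeasurableSet s ∧ μ s = 0 ∧ ν s ≠ 0 := by
      by_contra! hcon
      exact hac (Measure.AbsolutelyContinuous.mk fun s hs h => hcon s hs h)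
    have hpos : 0 < ν.real s := (measureReal_nonneg).lt_of_ne' (by
      simpa [measureReal_def, ENNReal.toReal_eq_zero_iff] using hν)
    set M := (|a| + 1) / ν.real s with hM
    have hM0 : 0 ≤ M := by positivity
    refine ⟨s.indicator fun _ => M, measurable_const.indicator hs, ⟨M, fun x => ?_⟩, ?_⟩
    · by_cases hx : x ∈ s <;> simp [hx, hM0, abs_of_nonneg]
    · have h0 : ∫ x, (Real.exp (s.indicator (fun _ => M) x) - 1) ∂μ = 0 := by
        refine integral_eq_zero_of_ae ?_
        filter_upwards [measure_eq_zero_iff_ae_notMem.1 hμ] with x hx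
        simp [hx]
      rw [expDual, h0, integral_indicator_const _ hs, smul_eq_mul, hM, mul_div_cancel₀ _ hpos.ne']
      linarith [le_abs_self a]

variable [TopologicalSpace E] [BorelSpace E]

lemma continuous_expDual (μ : Measure E) (f : E →ᵇ ℝ) :
    Continuous fun ν : ProbabilityMeasure E => expDual μ f (ν : Measure E) :=
  (ProbabilityMeasure.continuous_integral_boundedContinuousFunction f).sub continuous_const

variable [TopologicalSpace.PseudoMetrizableSpace E]

lemma exists_boundedContinuous_lt_expDual {μ ν : Measure E} [IsFiniteMeasure μ]
    [IsFiniteMeasure ν] {a : ℝ} (ha : ENNReal.ofReal a < klDiv ν μ) :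
    ∃ h : E →ᵇ ℝ, a < expDual μ h ν := by
  obtain ⟨f, hf, ⟨M, hM⟩, hlt⟩ := exists_measurable_lt_expDual ha
  set C := 1 + Real.exp M with hC
  have hC0 : 0 < C := by positivity
  set ε := (expDual μ f ν - a) / (2 * C) with hε
  have hε0 : 0 < ε := div_pos (by linarith) (by positivity)
  have hfi : Integrable f (ν + μ) := integrable_of_abs_le hf hM
  obtain ⟨h₀, hh₀, -⟩ := hfi.exists_boundedContinuous_integral_sub_le hε0
  set h : E →ᵇ ℝ := (h₀ ⊓ BoundedContinuousFunction.const E M) ⊔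
    BoundedContinuousFunction.const E (-M) with hh
  have hval : ∀ x, h x = max (min (h₀ x) M) (-M) := fun x => rfl
  have hclose : ∀ x, |f x - h x| ≤ |f x - h₀ x| := fun x => by
    rw [hval]
    have := abs_le.1 (hM x)
    grind
  have hhM : ∀ x, |h x| ≤ M := fun x => by
    rw [hval]
    have := (abs_nonneg _).trans (hM x)
    grind
  have hhm : Measurable h := h.continuous.measurable
  have hint : ∀ (ρ : Measure E) [IsFiniteMeasure ρ], Integrable (fun x => |f x - h x|) ρ :=
    fun ρ _ => ((integrable_of_abs_le hf hM).sub (integrable_of_abs_le hhm hhM)).abs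
  have hint₀ : ∀ (ρ : Measure E) [IsFiniteMeasure ρ], Integrable (fun x => |f x - h₀ x|) ρ :=
    fun ρ _ => ((integrable_of_abs_le hf hM).sub (h₀.integrable ρ)).abs
  have hsum : ∫ x, |f x - h x| ∂ν + ∫ x, |f x - h x| ∂μ ≤ ε := by
    rw [← integral_add_measure (hint ν) (hint μ)]
    exact (integral_mono (hint _) (hint₀ _) hclose).trans (by simpa using hh₀)
  have hν0 : 0 ≤ ∫ x, |f x - h x| ∂ν := integral_nonneg fun _ => abs_nonneg _
  have hμ0 : 0 ≤ ∫ x, |f x - h x| ∂μ := integral_nonneg fun _ => abs_nonneg _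
  have h1 : ∫ x, f x ∂ν - ∫ x, h x ∂ν ≤ ∫ x, |f x - h x| ∂ν := by
    rw [← integral_sub (integrable_of_abs_le hf hM) (integrable_of_abs_le hhm hhM)]
    exact (le_abs_self _).trans (abs_integral_le_integral_abs)
  have h2 : ∫ x, (Real.exp (h x) - 1) ∂μ - ∫ x, (Real.exp (f x) - 1) ∂μ
      ≤ Real.exp M * ∫ x, |f x - h x| ∂μ := by
    have i1 := integrable_exp_sub_one_of_abs_le (ρ := μ) hhm hhM
    have i2 := integrable_exp_sub_one_of_abs_le (ρ := μ) hf hM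
    rw [← integral_sub i1 i2, ← integral_const_mul]
    refine integral_mono (i1.sub i2) ((hint μ).const_mul _) fun x => ?_
    have := abs_exp_sub_exp_le (hhM x) (hM x)
    rw [abs_sub_comm (h x)] at this
    simpa using (le_abs_self _).trans this
  refine ⟨h, ?_⟩
  have h3 : ε * C = (expDual μ f ν - a) / 2 := by rw [hε]; field_simp
  have h4 : expDual μ f ν - expDual μ h ν ≤ ε * C := by
    have := Real.exp_pos M
    unfold expDual
    nlinarith
  linarith

lemma isClosed_klDiv_le (μ : Measure E) [IsFiniteMeasure μ] {c : ℝ≥0∞} (hc : c ≠ ∞) :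
    IsClosed {ν : ProbabilityMeasure E | klDiv (ν : Measure E) μ ≤ c} := by
  have : {ν : ProbabilityMeasure E | klDiv (ν : Measure E) μ ≤ c} =
      ⋂ f : E →ᵇ ℝ, {ν : ProbabilityMeasure E | expDual μ f (ν : Measure E) ≤ c.toReal} := by
    ext ν
    simp only [Set.mem_iInter, Set.mem_ofPred_eq]
    constructor
    · intro h f
      have := (expDual_le_klDiv (μ := μ) (ν := ν) f.continuous.measurable
        f.norm_coe_le_norm).trans h
      exact (ENNReal.ofReal_le_iff_le_toReal hc).1 this
    · intro h
      by_contra! hlt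
      rw [← ENNReal.ofReal_toReal hc] at hlt
      obtain ⟨f, hf⟩ := exists_boundedContinuous_lt_expDual hlt
      exact absurd (h f) (not_le.2 hf)
  rw [this]
  exact isClosed_iInter fun f => isClosed_le (continuous_expDual μ f) continuous_const

end Duality

section Sanov

variable {E : Type*} [MeasurableSpace E]

/-- The empirical measure of finitely many points. -/
def empiricalMeasure {n : ℕ} (z : Fin n → E) : Measure E :=
  (n : ℝ≥0∞)⁻¹ • ∑ i : Fin n, Measure.dirac (z i)

lemma isProbabilityMeasure_empiricalMeasure {n : ℕ} (hn : n ≠ 0) (z : Fin n → E) :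
    IsProbabilityMeasure (empiricalMeasure z) := by
  constructor
  simp only [empiricalMeasure, Measure.smul_apply, Measure.finsetSum_apply, measure_univ,
    Finset.sum_const, Finset.card_univ, Fintype.card_fin, smul_eq_mul, nsmul_eq_mul, mul_one]
  exact ENNReal.inv_mul_cancel (by simpa using hn) (ENNReal.natCast_ne_top n)

open scoped Classical in
/-- The empirical measure as a probability measure (junk value for `n = 0`). -/
def empiricalProb [Inhabited E] {n : ℕ} (z : Fin n → E) : ProbabilityMeasure E :=
  if h : IsProbabilityMeasure (empiricalMeasure z) then ⟨empiricalMeasure z, h⟩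
  else ⟨Measure.dirac default, inferInstance⟩

lemma coe_empiricalProb [Inhabited E] {n : ℕ} (hn : n ≠ 0) (z : Fin n → E) :
    (empiricalProb z : Measure E) = empiricalMeasure z := by
  have h := isProbabilityMeasure_empiricalMeasure hn z
  exact congrArg Subtype.val (dif_pos h : empiricalProb z = _)

lemma integral_empiricalMeasure {n : ℕ} (z : Fin n → E) {f : E → ℝ} (hf : Measurable f) :
    ∫ x, f x ∂empiricalMeasure z = (∑ i, f (z i)) / n := by
  rw [empiricalMeasure, integral_smul_measure, integral_finsetSum_measure]
  · simp [integral_dirac' _ _ hf.stronglyMeasurable, div_eq_inv_mul]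
  · exact fun i _ => integrable_dirac' hf.stronglyMeasurable (by simp)

/-- The weak law of large numbers on finite products. -/
lemma tendsto_pi_abs_average_sub_integral (ν : Measure E) [IsProbabilityMeasure ν] {h : E → ℝ}
    (hm : Measurable h) (hi : Integrable h ν) {ε : ℝ} (hε : 0 < ε) :
    Tendsto (fun n : ℕ => Measure.pi (fun _ : Fin n => ν)
      {z | ε ≤ |(∑ i, h (z i)) / n - ∫ x, h x ∂ν|}) atTop (𝓝 0) := by
  set P := Measure.infinitePi (fun _ : ℕ => ν)
  have hev : ∀ i, P.map (fun ω => ω i) = ν := Measure.infinitePi_map_eval _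
  have hid : ∀ i, IdentDistrib (fun ω : ℕ → E => h (ω i)) (fun ω => h (ω 0)) P P := fun i => by
    refine ⟨(by fun_prop : Measurable fun ω : ℕ → E => h (ω i)).aemeasurable,
      (by fun_prop : Measurable fun ω : ℕ → E => h (ω 0)).aemeasurable, ?_⟩
    have key : ∀ j, P.map (fun ω : ℕ → E => h (ω j)) = ν.map h := fun j => by
      rw [← hev j, Measure.map_map hm (by fun_prop)]
      rfl
    rw [key, key]
  have hint0 : Integrable (fun ω : ℕ → E => h (ω 0)) P := by
    rw [← hev 0] at hi
    exact hi.comp_measurable (by fun_prop)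
  have hE : ∫ ω, h (ω 0) ∂P = ∫ x, h x ∂ν := by
    conv_rhs => rw [← hev 0]
    rw [integral_map (measurable_pi_apply 0).aemeasurable hm.aestronglyMeasurable]
  have hlaw := strong_law_ae_real (μ := P) (fun i ω => h (ω i)) hint0
    (fun i j hij => (iIndepFun_infinitePi (fun _ => hm)).indepFun hij) hid
  have hmeas := tendstoInMeasure_of_tendsto_ae
    (f := fun (n : ℕ) (ω : ℕ → E) => (∑ i ∈ Finset.range n, h (ω i)) / n)
    (g := fun _ => ∫ ω, h (ω 0) ∂P) (μ := P)
    (fun n => (by fun_prop : Measurable fun ω : ℕ → E =>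
      (∑ i ∈ Finset.range n, h (ω i)) / n).aestronglyMeasurable) hlaw
  have := tendstoInMeasure_iff_dist.1 hmeas ε hε
  refine this.congr fun n => ?_
  have hmap : P.map (fun ω (i : Fin n) => ω i) = Measure.pi (fun _ : Fin n => ν) := by
    rw [Measure.map_infinitePi_infinitePi_of_inj Fin.val_injective, Measure.infinitePi_eq_pi]
  rw [← hmap, Measure.map_apply (by fun_prop) (measurableSet_le (by fun_prop) (by fun_prop)), hE]
  simp only [Real.dist_eq, Finset.sum_range]
  rfl

lemma pi_lt_sum_le (μ : Measure E) [IsProbabilityMeasure μ] {f : E → ℝ} (hf : Measurable f)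
    {M : ℝ} (hM : ∀ x, |f x| ≤ M) (a : ℝ) (n : ℕ) :
    Measure.pi (fun _ : Fin n => μ) {z | n * (a + ∫ x, (Real.exp (f x) - 1) ∂μ) < ∑ i, f (z i)}
      ≤ ENNReal.ofReal (Real.exp (-(n * a))) := by
  set b := a + ∫ x, (Real.exp (f x) - 1) ∂μ with hb
  have hi : Integrable (fun x => Real.exp (f x)) μ := by
    refine integrable_of_abs_le (M := Real.exp M) (by fun_prop) fun x => ?_
    rw [abs_of_pos (Real.exp_pos _)]
    exact Real.exp_le_exp.2 ((le_abs_self _).trans (hM x))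
  set P := Measure.pi (fun _ : Fin n => μ)
  have hprod : Integrable (fun z : Fin n → E => ∏ i, Real.exp (f (z i))) P :=
    Integrable.fintype_prod fun _ => hi
  have hval : ∫ z, ∏ i, Real.exp (f (z i)) ∂P = (∫ x, Real.exp (f x) ∂μ) ^ n := by
    rw [integral_fintype_prod_eq_pow (fun x => Real.exp (f x)), Fintype.card_fin]
  have hmarkov := mul_meas_ge_le_integral_of_nonneg
    (ae_of_all _ fun z => Finset.prod_nonneg fun i _ => (Real.exp_pos (f (z i))).le) hprod
    (Real.exp (n * b))
  have hexp : ∫ x, Real.exp (f x) ∂μ ≤ Real.exp (b - a) := by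
    have : ∫ x, (Real.exp (f x) - 1) ∂μ = ∫ x, Real.exp (f x) ∂μ - 1 := by
      rw [integral_sub hi (integrable_const 1)]
      simp
    have h2 := Real.add_one_le_exp (b - a)
    rw [hb, this] at h2 ⊢
    linarith
  have hpow : (∫ x, Real.exp (f x) ∂μ) ^ n ≤ Real.exp (n * (b - a)) := by
    rw [Real.exp_nat_mul]
    exact pow_le_pow_left₀ (integral_nonneg fun x => (Real.exp_pos _).le) hexp n
  have hreal : P.real {z | Real.exp (n * b) ≤ ∏ i, Real.exp (f (z i))}
      ≤ Real.exp (-(n * a)) := by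
    rw [hval] at hmarkov
    have h3 := hmarkov.trans hpow
    have h4 : Real.exp (n * (b - a)) = Real.exp (n * b) * Real.exp (-(n * a)) := by
      rw [← Real.exp_add]; ring_nf
    rw [h4] at h3
    exact le_of_mul_le_mul_left h3 (Real.exp_pos _)
  calc P {z | n * b < ∑ i, f (z i)}
      ≤ P {z | Real.exp (n * b) ≤ ∏ i, Real.exp (f (z i))} := by
        refine measure_mono fun z hz => ?_
        simp only [Set.mem_ofPred_eq, ← Real.exp_sum, Real.exp_le_exp] at hz ⊢
        exact hz.le
    _ = ENNReal.ofReal (P.real {z | Real.exp (n * b) ≤ ∏ i, Real.exp (f (z i))}) := by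
        simp
    _ ≤ _ := ENNReal.ofReal_le_ofReal hreal

lemma pi_withDensity {n : ℕ} (μ : Measure E) [IsProbabilityMeasure μ] {g : E → ℝ≥0∞}
    (hg : Measurable g) [IsProbabilityMeasure (μ.withDensity g)] :
    Measure.pi (fun _ : Fin n => μ.withDensity g)
      = (Measure.pi fun _ : Fin n => μ).withDensity fun z => ∏ i, g (z i) := by
  refine Measure.pi_eq fun s hs => ?_
  rw [withDensity_apply _ (MeasurableSet.univ_pi hs), ← lintegral_indicator (.univ_pi hs)]
  have h1 : ∀ z : Fin n → E, (Set.univ.pi s).indicator (fun z => ∏ i, g (z i)) z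
      = ∏ i, (s i).indicator g (z i) := fun z => by
    by_cases hz : z ∈ Set.univ.pi s
    · rw [Set.indicator_of_mem hz]
      exact Finset.prod_congr rfl fun i _ => (Set.indicator_of_mem (hz i trivial) g).symm
    · rw [Set.indicator_of_notMem hz]
      simp only [Set.mem_univ_pi, not_forall] at hz
      obtain ⟨i, hi⟩ := hz
      exact (Finset.prod_eq_zero (Finset.mem_univ i) (Set.indicator_of_notMem hi g)).symm
  simp_rw [h1]
  have hX : ∀ i, Measurable ((s i).indicator g) := fun i => hg.indicator (hs i)
  rw [lintegral_prod_eq_prod_lintegral_of_indepFun Finset.univ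
    (fun i (z : Fin n → E) => (s i).indicator g (z i))
    (iIndepFun_pi fun i => (hX i).aemeasurable) fun i => (hX i).comp (measurable_pi_apply i)]
  refine Finset.prod_congr rfl fun i _ => ?_
  rw [withDensity_apply _ (hs i), ← lintegral_indicator (hs i)]
  exact (measurePreserving_eval (fun _ : Fin n => μ) i).lintegral_comp (hX i)

/-- Change of measure from `ν` to `μ` on the event that the log-likelihood ratio is controlled. -/
lemma pi_inter_sum_llr_le (μ ν : Measure E) [IsProbabilityMeasure μ] [IsProbabilityMeasure ν]
    (hac : ν ≪ μ) {n : ℕ} (B : Set (Fin n → E)) (c : ℝ) :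
    Measure.pi (fun _ : Fin n => ν) (B ∩ {z | ∑ i, llr ν μ (z i) ≤ c})
      ≤ ENNReal.ofReal (Real.exp c) * Measure.pi (fun _ : Fin n => μ) B := by
  set g : E → ℝ≥0∞ := fun x => ENNReal.ofReal (ν.rnDeriv μ x).toReal with hg
  have hgm : Measurable g := by fun_prop
  have hν : μ.withDensity g = ν := by
    refine (withDensity_congr_ae ?_).trans (Measure.withDensity_rnDeriv_eq ν μ hac)
    filter_upwards [Measure.rnDeriv_ne_top ν μ] with x hx
    exact ENNReal.ofReal_toReal hx
  have : IsProbabilityMeasure (μ.withDensity g) := by rwa [hν]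
  set P := Measure.pi (fun _ : Fin n => μ)
  have hpi : Measure.pi (fun _ : Fin n => ν) = P.withDensity fun z => ∏ i, g (z i) := by
    rw [← pi_withDensity μ hgm, hν]
  have hllr := measurable_llr ν μ
  have hEm : MeasurableSet {z : Fin n → E | ∑ i, llr ν μ (z i) ≤ c} :=
    measurableSet_le (by fun_prop) measurable_const
  rw [hpi]
  calc _ ≤ (P.withDensity fun z => ∏ i, g (z i))
          (toMeasurable P B ∩ {z | ∑ i, llr ν μ (z i) ≤ c}) := by
        gcongr
        exact subset_toMeasurable P B
    _ = ∫⁻ z in toMeasurable P B ∩ {z | ∑ i, llr ν μ (z i) ≤ c}, ∏ i, g (z i) ∂P :=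
        withDensity_apply _ ((measurableSet_toMeasurable P B).inter hEm)
    _ ≤ ∫⁻ z in toMeasurable P B ∩ {z | ∑ i, llr ν μ (z i) ≤ c}, ENNReal.ofReal (Real.exp c) ∂P := by
        refine setLIntegral_mono measurable_const fun z hz => ?_
        rw [hg, ← ENNReal.ofReal_prod_of_nonneg fun i _ => ENNReal.toReal_nonneg]
        refine ENNReal.ofReal_le_ofReal ?_
        calc ∏ i, (ν.rnDeriv μ (z i)).toReal ≤ ∏ i, Real.exp (llr ν μ (z i)) :=
              Finset.prod_le_prod (fun i _ => ENNReal.toReal_nonneg) fun i _ => Real.le_exp_log _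
          _ ≤ Real.exp c := by
              rw [← Real.exp_sum]
              exact Real.exp_le_exp.2 hz.2
    _ = ENNReal.ofReal (Real.exp c) * P (toMeasurable P B ∩ {z | ∑ i, llr ν μ (z i) ≤ c}) := by
        rw [setLIntegral_const]
    _ ≤ _ := by
        rw [← measure_toMeasurable B]
        gcongr
        exact Set.inter_subset_left

variable [TopologicalSpace E] [BorelSpace E] [Inhabited E]

/-- The filter of sets of measures which the empirical measures of `ν` hit with
probability tending to one. -/
def empiricalFilter (ν : Measure E) [IsProbabilityMeasure ν] : Filter (ProbabilityMeasure E) where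
  sets := {U | Tendsto (fun n : ℕ => Measure.pi (fun _ : Fin n => ν)
    {z | empiricalProb z ∉ U}) atTop (𝓝 0)}
  univ_sets := by simp
  sets_of_superset {U V} hU hUV := by
    refine tendsto_of_tendsto_of_tendsto_of_le_of_le tendsto_const_nhds hU (fun _ => zero_le)
      fun n => measure_mono fun z hz hzU => hz (hUV hzU)
  inter_sets {U V} hU hV := by
    have hadd := Tendsto.add hU hV
    rw [add_zero] at hadd
    refine tendsto_of_tendsto_of_tendsto_of_le_of_le tendsto_const_nhds hadd (fun _ => zero_le)
      fun n => (measure_mono fun z hz => ?_).trans (measure_union_le _ _)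
    simp only [Set.mem_ofPred_eq, Set.mem_inter_iff, Set.mem_union] at hz ⊢
    tauto

lemma empiricalFilter_le_nhds (ν : ProbabilityMeasure E) :
    empiricalFilter (ν : Measure E) ≤ 𝓝 ν := by
  suffices Tendsto id (empiricalFilter (ν : Measure E)) (𝓝 ν) from this
  rw [ProbabilityMeasure.tendsto_iff_forall_integral_tendsto]
  intro f
  rw [Metric.tendsto_nhds]
  intro ε hε
  refine (tendsto_pi_abs_average_sub_integral (ν : Measure E) f.continuous.measurable
    (f.integrable _) hε).congr' ?_
  filter_upwards [eventually_ne_atTop 0] with n hn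
  simp [coe_empiricalProb hn, integral_empiricalMeasure _ f.continuous.measurable, Real.dist_eq]

/-- The lower bound in Sanov's theorem. -/
theorem eventually_exp_le_pi_empiricalProb_mem (μ : Measure E) [IsProbabilityMeasure μ]
    (ν : ProbabilityMeasure E) (hKL : klDiv (ν : Measure E) μ ≠ ∞) {U : Set (ProbabilityMeasure E)}
    (hU : U ∈ 𝓝 ν) {c : ℝ} (hc : (klDiv (ν : Measure E) μ).toReal < c) :
    ∀ᶠ n : ℕ in atTop, ENNReal.ofReal (Real.exp (-(n * c)))
      ≤ Measure.pi (fun _ : Fin n => μ) {z | empiricalProb z ∈ U} := by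
  obtain ⟨hac, hint⟩ := klDiv_ne_top_iff.1 hKL
  set D := (klDiv (ν : Measure E) μ).toReal with hD
  have hDval : ∫ x, llr ν μ x ∂ν = D := by
    rw [hD, toReal_klDiv_of_measure_eq hac (by simp)]
  have h1 : Tendsto (fun n : ℕ => Measure.pi (fun _ : Fin n => (ν : Measure E))
    {z | empiricalProb z ∉ U}) atTop (𝓝 0) := empiricalFilter_le_nhds ν hU
  have h2 := tendsto_pi_abs_average_sub_integral (ν : Measure E) (measurable_llr ν μ) hint
    (ε := (c - D) / 2) (by linarith)
  have h3 := h1.add h2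
  rw [add_zero] at h3
  have hexp : Tendsto (fun n : ℕ => Real.exp (-(n * ((c - D) / 2)))) atTop (𝓝 0) :=
    Real.tendsto_exp_neg_atTop_nhds_zero.comp
      (tendsto_natCast_atTop_atTop.atTop_mul_const (by linarith))
  filter_upwards [h3.eventually_lt_const (u := ENNReal.ofReal (1 / 2)) (by simp),
    hexp.eventually_lt_const (u := 1 / 2) (by norm_num), eventually_gt_atTop 0] with n hn1 hn2 hn
  set Q := Measure.pi (fun _ : Fin n => (ν : Measure E))
  set P := Measure.pi (fun _ : Fin n => μ)
  set B := {z : Fin n → E | empiricalProb z ∈ U}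
  set G := {z : Fin n → E | ∑ i, llr ν μ (z i) ≤ n * ((c + D) / 2)}
  have hn' : (0 : ℝ) < n := by exact_mod_cast hn
  have hcompl : Q (B ∩ G)ᶜ < ENNReal.ofReal (1 / 2) := by
    refine lt_of_le_of_lt ((measure_mono fun z hz => ?_).trans (measure_union_le _ _)) hn1
    rw [hDval]
    simp only [B, G, Set.mem_compl_iff, Set.mem_inter_iff, Set.mem_ofPred_eq, not_and_or,
      Set.mem_union, not_le] at hz ⊢
    refine hz.imp_right fun h => ?_
    rw [mul_comm, ← lt_div_iff₀ hn'] at h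
    exact le_trans (by linarith) (le_abs_self _)
  have hhalf : ENNReal.ofReal (1 / 2) ≤ Q (B ∩ G) := by
    have hone : (1 : ℝ≥0∞) ≤ Q (B ∩ G) + Q (B ∩ G)ᶜ := by
      rw [← measure_univ (μ := Q), ← Set.union_compl_self (B ∩ G)]
      exact measure_union_le _ _
    by_contra! hlt
    have := ENNReal.add_lt_add hlt hcompl
    rw [← ENNReal.ofReal_add (by norm_num) (by norm_num)] at this
    norm_num at this
    exact absurd hone (not_le.2 this)
  have hkey := hhalf.trans (pi_inter_sum_llr_le μ ν hac B (n * ((c + D) / 2)))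
  have hsplit : ENNReal.ofReal (Real.exp (n * ((c + D) / 2))) *
      ENNReal.ofReal (Real.exp (-(n * c))) ≤ ENNReal.ofReal (1 / 2) := by
    rw [← ENNReal.ofReal_mul (Real.exp_pos _).le, ← Real.exp_add]
    refine ENNReal.ofReal_le_ofReal (le_trans (le_of_eq ?_) hn2.le)
    ring_nf
  refine (ENNReal.mul_le_mul_iff_right ?_ ENNReal.ofReal_ne_top).1 (hsplit.trans hkey)
  simpa using Real.exp_pos _

variable [TopologicalSpace.PseudoMetrizableSpace E]

/-- The upper bound in Sanov's theorem, for compact sets. -/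
theorem exists_pi_empiricalProb_mem_le (μ : Measure E) [IsProbabilityMeasure μ]
    {K : Set (ProbabilityMeasure E)} (hK : IsCompact K) {a : ℝ}
    (ha : ∀ ν ∈ K, ENNReal.ofReal a < klDiv (ν : Measure E) μ) :
    ∃ N : ℕ, ∀ n : ℕ, n ≠ 0 → Measure.pi (fun _ : Fin n => μ) {z | empiricalProb z ∈ K}
      ≤ N * ENNReal.ofReal (Real.exp (-(n * a))) := by
  choose! f hf using fun ν hν => exists_boundedContinuous_lt_expDual (ha ν hν)
  obtain ⟨t, ht⟩ := hK.elim_nhds_subcover'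
    (fun ν _ => {ρ : ProbabilityMeasure E | a < expDual μ (f ν) (ρ : Measure E)})
    (fun ν hν => (isOpen_lt continuous_const (continuous_expDual μ (f ν))).mem_nhds (hf ν hν))
  refine ⟨t.card, fun n hn => ?_⟩
  have hn' : (0 : ℝ) < n := by exact_mod_cast Nat.pos_of_ne_zero hn
  calc Measure.pi (fun _ : Fin n => μ) {z | empiricalProb z ∈ K}
      ≤ Measure.pi (fun _ : Fin n => μ) (⋃ ν ∈ t,
          {z | a < expDual μ (f ν) (empiricalProb z : Measure E)}) := by
        refine measure_mono fun z hz => ?_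
        simpa using ht hz
    _ ≤ ∑ ν ∈ t, Measure.pi (fun _ : Fin n => μ)
          {z | a < expDual μ (f ν) (empiricalProb z : Measure E)} := measure_biUnion_finset_le _ _
    _ ≤ ∑ ν ∈ t, ENNReal.ofReal (Real.exp (-(n * a))) := by
        refine Finset.sum_le_sum fun ν _ => le_trans (measure_mono fun z hz => ?_)
          (pi_lt_sum_le μ (f ν).continuous.measurable (f ν).norm_coe_le_norm a n)
        simp only [Set.mem_ofPred_eq, expDual, coe_empiricalProb hn,
          integral_empiricalMeasure _ (f ν).continuous.measurable] at hz ⊢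
        rw [mul_comm, ← lt_div_iff₀ hn']
        linarith
    _ = _ := by simp

end Sanov

section ContinuousCdf

variable {m : Measure ℝ} [IsProbabilityMeasure m]

lemma continuous_cdf (hm : ∀ x, m {x} = 0) : Continuous (cdf m) := by
  refine continuous_iff_continuousAt.2 fun x => ?_
  rw [(monotone_cdf m).continuousAt_iff_leftLim_eq_rightLim, StieltjesFunction.rightLim_eq]
  have h := (cdf m).measure_singleton x
  rw [measure_cdf, hm x, eq_comm, ENNReal.ofReal_eq_zero] at h
  exact le_antisymm ((monotone_cdf m).leftLim_le le_rfl) (by linarith)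

lemma exists_cdf_eq (hm : ∀ x, m {x} = 0) {t : ℝ} (h0 : 0 < t) (h1 : t < 1) :
    ∃ x, cdf m x = t :=
  mem_range_of_exists_le_of_exists_ge (continuous_cdf hm)
    ((tendsto_cdf_atBot m).eventually_le_const h0).exists
    ((tendsto_cdf_atTop m).eventually_const_le h1).exists

/-- The probability integral transform. -/
lemma map_cdf_eq_unif01 (hm : ∀ x, m {x} = 0) : m.map (cdf m) = unif01 := by
  have hmeas : Measurable (cdf m) := (monotone_cdf m).measurable
  have := Measure.isProbabilityMeasure_map (μ := m) hmeas.aemeasurable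
  refine Measure.ext_of_Iic _ _ fun t => ?_
  rw [Measure.map_apply hmeas measurableSet_Iic, unif01, Measure.restrict_apply measurableSet_Iic]
  rcases lt_or_ge t 0 with ht | ht
  · have h1 : cdf m ⁻¹' Set.Iic t = ∅ := by
      ext x
      simpa using ht.trans_le (cdf_nonneg m x)
    have h2 : Set.Iic t ∩ Set.Icc (0 : ℝ) 1 = ∅ := by
      ext x
      simp only [Set.mem_inter_iff, Set.mem_Iic, Set.mem_Icc, Set.mem_empty_iff_false, iff_false]
      intro h
      linarith [h.1, h.2.1]
    rw [h1, h2]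
    simp
  rcases le_or_gt 1 t with ht1 | ht1
  · have h1 : cdf m ⁻¹' Set.Iic t = Set.univ := by
      ext x
      simpa using (cdf_le_one m x).trans ht1
    have h2 : Set.Iic t ∩ Set.Icc (0 : ℝ) 1 = Set.Icc 0 1 :=
      Set.inter_eq_right.2 fun x hx => hx.2.trans ht1
    rw [h1, h2]
    simp
  have h2 : Set.Iic t ∩ Set.Icc (0 : ℝ) 1 = Set.Icc 0 t := by
    ext x
    simp only [Set.mem_inter_iff, Set.mem_Iic, Set.mem_Icc]
    exact ⟨fun h => ⟨h.2.1, h.1⟩, fun h => ⟨h.2, h.1, h.2.trans ht1.le⟩⟩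
  rw [h2, Real.volume_Icc, sub_zero]
  refine le_antisymm ?_ ?_
  · have hlim : Tendsto ENNReal.ofReal (𝓝[>] t) (𝓝 (ENNReal.ofReal t)) :=
      ENNReal.continuous_ofReal.continuousWithinAt
    refine ge_of_tendsto hlim ?_
    filter_upwards [Ioo_mem_nhdsGT ht1] with s hs
    obtain ⟨x, hx⟩ := exists_cdf_eq hm (ht.trans_lt hs.1) hs.2
    rw [← hx, ofReal_cdf]
    refine measure_mono fun y hy => ?_
    by_contra hxy
    exact absurd (hy.trans_lt hs.1) (not_lt.2 (hx ▸ monotone_cdf m (not_le.1 hxy).le))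
  · rcases ht.eq_or_lt with rfl | ht0
    · simp
    obtain ⟨x, hx⟩ := exists_cdf_eq hm ht0 ht1
    rw [← hx, ofReal_cdf, hx]
    exact measure_mono fun y hy => hx ▸ monotone_cdf m hy

/-- A continuous distribution function admits finite brackets of arbitrarily small size. -/
lemma exists_finset_cdf_bracketing (hm : ∀ x, m {x} = 0) {ε : ℝ} (hε : 0 < ε) :
    ∃ T : Finset ℝ, ∀ x,
      (1 ≤ cdf m x + ε ∨ ∃ t ∈ T, x ≤ t ∧ cdf m t ≤ cdf m x + ε) ∧
      (cdf m x ≤ ε ∨ ∃ t ∈ T, t ≤ x ∧ cdf m x ≤ cdf m t + ε) := by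
  obtain ⟨k, hk⟩ := exists_nat_gt (2 / ε)
  have hk0 : (0 : ℝ) < k := (by positivity : 0 < 2 / ε).trans hk
  have hkε : 2 / k < ε := by
    rw [div_lt_iff₀ hε] at hk
    rw [div_lt_iff₀ hk0]
    linarith
  have hex : ∀ j : ℕ, ∃ x, 0 < j → j < k → cdf m x = j / k := fun j => by
    by_cases h : 0 < j ∧ j < k
    · obtain ⟨x, hx⟩ := exists_cdf_eq hm (t := j / k) (div_pos (by exact_mod_cast h.1) hk0)
        ((div_lt_one hk0).2 (by exact_mod_cast h.2))
      exact ⟨x, fun _ _ => hx⟩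
    · exact ⟨0, fun h0 h1 => absurd ⟨h0, h1⟩ h⟩
  choose p hp using hex
  have hmono : ∀ {x y}, cdf m x < cdf m y → x ≤ y := fun {x y} h => by
    by_contra hxy
    exact absurd h (not_lt.2 (monotone_cdf m (not_le.1 hxy).le))
  refine ⟨(Finset.range k).image p, fun x => ?_⟩
  set j := ⌊k * cdf m x⌋₊ with hj
  have hjle : (j : ℝ) ≤ k * cdf m x := Nat.floor_le (mul_nonneg hk0.le (cdf_nonneg m x))
  have hjlt : k * cdf m x < j + 1 := Nat.lt_floor_add_one _
  have hjle' : (j : ℝ) / k ≤ cdf m x := by rwa [div_le_iff₀' hk0]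
  have hjlt' : cdf m x < (j + 1) / k := by rwa [lt_div_iff₀' hk0]
  have h2 : (2 : ℝ) / k = 1 / k + 1 / k := by ring
  have h1k : 0 < 1 / (k : ℝ) := by positivity
  have hadd : ((j : ℝ) + 1) / k = j / k + 1 / k := by ring
  constructor
  · rcases lt_or_ge (j + 1) k with h | h
    · have hpj := hp (j + 1) (by omega) h
      push_cast at hpj
      refine Or.inr ⟨p (j + 1), Finset.mem_image_of_mem p (Finset.mem_range.2 h),
        hmono (by rwa [hpj]), ?_⟩
      rw [hpj]
      linarith
    · left
      have : (k : ℝ) ≤ j + 1 := by exact_mod_cast h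
      have : 1 ≤ ((j : ℝ) + 1) / k := by rwa [one_le_div hk0]
      linarith
  · rcases le_or_gt j 1 with h | h
    · left
      have : (j : ℝ) ≤ 1 := by exact_mod_cast h
      have : ((j : ℝ) + 1) / k ≤ 2 / k := by gcongr; linarith
      linarith
    · have hjk : j ≤ k := by
        have h3 : (k : ℝ) * cdf m x ≤ k * 1 := by gcongr; exact cdf_le_one m x
        exact_mod_cast hjle.trans (h3.trans_eq (mul_one _))
      have hpj := hp (j - 1) (by omega) (by omega)
      rw [Nat.cast_sub h.le, Nat.cast_one, sub_div] at hpj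
      refine Or.inr ⟨p (j - 1), Finset.mem_image_of_mem p (Finset.mem_range.2 (by omega)),
        hmono (by rw [hpj]; linarith), ?_⟩
      rw [hpj]
      linarith

/-- Pólya's theorem: weak convergence to an atomless limit implies uniform convergence of the
distribution functions. -/
lemma tendstoUniformly_cdf {ι : Type*} {l : Filter ι} {ρ : ι → ProbabilityMeasure ℝ}
    {ρ₀ : ProbabilityMeasure ℝ} (hm : ∀ x, (ρ₀ : Measure ℝ) {x} = 0) (hρ : Tendsto ρ l (𝓝 ρ₀)) :
    TendstoUniformly (fun i x => cdf (ρ i : Measure ℝ) x) (cdf (ρ₀ : Measure ℝ)) l := by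
  have hpt : ∀ x, Tendsto (fun i => cdf (ρ i : Measure ℝ) x) l (𝓝 (cdf (ρ₀ : Measure ℝ) x)) := by
    intro x
    simp only [cdf_eq_real, measureReal_def]
    refine (ENNReal.tendsto_toReal (measure_ne_top _ _)).comp
      (ProbabilityMeasure.tendsto_measure_of_null_frontier_of_tendsto' hρ ?_)
    rw [frontier_Iic]
    exact hm x
  rw [Metric.tendstoUniformly_iff]
  intro ε hε
  obtain ⟨T, hT⟩ := exists_finset_cdf_bracketing hm (half_pos (half_pos hε))
  have hev : ∀ᶠ i in l, ∀ t ∈ T, |cdf (ρ i : Measure ℝ) t - cdf (ρ₀ : Measure ℝ) t| < ε / 2 := by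
    rw [Finset.eventually_all]
    exact fun t _ => (Metric.tendsto_nhds.1 (hpt t)) _ (half_pos hε)
  filter_upwards [hev] with i hi x
  rw [Real.dist_eq, abs_sub_comm, abs_lt]
  obtain ⟨hu, hl⟩ := hT x
  have h0 := cdf_nonneg (ρ i : Measure ℝ) x
  have h1 := cdf_le_one (ρ i : Measure ℝ) x
  constructor
  · rcases hl with hl | ⟨t, ht, htx, htb⟩
    · linarith
    · have := (abs_lt.1 (hi t ht)).1
      have := monotone_cdf (ρ i : Measure ℝ) htx
      linarith
  · rcases hu with hu | ⟨t, ht, htx, htb⟩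
    · linarith
    · have := (abs_lt.1 (hi t ht)).2
      have := monotone_cdf (ρ i : Measure ℝ) htx
      linarith

end ContinuousCdf

lemma KL_eq_klDiv (ν μ : Measure Ω2) [IsFiniteMeasure ν] [IsFiniteMeasure μ] :
    KL ν μ = klDiv ν μ := by
  rw [klDiv_eq_lintegral_klFun]
  rfl

lemma isCompact_unitSq : IsCompact unitSq := isCompact_Icc.prod isCompact_Icc

lemma measurableSet_unitSq : MeasurableSet unitSq := measurableSet_Icc.prod measurableSet_Icc

lemma isCompact_Pcal : IsCompact Pcal := by
  have h := isCompact_setOfPred_probabilityMeasure_mass_eq_compl_isCompact_le (E := Ω2)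
    (u := fun _ => 0) (K := fun _ => unitSq) tendsto_const_nhds (fun _ => isCompact_unitSq)
    (Or.inr monotone_const)
  convert h using 1
  ext ρ
  have h1 : ρ unitSqᶜ ≤ 0 ↔ (ρ : Measure Ω2) unitSqᶜ = 0 := by
    rw [nonpos_iff_eq_zero, ← ENNReal.coe_eq_zero, ProbabilityMeasure.ennreal_coeFn_eq_coeFn_toMeasure]
  simp only [Pcal, Set.mem_ofPred_eq, forall_const, h1]
  exact (prob_compl_eq_zero_iff measurableSet_unitSq).symm

lemma mem_Pcal_of_absolutelyContinuous {μ ν : ProbabilityMeasure Ω2} (hμ : μ ∈ Pcal)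
    (h : (ν : Measure Ω2) ≪ μ) : ν ∈ Pcal :=
  (prob_compl_eq_zero_iff measurableSet_unitSq).1
    (h ((prob_compl_eq_zero_iff measurableSet_unitSq).2 hμ))

lemma mem_Mcal_of_absolutelyContinuous {μ ν : ProbabilityMeasure Ω2} (hμ : μ ∈ Mcal)
    (h : (ν : Measure Ω2) ≪ μ) : ν ∈ Mcal :=
  ⟨mem_Pcal_of_absolutelyContinuous hμ.1 h, fun x => h.map measurable_fst (hμ.2.1 x),
    fun y => h.map measurable_snd (hμ.2.2 y)⟩

/-- The coordinatewise distribution functions of a measure on the plane. -/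
def marginalCdf (ρ : Measure Ω2) (p : Ω2) : Ω2 := (cdfX ρ p.1, cdfY ρ p.2)

lemma Omap_eq_map (ρ : Measure Ω2) : Omap ρ = ρ.map (marginalCdf ρ) := rfl

section Omap

variable (ρ : Measure Ω2) [IsProbabilityMeasure ρ]

lemma cdfX_eq : cdfX ρ = cdf (ρ.map Prod.fst) := by
  have := Measure.isProbabilityMeasure_map (μ := ρ) measurable_fst.aemeasurable
  funext x
  rw [cdf_eq_real, measureReal_def, Measure.map_apply measurable_fst measurableSet_Iic]
  rfl

lemma cdfY_eq : cdfY ρ = cdf (ρ.map Prod.snd) := by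
  have := Measure.isProbabilityMeasure_map (μ := ρ) measurable_snd.aemeasurable
  funext x
  rw [cdf_eq_real, measureReal_def, Measure.map_apply measurable_snd measurableSet_Iic]
  rfl

lemma measurable_cdfX : Measurable (cdfX ρ) := cdfX_eq ρ ▸ (monotone_cdf _).measurable

lemma measurable_cdfY : Measurable (cdfY ρ) := cdfY_eq ρ ▸ (monotone_cdf _).measurable

lemma measurable_marginalCdf : Measurable (marginalCdf ρ) :=
  ((measurable_cdfX ρ).comp measurable_fst).prodMk ((measurable_cdfY ρ).comp measurable_snd)

lemma marginalCdf_mem_unitSq (p : Ω2) : marginalCdf ρ p ∈ unitSq := by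
  rw [marginalCdf, cdfX_eq, cdfY_eq]
  exact ⟨⟨cdf_nonneg _ _, cdf_le_one _ _⟩, ⟨cdf_nonneg _ _, cdf_le_one _ _⟩⟩

instance isProbabilityMeasure_Omap : IsProbabilityMeasure (Omap ρ) :=
  Measure.isProbabilityMeasure_map (measurable_marginalCdf ρ).aemeasurable

end Omap

/-- `Omap` as a map between spaces of probability measures. -/
def OmapProb (ρ : ProbabilityMeasure Ω2) : ProbabilityMeasure Ω2 :=
  ⟨Omap (ρ : Measure Ω2), isProbabilityMeasure_Omap _⟩

lemma coe_OmapProb (ρ : ProbabilityMeasure Ω2) : (OmapProb ρ : Measure Ω2) = Omap ρ := rfl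

lemma OmapProb_mem_Mtilde {ν : ProbabilityMeasure Ω2} (hν : ν ∈ Mcal) : OmapProb ν ∈ Mtilde := by
  have hX := Measure.isProbabilityMeasure_map (μ := (ν : Measure Ω2)) measurable_fst.aemeasurable
  have hY := Measure.isProbabilityMeasure_map (μ := (ν : Measure Ω2)) measurable_snd.aemeasurable
  refine ⟨?_, ?_, ?_⟩
  · rw [Pcal, Set.mem_ofPred_eq, coe_OmapProb, Omap_eq_map,
      Measure.map_apply (measurable_marginalCdf _) measurableSet_unitSq,
      Set.eq_univ_of_forall (s := marginalCdf (ν : Measure Ω2) ⁻¹' unitSq)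
        (marginalCdf_mem_unitSq _), measure_univ]
  · rw [coe_OmapProb, Omap_eq_map, Measure.map_map measurable_fst (measurable_marginalCdf _),
      ← map_cdf_eq_unif01 hν.2.1, Measure.map_map (monotone_cdf _).measurable measurable_fst,
      ← cdfX_eq]
    rfl
  · rw [coe_OmapProb, Omap_eq_map, Measure.map_map measurable_snd (measurable_marginalCdf _),
      ← map_cdf_eq_unif01 hν.2.2, Measure.map_map (monotone_cdf _).measurable measurable_snd,
      ← cdfY_eq]
    rfl

lemma continuous_marginalCdf {ν : ProbabilityMeasure Ω2} (hν : ν ∈ Mcal) :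
    Continuous (marginalCdf (ν : Measure Ω2)) := by
  have hX := Measure.isProbabilityMeasure_map (μ := (ν : Measure Ω2)) measurable_fst.aemeasurable
  have hY := Measure.isProbabilityMeasure_map (μ := (ν : Measure Ω2)) measurable_snd.aemeasurable
  have h1 := continuous_cdf hν.2.1
  have h2 := continuous_cdf hν.2.2
  rw [← cdfX_eq] at h1
  rw [← cdfY_eq] at h2
  exact (h1.comp continuous_fst).prodMk (h2.comp continuous_snd)

lemma tendstoUniformly_marginalCdf {ν : ProbabilityMeasure Ω2} (hν : ν ∈ Mcal) :
    TendstoUniformly (fun ρ : ProbabilityMeasure Ω2 => marginalCdf (ρ : Measure Ω2))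
      (marginalCdf (ν : Measure Ω2)) (𝓝 ν) := by
  have h1 := tendstoUniformly_cdf (ρ₀ := ν.map measurable_fst.aemeasurable)
    (by simpa using hν.2.1)
    ((ProbabilityMeasure.continuous_map continuous_fst).tendsto ν)
  have h2 := tendstoUniformly_cdf (ρ₀ := ν.map measurable_snd.aemeasurable)
    (by simpa using hν.2.2)
    ((ProbabilityMeasure.continuous_map continuous_snd).tendsto ν)
  simp only [ProbabilityMeasure.toMeasure_map, ← cdfX_eq, ← cdfY_eq] at h1 h2
  rw [Metric.tendstoUniformly_iff] at h1 h2 ⊢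
  intro ε hε
  filter_upwards [h1 ε hε, h2 ε hε] with ρ hρ1 hρ2 p
  rw [Prod.dist_eq]
  exact max_lt (hρ1 p.1) (hρ2 p.2)

lemma continuousAt_OmapProb {ν : ProbabilityMeasure Ω2} (hν : ν ∈ Mcal) :
    ContinuousAt OmapProb ν := by
  rw [ContinuousAt, ProbabilityMeasure.tendsto_iff_forall_integral_tendsto]
  intro f
  have hf : ∀ ρ : ProbabilityMeasure Ω2,
      ∫ p, f p ∂(OmapProb ρ : Measure Ω2) = ∫ p, f (marginalCdf (ρ : Measure Ω2) p) ∂ρ := fun ρ => by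
    rw [coe_OmapProb, Omap_eq_map, integral_map (measurable_marginalCdf _).aemeasurable
      f.continuous.measurable.aestronglyMeasurable]
  simp only [hf]
  have h1 : Tendsto (fun ρ : ProbabilityMeasure Ω2 => ∫ p, f (marginalCdf (ν : Measure Ω2) p) ∂ρ)
      (𝓝 ν) (𝓝 (∫ p, f (marginalCdf (ν : Measure Ω2) p) ∂ν)) :=
    ProbabilityMeasure.tendsto_iff_forall_integral_tendsto.1 tendsto_id
      (f.compContinuous ⟨_, continuous_marginalCdf hν⟩)
  have h2 := (isCompact_unitSq.uniformContinuousOn_of_continuous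
    f.continuous.continuousOn).comp_tendstoUniformly
    (fun (ρ : ProbabilityMeasure Ω2) p => marginalCdf_mem_unitSq (ρ : Measure Ω2) p)
    (fun p => marginalCdf_mem_unitSq (ν : Measure Ω2) p) (tendstoUniformly_marginalCdf hν)
  have h3 : Tendsto (fun ρ : ProbabilityMeasure Ω2 => ∫ p, f (marginalCdf (ρ : Measure Ω2) p) ∂ρ
      - ∫ p, f (marginalCdf (ν : Measure Ω2) p) ∂ρ) (𝓝 ν) (𝓝 0) := by
    rw [Metric.tendsto_nhds]
    intro ε hε
    filter_upwards [Metric.tendstoUniformly_iff.1 h2 _ (half_pos hε)] with ρ hρ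
    have hint : ∀ σ : ProbabilityMeasure Ω2,
        Integrable (fun p => f (marginalCdf (σ : Measure Ω2) p)) (ρ : Measure Ω2) := fun σ =>
      integrable_of_abs_le (f.continuous.measurable.comp (measurable_marginalCdf _))
        fun p => f.norm_coe_le_norm _
    rw [← integral_sub (hint ρ) (hint ν), dist_zero_right]
    refine lt_of_le_of_lt (norm_integral_le_of_norm_le_const (C := ε / 2)
      (ae_of_all _ fun p => ?_)) (by simpa using hε)
    have h4 := (hρ p).le
    rwa [dist_comm, dist_eq_norm] at h4
  simpa using h3.add h1

section InducedPermutation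

lemma prod_self_diagonal_eq_zero (m : Measure ℝ) [IsProbabilityMeasure m] (hm : ∀ x, m {x} = 0) :
    m.prod m {p | p.1 = p.2} = 0 := by
  rw [Measure.measure_prod_null (measurableSet_eq_fun measurable_fst measurable_snd)]
  refine ae_of_all _ fun x => ?_
  have : Prod.mk x ⁻¹' {p : ℝ × ℝ | p.1 = p.2} = {x} := by
    ext y
    simp [eq_comm]
  change m (Prod.mk x ⁻¹' {p : ℝ × ℝ | p.1 = p.2}) = 0
  rw [this, hm]

lemma ae_pi_injective_comp {E : Type*} [MeasurableSpace E] (μ : Measure E) [IsProbabilityMeasure μ]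
    {X : E → ℝ} (hX : Measurable X) (hat : ∀ x, μ.map X {x} = 0) (n : ℕ) :
    ∀ᵐ z ∂Measure.pi (fun _ : Fin n => μ), Function.Injective fun i => X (z i) := by
  have := Measure.isProbabilityMeasure_map (μ := μ) hX.aemeasurable
  set P := Measure.pi (fun _ : Fin n => μ)
  have hmap : ∀ i : Fin n, P.map (fun z => X (z i)) = μ.map X := fun i => by
    rw [← (measurePreserving_eval (fun _ : Fin n => μ) i).map_eq,
      Measure.map_map hX (measurable_pi_apply i)]
    rfl
  have hmeas : ∀ i : Fin n, Measurable fun z : Fin n → E => X (z i) := fun i => by fun_prop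
  have hpair : ∀ i j : Fin n, i ≠ j → ∀ᵐ z ∂P, X (z i) ≠ X (z j) := fun i j hij => by
    have hind : IndepFun (fun z : Fin n → E => X (z i)) (fun z => X (z j)) P :=
      (iIndepFun_pi (μ := fun _ : Fin n => μ) (X := fun _ => X)
        fun _ => hX.aemeasurable).indepFun hij
    have h := (indepFun_iff_map_prod_eq_prod_map_map (hmeas i).aemeasurable
      (hmeas j).aemeasurable).1 hind
    rw [hmap, hmap] at h
    have h0 := prod_self_diagonal_eq_zero (μ.map X) hat
    rw [← h, Measure.map_apply ((hmeas i).prodMk (hmeas j))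
      (measurableSet_eq_fun measurable_fst measurable_snd)] at h0
    exact measure_eq_zero_iff_ae_notMem.1 h0
  have hall : ∀ᵐ z ∂P, ∀ i j : Fin n, i ≠ j → X (z i) ≠ X (z j) := by
    simp only [ae_all_iff]
    exact hpair
  filter_upwards [hall] with z hz i j hij
  by_contra hne
  exact hz i j hne hij

lemma exists_perm_strictMono_comp {n : ℕ} {x : Fin n → ℝ} (hx : Function.Injective x) :
    ∃ τ : Equiv.Perm (Fin n), StrictMono fun i => x (τ i) :=
  ⟨Tuple.sort x, (Tuple.monotone_sort x).strictMono_of_injective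
    (hx.comp (Tuple.sort x).injective)⟩

lemma exists_hPat_eq_one {n : ℕ} {z : Fin n → Ω2} (h1 : Function.Injective fun i => (z i).1)
    (h2 : Function.Injective fun i => (z i).2) : ∃ σ : Equiv.Perm (Fin n), hPat σ z = 1 := by
  obtain ⟨τ₁, hτ₁⟩ := exists_perm_strictMono_comp h1
  obtain ⟨τ₂, hτ₂⟩ := exists_perm_strictMono_comp h2
  refine ⟨(τ₁⁻¹ * τ₂)⁻¹, if_pos ⟨τ₁, hτ₁, ?_⟩⟩
  simpa using hτ₂

lemma card_filter_le_of_strictMono {n : ℕ} {x : Fin n → ℝ} {e : Equiv.Perm (Fin n)}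
    (he : StrictMono fun i => x (e i)) (j : Fin n) :
    (Finset.univ.filter fun i => x i ≤ x (e j)).card = (j : ℕ) + 1 := by
  have h : (Finset.univ.filter fun i => x i ≤ x (e j)) = (Finset.Iic j).map e.toEmbedding := by
    ext i
    obtain ⟨k, rfl⟩ := e.surjective i
    simp [he.le_iff_le]
  rw [h, Finset.card_map, Fin.card_Iic]

lemma empiricalMeasure_toReal_setOf_le {E : Type*} [MeasurableSpace E] {n : ℕ} (z : Fin n → E)
    {X : E → ℝ} (hX : Measurable X) (t : ℝ) : (empiricalMeasure z {p | X p ≤ t}).toReal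
      = (Finset.univ.filter fun i => X (z i) ≤ t).card / n := by
  have hs : MeasurableSet {p | X p ≤ t} := measurableSet_le hX measurable_const
  simp [empiricalMeasure, Measure.smul_apply, Measure.finsetSum_apply, Measure.dirac_apply' _ hs,
    Set.indicator_apply, Finset.sum_boole, div_eq_inv_mul]

lemma map_empiricalMeasure {E F : Type*} [MeasurableSpace E] [MeasurableSpace F] {n : ℕ}
    (z : Fin n → E) {g : E → F} (hg : Measurable g) :
    (empiricalMeasure z).map g = empiricalMeasure fun i => g (z i) := by
  ext s hs
  simp [empiricalMeasure, Measure.map_apply hg hs, Measure.finsetSum_apply,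
    Measure.dirac_apply' _ hs, Measure.dirac_apply' _ (hg hs)]
  rfl

lemma empiricalMeasure_comp_perm {E : Type*} [MeasurableSpace E] {n : ℕ} (z : Fin n → E)
    (e : Equiv.Perm (Fin n)) : empiricalMeasure (fun i => z (e i)) = empiricalMeasure z := by
  rw [empiricalMeasure, empiricalMeasure, Equiv.sum_comp e fun i => Measure.dirac (z i)]

lemma EmM_eq_Omap_empiricalMeasure {n : ℕ} (hn : n ≠ 0) {z : Fin n → Ω2}
    {σ : Equiv.Perm (Fin n)} (h : hPat σ z = 1) : EmM σ = Omap (empiricalMeasure z) := by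
  have := isProbabilityMeasure_empiricalMeasure hn z
  have hex : ∃ τ : Equiv.Perm (Fin n),
      StrictMono (fun i => (z (τ i)).1) ∧ StrictMono (fun i => (z (τ (σ⁻¹ i))).2) := by
    by_contra hne
    rw [hPat, if_neg hne] at h
    exact zero_ne_one h
  obtain ⟨τ, hτ1, hτ2⟩ := hex
  rw [Omap_eq_map, map_empiricalMeasure _ (measurable_marginalCdf _),
    ← empiricalMeasure_comp_perm _ τ]
  have hpt : ∀ j, marginalCdf (empiricalMeasure z) (z (τ j))
      = ((((j : ℕ) + 1 : ℝ)) / n, (((σ j : ℕ) + 1 : ℝ)) / n) := fun j => by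
    have h1 := card_filter_le_of_strictMono (x := fun i => (z i).1) hτ1 j
    have h2 := card_filter_le_of_strictMono (x := fun i => (z i).2) (e := τ * σ⁻¹) hτ2 (σ j)
    have hσ : (τ * σ⁻¹) (σ j) = τ j := by simp
    rw [hσ] at h2
    rw [marginalCdf, cdfX, cdfY, empiricalMeasure_toReal_setOf_le z measurable_fst,
      empiricalMeasure_toReal_setOf_le z measurable_snd, h1, h2]
    push_cast
    rfl
  simp only [hpt]
  rfl

lemma ae_EmP_inducedPerm_eq {μ : ProbabilityMeasure Ω2} (hμ : μ ∈ Mcal) {n : ℕ} (hn : n ≠ 0) :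
    ∀ᵐ z ∂pmeas (μ : Measure Ω2) n, EmP (inducedPerm z) = OmapProb (empiricalProb z) := by
  filter_upwards [ae_pi_injective_comp (μ : Measure Ω2) measurable_fst hμ.2.1 n,
    ae_pi_injective_comp (μ : Measure Ω2) measurable_snd hμ.2.2 n] with z h1 h2
  have hex := exists_hPat_eq_one h1 h2
  have hσ : hPat (inducedPerm z) z = 1 := by
    rw [inducedPerm, dif_pos hex]
    exact hex.choose_spec
  have hEm := EmM_eq_Omap_empiricalMeasure hn hσ
  have := isProbabilityMeasure_empiricalMeasure hn z
  have hprob : IsProbabilityMeasure (EmM (inducedPerm z)) := hEm ▸ isProbabilityMeasure_Omap _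
  refine Subtype.ext ((congrArg Subtype.val (dif_pos hprob : EmP (inducedPerm z) = _)).trans ?_)
  change EmM (inducedPerm z) = Omap (empiricalProb z : Measure Ω2)
  rw [hEm, coe_empiricalProb hn]

lemma ae_empiricalProb_mem_Pcal {μ : ProbabilityMeasure Ω2} (hμ : μ ∈ Pcal) {n : ℕ} (hn : n ≠ 0) :
    ∀ᵐ z ∂pmeas (μ : Measure Ω2) n, empiricalProb z ∈ Pcal := by
  have hae : ∀ᵐ p ∂(μ : Measure Ω2), p ∈ unitSq :=
    (prob_compl_eq_zero_iff measurableSet_unitSq).2 hμ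
  have hall : ∀ᵐ z ∂pmeas (μ : Measure Ω2) n, ∀ i, z i ∈ unitSq := by
    rw [ae_all_iff]
    exact fun i => (measurePreserving_eval (fun _ : Fin n => (μ : Measure Ω2)) i).quasiMeasurePreserving.ae hae
  filter_upwards [hall] with z hz
  rw [Pcal, Set.mem_ofPred_eq, coe_empiricalProb hn]
  simp [empiricalMeasure, Measure.finsetSum_apply, Measure.dirac_apply' _ measurableSet_unitSq,
    Set.indicator_of_mem (hz _), ENNReal.inv_mul_cancel (Nat.cast_ne_zero.2 hn)]

end InducedPermutation

section LargeDeviations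

variable {μ : ProbabilityMeasure Ω2}

lemma mem_Mcal_of_klDiv_ne_top (hμ : μ ∈ Mcal) {ν : ProbabilityMeasure Ω2}
    (h : klDiv (ν : Measure Ω2) μ ≠ ∞) : ν ∈ Mcal :=
  mem_Mcal_of_absolutelyContinuous hμ (klDiv_ne_top_iff.1 h).1

lemma isCompact_klDiv_le (hμ : μ ∈ Pcal) {c : ℝ≥0∞} (hc : c ≠ ∞) :
    IsCompact {ν : ProbabilityMeasure Ω2 | klDiv (ν : Measure Ω2) μ ≤ c} :=
  isCompact_Pcal.of_isClosed_subset (isClosed_klDiv_le _ hc) fun _ hν =>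
    mem_Pcal_of_absolutelyContinuous hμ
      (klDiv_ne_top_iff.1 (ne_top_of_le_ne_top hc hν)).1

lemma Irate_OmapProb_le {ν : ProbabilityMeasure Ω2} (hν : ν ∈ Mcal) :
    Irate μ (OmapProb ν) ≤ klDiv (ν : Measure Ω2) μ := by
  rw [Irate, if_pos (OmapProb_mem_Mtilde hν), ← KL_eq_klDiv]
  exact iInf₂_le ν ⟨hν, rfl⟩

lemma exists_klDiv_lt_of_Irate_lt {γ : ProbabilityMeasure Ω2} {c : ℝ≥0∞} (h : Irate μ γ < c) :
    ∃ ν ∈ Mcal, OmapProb ν = γ ∧ klDiv (ν : Measure Ω2) μ < c := by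
  by_cases hγ : γ ∈ Mtilde
  · rw [Irate, if_pos hγ] at h
    obtain ⟨ν, h⟩ := iInf_lt_iff.1 h
    obtain ⟨⟨hν, hO⟩, h⟩ := iInf_lt_iff.1 h
    exact ⟨ν, hν, Subtype.ext hO, by rwa [← KL_eq_klDiv]⟩
  · rw [Irate, if_neg hγ] at h
    exact absurd h not_top_lt

lemma setOf_Irate_le_eq (hμ : μ ∈ Mcal) (c : ℝ≥0∞) :
    {γ | Irate μ γ ≤ c} = ⋂ b ∈ Set.Ioo c ∞,
      OmapProb '' {ν : ProbabilityMeasure Ω2 | klDiv (ν : Measure Ω2) μ ≤ b} := by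
  ext γ
  simp only [Set.mem_ofPred_eq, Set.mem_iInter]
  constructor
  · intro h b hb
    obtain ⟨ν, -, hO, hν⟩ := exists_klDiv_lt_of_Irate_lt (h.trans_lt hb.1)
    exact ⟨ν, hν.le, hO⟩
  · refine fun h => le_of_forall_gt_imp_ge_of_dense fun b hb => ?_
    rcases eq_or_ne b ∞ with rfl | hb'
    · exact le_top
    obtain ⟨ν, hν, rfl⟩ := h b ⟨hb, hb'.lt_top⟩
    exact (Irate_OmapProb_le (mem_Mcal_of_klDiv_ne_top hμ (ne_top_of_le_ne_top hb' hν))).trans hν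

lemma isCompact_Irate_le (hμ : μ ∈ Mcal) {c : ℝ≥0∞} (hc : c ≠ ∞) :
    IsCompact {γ : ProbabilityMeasure Ω2 | Irate μ γ ≤ c} := by
  have himg : ∀ b ∈ Set.Ioo c ∞, IsCompact
      (OmapProb '' {ν : ProbabilityMeasure Ω2 | klDiv (ν : Measure Ω2) μ ≤ b}) := fun b hb =>
    (isCompact_klDiv_le hμ.1 hb.2.ne).image_of_continuousOn fun ν hν =>
      (continuousAt_OmapProb (mem_Mcal_of_klDiv_ne_top hμ
        (ne_top_of_le_ne_top hb.2.ne hν))).continuousWithinAt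
  obtain ⟨b, hb⟩ := exists_between hc.lt_top
  rw [setOf_Irate_le_eq hμ]
  exact (himg b hb).of_isClosed_subset (isClosed_biInter fun b hb => (himg b hb).isClosed)
    (Set.biInter_subset_of_mem hb)

lemma lowerSemicontinuous_Irate (hμ : μ ∈ Mcal) : LowerSemicontinuous (Irate μ) := by
  refine lowerSemicontinuous_iff_isClosed_preimage.2 fun c => ?_
  rcases eq_or_ne c ∞ with rfl | hc
  · simp
  · exact (isCompact_Irate_le hμ hc).isClosed

lemma inv_mul_log_ofReal_exp {n : ℕ} (hn : n ≠ 0) (b : ℝ) :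
    (((n : ℝ)⁻¹ : ℝ) : EReal) * ENNReal.log (ENNReal.ofReal (Real.exp (-(n * b)))) = -(b : EReal) := by
  have hn' : (n : ℝ) ≠ 0 := Nat.cast_ne_zero.2 hn
  rw [ENNReal.log_ofReal_of_pos (Real.exp_pos _), Real.log_exp, ← EReal.coe_mul, ← EReal.coe_neg]
  congr 1
  field_simp

lemma monotone_inv_mul_log (n : ℕ) :
    Monotone fun p : ℝ≥0∞ => (((n : ℝ)⁻¹ : ℝ) : EReal) * ENNReal.log p := fun _ _ h =>
  mul_le_mul_of_nonneg_left (ENNReal.log_monotone h)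
    (EReal.coe_nonneg.2 (inv_nonneg.2 n.cast_nonneg))

lemma eventually_natCast_mul_exp_le (N : ℕ) {a b : ℝ} (hab : b < a) :
    ∀ᶠ n : ℕ in atTop, (N : ℝ≥0∞) * ENNReal.ofReal (Real.exp (-(n * a)))
      ≤ ENNReal.ofReal (Real.exp (-(n * b))) := by
  have hlim : Tendsto (fun n : ℕ => Real.exp (n * (a - b))) atTop atTop :=
    Real.tendsto_exp_atTop.comp (tendsto_natCast_atTop_atTop.atTop_mul_const (by linarith))
  filter_upwards [hlim.eventually_ge_atTop (N : ℝ)] with n hn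
  rw [← ENNReal.ofReal_natCast, ← ENNReal.ofReal_mul N.cast_nonneg]
  refine ENNReal.ofReal_le_ofReal ?_
  calc (N : ℝ) * Real.exp (-(n * a)) ≤ Real.exp (n * (a - b)) * Real.exp (-(n * a)) := by gcongr
    _ = Real.exp (-(n * b)) := by
      rw [← Real.exp_add]
      ring_nf

lemma ldp_lower_bound (hμ : μ ∈ Mcal) (A : Set (ProbabilityMeasure Ω2)) :
    -(⨅ γ ∈ interior A, ((Irate μ γ : ℝ≥0∞) : EReal)) ≤
      liminf (fun n : ℕ => (((n : ℝ)⁻¹ : ℝ) : EReal) *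
        ENNReal.log (pmeas (μ : Measure Ω2) n {z | EmP (inducedPerm z) ∈ A})) atTop := by
  refine EReal.neg_le.2 (le_iInf₂ fun γ hγ => EReal.le_of_forall_lt_iff_le.1 fun c hc => ?_)
  refine EReal.neg_le.2 (le_liminf_of_le (by isBoundedDefault) ?_)
  have hc' : Irate μ γ < ENNReal.ofReal c := by
    rw [← EReal.coe_ennreal_lt_coe_ennreal_iff, EReal.coe_ennreal_ofReal]
    exact hc.trans_le (EReal.coe_le_coe_iff.2 (le_max_left _ _))
  obtain ⟨ν, hν, rfl, hKL⟩ := exists_klDiv_lt_of_Irate_lt hc'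
  have hU : OmapProb ⁻¹' A ∈ 𝓝 ν :=
    (continuousAt_OmapProb hν).preimage_mem_nhds (mem_interior_iff_mem_nhds.1 hγ)
  filter_upwards [eventually_exp_le_pi_empiricalProb_mem (μ : Measure Ω2) ν hKL.ne_top hU
    ((ENNReal.lt_ofReal_iff_toReal_lt hKL.ne_top).1 hKL), eventually_ne_atTop 0] with n hn hn0
  rw [← inv_mul_log_ofReal_exp hn0]
  refine monotone_inv_mul_log n (hn.trans (measure_mono_ae ?_))
  filter_upwards [ae_EmP_inducedPerm_eq hμ hn0] with z hz hzU
  change EmP (inducedPerm z) ∈ A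
  rw [hz]
  exact hzU

lemma ldp_upper_bound (hμ : μ ∈ Mcal) (A : Set (ProbabilityMeasure Ω2)) :
    limsup (fun n : ℕ => (((n : ℝ)⁻¹ : ℝ) : EReal) *
        ENNReal.log (pmeas (μ : Measure Ω2) n {z | EmP (inducedPerm z) ∈ A})) atTop ≤
      -(⨅ γ ∈ closure A, ((Irate μ γ : ℝ≥0∞) : EReal)) := by
  refine EReal.le_neg.2 (EReal.ge_of_forall_gt_iff_ge.1 fun b hb => ?_)
  refine EReal.le_neg.2 (limsup_le_of_le (by isBoundedDefault) ?_)
  rcases lt_or_ge b 0 with hb0 | hb0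
  · filter_upwards with n
    have hp : pmeas (μ : Measure Ω2) n {z | EmP (inducedPerm z) ∈ A} ≤ 1 := by
      rw [pmeas]
      exact prob_le_one
    refine (monotone_inv_mul_log n hp).trans ?_
    simp only [ENNReal.log_one, mul_zero]
    exact_mod_cast (neg_pos.2 hb0).le
  obtain ⟨a, hba, ha⟩ := EReal.lt_iff_exists_real_btwn.1 hb
  replace hba : b < a := EReal.coe_lt_coe_iff.1 hba
  set K := closure (OmapProb ⁻¹' closure A) ∩ Pcal
  have hK : IsCompact K := isCompact_Pcal.inter_left isClosed_closure
  have hKa : ∀ ν ∈ K, ENNReal.ofReal a < klDiv (ν : Measure Ω2) μ := fun ν hν => by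
    by_contra! hle
    have hM := mem_Mcal_of_klDiv_ne_top hμ (ne_top_of_le_ne_top ENNReal.ofReal_ne_top hle)
    have hmem : OmapProb ν ∈ closure A := by
      rw [← closure_closure]
      exact (continuousAt_OmapProb hM).continuousWithinAt.mem_closure hν.1
        (Set.mapsTo_preimage _ _)
    refine absurd ha (not_lt.2 ((iInf₂_le _ hmem).trans ?_))
    have h1 := EReal.coe_ennreal_le_coe_ennreal_iff.2 ((Irate_OmapProb_le hM).trans hle)
    rwa [EReal.coe_ennreal_ofReal, max_eq_left (hb0.trans hba.le)] at h1
  obtain ⟨N, hN⟩ := exists_pi_empiricalProb_mem_le (μ : Measure Ω2) hK hKa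
  filter_upwards [eventually_natCast_mul_exp_le N hba, eventually_ne_atTop 0] with n hn hn0
  rw [← inv_mul_log_ofReal_exp hn0]
  refine monotone_inv_mul_log n (le_trans (measure_mono_ae ?_) ((hN n hn0).trans hn))
  filter_upwards [ae_EmP_inducedPerm_eq hμ hn0, ae_empiricalProb_mem_Pcal hμ.1 hn0] with z hz hzP hzA
  refine ⟨subset_closure (subset_closure ?_), hzP⟩
  rw [← hz]
  exact hzA

end LargeDeviations

end

/-- Theorem 1.5: `I_μ` is a good rate function and the `μ`-random
permutations satisfy an LDP with speed `n` and rate `I_μ`. -/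
theorem ldp_mu_random_permutations (μ : ProbabilityMeasure Ω2) (hμ : μ ∈ Mcal) :
    (LowerSemicontinuous (Irate μ) ∧
      ∀ c : ℝ≥0∞, c ≠ ∞ → IsCompact {γ : ProbabilityMeasure Ω2 | Irate μ γ ≤ c}) ∧
    ∀ A : Set (ProbabilityMeasure Ω2), MeasurableSet[borel (ProbabilityMeasure Ω2)] A →
      (-(⨅ γ ∈ interior A, ((Irate μ γ : ℝ≥0∞) : EReal)) ≤
          liminf (fun n : ℕ => (((n : ℝ)⁻¹ : ℝ) : EReal) *
            ENNReal.log (pmeas (↑μ) n {z | EmP (inducedPerm z) ∈ A})) atTop) ∧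
      limsup (fun n : ℕ => (((n : ℝ)⁻¹ : ℝ) : EReal) *
            ENNReal.log (pmeas (↑μ) n {z | EmP (inducedPerm z) ∈ A})) atTop ≤
        -(⨅ γ ∈ closure A, ((Irate μ γ : ℝ≥0∞) : EReal)) :=
  ⟨⟨lowerSemicontinuous_Irate hμ, fun _ hc => isCompact_Irate_le hμ hc⟩,
    fun A _ => ⟨ldp_lower_bound hμ A, ldp_upper_bound hμ A⟩⟩

end
end

section
/- Let π_n be uniformly distributed on S_n, let λ be Lebesgue measure on [0,1]², and define I : 𝒫 → [0,∞] by I(γ) := D(γ|λ) if γ ∈ ℳ̃ and I(γ) := ∞ otherwise. Then for every Borel set A ⊆ 𝒫, −inf_{γ∈A°} I(γ) ≤ liminf_{n→∞} (1/n) log P(Em(π_n) ∈ A) ≤ limsup_{n→∞} (1/n) log P(Em(π_n) ∈ A) ≤ −inf_{γ∈Ā} I(γ), where A° and Ā denote the interior and closure of A in the weak topology. -/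
open MeasureTheory Filter Topology
open scoped ENNReal

noncomputable section

open scoped Classical in
/-- `P(Em(π_n) ∈ A)` for a uniformly random permutation `π_n ∈ S_n`. -/
def probUnif (n : ℕ) (A : Set (ProbabilityMeasure Ω2)) : ℝ≥0∞ :=
  ((Finset.univ.filter fun π : Equiv.Perm (Fin n) => EmP π ∈ A).card : ℝ≥0∞) /
    (Fintype.card (Equiv.Perm (Fin n)) : ℝ≥0∞)

open scoped Classical in
/-- The rate function for uniformly random permutations. -/
def IrateUnif (γ : ProbabilityMeasure Ω2) : ℝ≥0∞ :=
  if γ ∈ Mtilde then KL (↑γ) lebSq else ∞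

namespace PermutonLDP

open scoped Nat

set_option linter.unusedSectionVars false

section Combinatorics

variable {α ι : Type*} [Fintype α] [DecidableEq α] [Fintype ι] [DecidableEq ι]

/-- The number of points of a finite type that `f` labels `c`. -/
def labelCount (f : α → ι) (c : ι) : ℕ := Fintype.card {i // f i = c}

/-- The number of permutations preserving a labelling. -/
def labelSymm (f : α → ι) : ℕ := ∏ c, (labelCount f c)!

/-- The pair of labels of a point and of its image under a permutation. -/
def pairLabel (f : α → ι) (π : Equiv.Perm α) (i : α) : ι × ι := (f i, f (π i))

lemma card_filter_comp_eq (f : α → ι) :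
    (Finset.univ.filter fun g : Equiv.Perm α => f ∘ g = f).card = labelSymm f := by
  rw [← Fintype.card_subtype]
  exact DomMulAct.stabilizer_card f

lemma sum_labelCount (f : α → ι) : ∑ c, labelCount f c = Fintype.card α := by
  unfold labelCount
  rw [← Fintype.card_sigma]
  exact Fintype.card_congr (Equiv.sigmaFiberEquiv f)

lemma sum_comp_label (f : α → ι) (F : ι → ℝ) :
    ∑ i, F (f i) = ∑ c, (labelCount f c : ℝ) * F c := by
  rw [← Finset.sum_fiberwise (s := Finset.univ) (g := f)]
  refine Finset.sum_congr rfl fun c _ => ?_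
  rw [Finset.sum_congr rfl (g := fun _ => F c)
    (fun i hi => by rw [(Finset.mem_filter.1 hi).2])]
  rw [Finset.sum_const, nsmul_eq_mul, labelCount, Fintype.card_subtype]

/-- Upper bound for the permanent of a matrix depending on columns only through their label. -/
lemma sum_perm_prod_label_le (f : α → ι) (M : α → ι → ℝ) (hM : ∀ i c, 0 ≤ M i c) :
    ∑ π : Equiv.Perm α, ∏ i, M i (f (π i)) ≤ (labelSymm f : ℝ) * ∏ i, ∑ c, M i c := by
  have h1 : ∑ π : Equiv.Perm α, ∏ i, M i (f (π i)) =
      ∑ w : α → ι, ∑ π ∈ Finset.univ.filter (fun π : Equiv.Perm α => f ∘ π = w),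
        ∏ i, M i (f (π i)) :=
    (Finset.sum_fiberwise _ _ _).symm
  have h2 : ∏ i, ∑ c, M i c = ∑ w : α → ι, ∏ i, M i (w i) := by
    rw [Finset.prod_univ_sum]; simp
  rw [h1, h2, Finset.mul_sum]
  refine Finset.sum_le_sum fun w _ => ?_
  rw [Finset.sum_congr rfl (g := fun _ => ∏ i, M i (w i)) (fun π hπ => by
    have := (Finset.mem_filter.1 hπ).2
    refine Finset.prod_congr rfl fun i _ => ?_
    rw [← this]; rfl)]
  rw [Finset.sum_const, nsmul_eq_mul]
  refine mul_le_mul_of_nonneg_right ?_ (Finset.prod_nonneg fun i _ => hM _ _)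
  rw [← card_filter_comp_eq]
  norm_cast
  rcases (Finset.univ.filter (fun π : Equiv.Perm α => f ∘ π = w)).eq_empty_or_nonempty with h | h
  · rw [h]; simp
  obtain ⟨π₀, h₀⟩ := h
  have h₀' := (Finset.mem_filter.1 h₀).2
  refine Finset.card_le_card_of_injOn (fun π => π * π₀⁻¹) (fun π hπ => ?_) ?_
  · have hπ' := (Finset.mem_filter.1 hπ).2
    simp only [Finset.coe_filter, Finset.mem_univ, true_and, Set.mem_ofPred_eq]
    funext i
    have := congrFun (hπ'.trans h₀'.symm) (π₀⁻¹ i)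
    simpa using this
  · intro a _ b _ hab
    simpa using hab

lemma labelCount_comp_perm (f : α → ι) (g : Equiv.Perm α) :
    labelCount (f ∘ g) = labelCount f := by
  funext c
  exact Fintype.card_congr (g.subtypeEquiv fun _ => Iff.rfl)

/-- Lower bound for the number of permutations with prescribed joint label counts. -/
lemma labelSymm_sq_le (f : α → ι) (π₀ : Equiv.Perm α) :
    labelSymm f * labelSymm f ≤ labelSymm (pairLabel f π₀) *
      (Finset.univ.filter fun π : Equiv.Perm α =>
        labelCount (pairLabel f π) = labelCount (pairLabel f π₀)).card := by
  set S := Finset.univ.filter fun g : Equiv.Perm α => f ∘ g = f with hS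
  have hmem : ∀ g : Equiv.Perm α, g ∈ S ↔ ∀ i, f (g i) = f i := fun g => by
    simp [hS, funext_iff]
  have hinv : ∀ g ∈ S, ∀ i, f (g⁻¹ i) = f i := fun g hg i => by
    have := (hmem g).1 hg (g⁻¹ i)
    simpa using this.symm
  rw [← card_filter_comp_eq, ← Finset.card_product]
  refine Finset.card_le_mul_card_image_of_maps_to
    (f := fun x : Equiv.Perm α × Equiv.Perm α => x.2 * π₀ * x.1) ?_ _ ?_
  · rintro ⟨g, h⟩ hx
    obtain ⟨hg, hh⟩ := Finset.mem_product.1 hx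
    have : pairLabel f (h * π₀ * g) = pairLabel f π₀ ∘ g := by
      funext i
      simp [pairLabel, (hmem _).1 hg i, (hmem _).1 hh (π₀ (g i))]
    simp [this, labelCount_comp_perm]
  · intro π _
    rw [← card_filter_comp_eq]
    rcases (Finset.filter (fun x : Equiv.Perm α × Equiv.Perm α => x.2 * π₀ * x.1 = π)
      (S ×ˢ S)).eq_empty_or_nonempty with h | h
    · rw [h]; simp
    obtain ⟨⟨g₁, h₁⟩, hx₁⟩ := h
    obtain ⟨hm₁, he₁⟩ := Finset.mem_filter.1 hx₁
    obtain ⟨hg₁, hh₁⟩ := Finset.mem_product.1 hm₁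
    simp only at he₁ hg₁ hh₁
    refine Finset.card_le_card_of_injOn (fun x => x.1 * g₁⁻¹) ?_ ?_
    · rintro ⟨g, h⟩ hx
      obtain ⟨hm, he⟩ := Finset.mem_filter.1 hx
      obtain ⟨hg, hh⟩ := Finset.mem_product.1 hm
      simp only at he hg hh
      simp only [Finset.coe_filter, Finset.mem_univ, true_and, Set.mem_ofPred_eq]
      funext i
      have e1 : h (π₀ (g (g₁⁻¹ i))) = h₁ (π₀ i) := by
        have := congrArg (fun p : Equiv.Perm α => p (g₁⁻¹ i)) (he.trans he₁.symm)
        simpa using this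
      simp only [pairLabel, Function.comp_apply, Equiv.Perm.mul_apply, Prod.mk.injEq]
      refine ⟨by rw [(hmem g).1 hg, hinv g₁ hg₁], ?_⟩
      rw [← (hmem h).1 hh, e1, (hmem h₁).1 hh₁]
    · rintro ⟨g, h⟩ hx ⟨g', h'⟩ hx' hgg
      have he := (Finset.mem_filter.1 hx).2
      have he' := (Finset.mem_filter.1 hx').2
      have hg : g = g' := by simpa using hgg
      subst hg
      have := he.trans he'.symm
      simpa using this

lemma exists_embedding_label {X : Type*} [Fintype X] (f : α → ι) (g : X → ι)
    (h : ∀ c, Fintype.card {x // g x = c} ≤ labelCount f c) :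
    ∃ e : X ↪ α, ∀ x, f (e x) = g x := by
  have hne : ∀ c, Nonempty ({x // g x = c} ↪ {i // f i = c}) := fun c =>
    Function.Embedding.nonempty_of_card_le (h c)
  let e := fun c => (hne c).some
  have he : ∀ x, f (e (g x) ⟨x, rfl⟩).1 = g x := fun x => (e (g x) ⟨x, rfl⟩).2
  refine ⟨⟨fun x => (e (g x) ⟨x, rfl⟩).1, fun x y hxy => ?_⟩, he⟩
  simp only at hxy
  have hg : g x = g y := by rw [← he x, ← he y, hxy]
  have key : ∀ c (hx : g x = c), (e (g x) ⟨x, rfl⟩).1 = (e c ⟨x, hx⟩).1 := by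
    intro c hx; subst hx; rfl
  rw [key _ hg] at hxy
  have := (e (g y)).injective (Subtype.ext hxy)
  simpa using this

/-- A permutation whose joint label counts dominate a prescribed nonnegative integer matrix
with small enough margins. -/
lemma exists_perm_labelCount_ge (f : α → ι) (m : ι × ι → ℕ)
    (hr : ∀ c, ∑ d, m (c, d) ≤ labelCount f c) (hc : ∀ d, ∑ c, m (c, d) ≤ labelCount f d) :
    ∃ π : Equiv.Perm α, ∀ p, m p ≤ labelCount (pairLabel f π) p := by
  let X := Σ p : ι × ι, Fin (m p)
  have hX1 : ∀ c, Fintype.card {x : X // x.1.1 = c} ≤ labelCount f c := by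
    intro c
    refine le_trans (le_of_eq ?_) (hr c)
    rw [Fintype.card_subtype, Finset.card_filter, Fintype.sum_sigma, Fintype.sum_prod_type,
      Finset.sum_eq_single c]
    · simp
    · intro b _ hb; simp [hb]
    · simp
  have hX2 : ∀ d, Fintype.card {x : X // x.1.2 = d} ≤ labelCount f d := by
    intro d
    refine le_trans (le_of_eq ?_) (hc d)
    rw [Fintype.card_subtype, Finset.card_filter, Fintype.sum_sigma, Fintype.sum_prod_type_right,
      Finset.sum_eq_single d]
    · simp
    · intro b _ hb; simp [hb]
    · simp
  obtain ⟨e₁, h₁⟩ := exists_embedding_label f (fun x : X => x.1.1) hX1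
  obtain ⟨e₂, h₂⟩ := exists_embedding_label f (fun x : X => x.1.2) hX2
  let E : {i // i ∈ Set.range e₁} ≃ {i // i ∈ Set.range e₂} :=
    (Equiv.ofInjective e₁ e₁.injective).symm.trans (Equiv.ofInjective e₂ e₂.injective)
  have hE : ∀ x, E.extendSubtype (e₁ x) = e₂ x := by
    intro x
    rw [Equiv.extendSubtype_apply_of_mem _ _ (Set.mem_range_self x)]
    have : (⟨e₁ x, Set.mem_range_self x⟩ : {i // i ∈ Set.range e₁}) =
      Equiv.ofInjective e₁ e₁.injective x := rfl
    rw [this]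
    simp [E]
  refine ⟨E.extendSubtype, fun p => ?_⟩
  rw [← Fintype.card_fin (m p)]
  refine Fintype.card_le_of_injective
    (fun t => ⟨e₁ ⟨p, t⟩, by simp [pairLabel, hE, h₁, h₂]⟩) fun s t hst => ?_
  exact eq_of_heq (Sigma.mk.inj_iff.1 (e₁.injective (Subtype.ext_iff.1 hst))).2

end Combinatorics

lemma abs_log_factorial_sub_le {m : ℕ} (hm : m ≠ 0) :
    |Real.log (m ! : ℝ) - (m * Real.log m - m)| ≤ 1 + Real.log m := by
  have hm1 : (1 : ℝ) ≤ m := by exact_mod_cast Nat.one_le_iff_ne_zero.2 hm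
  have hl : 0 ≤ Real.log m := Real.log_nonneg hm1
  have h1 := Stirling.le_log_factorial_stirling hm
  have h2 : 0 ≤ Real.log (2 * Real.pi) :=
    Real.log_nonneg (by nlinarith [Real.pi_gt_three])
  have h3 : Real.log (Stirling.stirlingSeq m) ≤ Real.log (Stirling.stirlingSeq 1) := by
    obtain ⟨k, rfl⟩ := Nat.exists_eq_succ_of_ne_zero hm
    exact Stirling.log_stirlingSeq'_antitone (Nat.zero_le k)
  rw [Stirling.log_stirlingSeq_formula, Stirling.log_stirlingSeq_formula,
    Real.log_div (by positivity) (by positivity), Real.log_mul (by norm_num) (by positivity)] at h3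
  simp at h3
  rw [abs_le]
  constructor <;> linarith

lemma tendsto_log_div_nat : Tendsto (fun n : ℕ => (1 + Real.log n) / n) atTop (𝓝 0) := by
  have h : Tendsto (fun x : ℝ => (1 + Real.log x) / x) atTop (𝓝 0) := by
    have h1 : Tendsto (fun x : ℝ => 1 / x) atTop (𝓝 0) := by
      simpa using tendsto_inv_atTop_zero (𝕜 := ℝ)
    have h2 : Tendsto (fun x : ℝ => Real.log x / x) atTop (𝓝 0) := by
      simpa using Real.tendsto_pow_log_div_mul_add_atTop 1 0 1 one_ne_zero
    simpa [add_div] using h1.add h2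
  exact h.comp tendsto_natCast_atTop_atTop

/-- The normalised logarithmic factorial. -/
def logFact (n m : ℕ) : ℝ := (Real.log (m ! : ℝ) - m * Real.log n + m) / n

lemma tendsto_logFact {m : ℕ → ℕ} {x : ℝ} (hmn : ∀ n, m n ≤ n)
    (hx : Tendsto (fun n => (m n : ℝ) / n) atTop (𝓝 x)) :
    Tendsto (fun n => logFact n (m n)) atTop (𝓝 (x * Real.log x)) := by
  have h1 : Tendsto (fun n => (m n : ℝ) / n * Real.log ((m n : ℝ) / n)) atTop
      (𝓝 (x * Real.log x)) :=
    (Real.continuous_mul_log.tendsto x).comp hx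
  have h2 : Tendsto (fun n => logFact n (m n) - (m n : ℝ) / n * Real.log ((m n : ℝ) / n))
      atTop (𝓝 0) := by
    refine squeeze_zero_norm' ?_ tendsto_log_div_nat
    filter_upwards [eventually_gt_atTop 0] with n hn
    have hn' : (0 : ℝ) < n := by exact_mod_cast hn
    have hn1 : (1 : ℝ) ≤ n := by exact_mod_cast hn
    have hl : 0 ≤ Real.log n := Real.log_nonneg hn1
    rw [Real.norm_eq_abs]
    by_cases h0 : m n = 0
    · simp [logFact, h0]; positivity
    have h0' : (0 : ℝ) < m n := by exact_mod_cast Nat.pos_of_ne_zero h0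
    have e : logFact n (m n) - (m n : ℝ) / n * Real.log ((m n : ℝ) / n) =
        (Real.log ((m n)! : ℝ) - (m n * Real.log (m n) - m n)) / n := by
      rw [logFact, Real.log_div h0'.ne' hn'.ne']
      field_simp
      ring
    rw [e, abs_div, abs_of_pos hn']
    gcongr
    refine (abs_log_factorial_sub_le h0).trans ?_
    have : Real.log (m n) ≤ Real.log n :=
      Real.log_le_log h0' (by exact_mod_cast hmn n)
    linarith
  simpa using h2.add h1

lemma log_factorial_eq {n : ℕ} (hn : n ≠ 0) (m : ℕ) :
    Real.log (m ! : ℝ) = n * logFact n m + m * Real.log n - m := by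
  have hn' : (n : ℝ) ≠ 0 := by exact_mod_cast hn
  rw [logFact]; field_simp; ring

lemma tendsto_div_of_sum_eq {ι : Type*} [Fintype ι] (N : ℕ → ι → ℕ) (p : ι → ℝ)
    (hp : ∑ x, p x = 1) (hN : ∀ n, ∑ x, N n x = n) (h : ∀ (n : ℕ) x, (n : ℝ) * p x - 1 ≤ N n x)
    (x : ι) : Tendsto (fun n => (N n x : ℝ) / n) atTop (𝓝 (p x)) := by
  classical
  have hupper : ∀ n, (N n x : ℝ) ≤ n * p x + Fintype.card ι := by
    intro n
    have h1 : ∑ y, ((N n y : ℝ) - (n * p y - 1)) = Fintype.card ι := by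
      rw [Finset.sum_sub_distrib, Finset.sum_sub_distrib, ← Finset.mul_sum, hp]
      have : (∑ y, (N n y : ℝ)) = n := by exact_mod_cast hN n
      rw [this]; simp
    have h2 : (N n x : ℝ) - (n * p x - 1) ≤ ∑ y, ((N n y : ℝ) - (n * p y - 1)) :=
      Finset.single_le_sum (f := fun y => (N n y : ℝ) - (n * p y - 1))
        (fun y _ => by linarith [h n y]) (Finset.mem_univ x)
    linarith
  have hz : Tendsto (fun n : ℕ => ((Fintype.card ι : ℝ) + 1) / n) atTop (𝓝 0) :=
    tendsto_const_div_atTop_nhds_zero_nat _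
  rw [tendsto_iff_norm_sub_tendsto_zero]
  refine squeeze_zero' (Eventually.of_forall fun _ => norm_nonneg _) ?_ hz
  filter_upwards [eventually_gt_atTop 0] with n hn
  have hn' : (0 : ℝ) < n := by exact_mod_cast hn
  have e : (N n x : ℝ) / n - p x = (N n x - n * p x) / n := by field_simp
  rw [e, Real.norm_eq_abs, abs_div, abs_of_pos hn']
  gcongr
  rw [abs_le]
  constructor
  · have := h n x
    have : (0 : ℝ) ≤ Fintype.card ι := by positivity
    linarith
  · linarith [hupper n]

/-- The index `a` of the interval `(a/(k+1), (a+1)/(k+1)]` containing `x`. -/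
def block (k : ℕ) (x : ℝ) : Fin (k + 1) := ⟨min (⌈((k : ℝ) + 1) * x⌉₊ - 1) k, by omega⟩

lemma block_eq_iff {k : ℕ} {x : ℝ} (h0 : 0 < x) (h1 : x ≤ 1) (a : Fin (k + 1)) :
    block k x = a ↔ (a : ℕ) < ((k : ℝ) + 1) * x ∧ ((k : ℝ) + 1) * x ≤ (a : ℕ) + 1 := by
  have hc : ⌈((k : ℝ) + 1) * x⌉₊ ≤ k + 1 := by
    rw [Nat.ceil_le]; push_cast; nlinarith [(Nat.cast_nonneg k : (0 : ℝ) ≤ k)]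
  have hp : 0 < ⌈((k : ℝ) + 1) * x⌉₊ := Nat.ceil_pos.2 (by positivity)
  have h := Nat.ceil_eq_iff (a := ((k : ℝ) + 1) * x) (Nat.succ_ne_zero (a : ℕ))
  push_cast [Nat.succ_eq_add_one] at h
  rw [← h, Fin.ext_iff, block]
  simp only
  omega

lemma block_zero (k : ℕ) : block k 0 = 0 := by
  simp [block]

lemma abs_sub_block_le (k : ℕ) {x : ℝ} (h0 : 0 ≤ x) (h1 : x ≤ 1) :
    |x - (block k x : ℕ) / ((k : ℝ) + 1)| ≤ 1 / ((k : ℝ) + 1) := by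
  have hk : (0 : ℝ) < (k : ℝ) + 1 := by positivity
  rcases h0.eq_or_lt with rfl | h0
  · rw [block_zero]; simp; positivity
  obtain ⟨h2, h3⟩ := (block_eq_iff h0 h1 _).1 rfl
  have e : x - (block k x : ℕ) / ((k : ℝ) + 1) =
      (((k : ℝ) + 1) * x - (block k x : ℕ)) / ((k : ℝ) + 1) := by field_simp
  rw [e, abs_div, abs_of_pos hk]
  gcongr
  rw [abs_le]; constructor <;> linarith

/-- The points `i/n` at which empirical measures of permutations are supported. -/
def gridPt {n : ℕ} (i : Fin n) : ℝ := ((i : ℕ) + 1 : ℝ) / n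

lemma gridPt_pos {n : ℕ} (i : Fin n) : 0 < gridPt i := by
  have : 0 < n := i.pos
  unfold gridPt; positivity

lemma gridPt_le_one {n : ℕ} (i : Fin n) : gridPt i ≤ 1 := by
  have h : (0 : ℝ) < n := by exact_mod_cast i.pos
  rw [gridPt, div_le_one h]
  exact_mod_cast i.2

/-- The block of a grid point. -/
def gridBlock (k n : ℕ) (i : Fin n) : Fin (k + 1) := block k (gridPt i)

lemma div_le_labelCount_gridBlock (k n : ℕ) (a : Fin (k + 1)) :
    n / (k + 1) ≤ labelCount (gridBlock k n) a := by
  set s := n * a / (k + 1) with hs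
  have ha : (a : ℕ) + 1 ≤ k + 1 := a.2
  have hq := Nat.div_mul_le_self n (k + 1)
  have hs1 := Nat.div_mul_le_self (n * a) (k + 1)
  have hs2 := Nat.lt_div_mul_add (a := n * a) (b := k + 1) (Nat.succ_pos k)
  rw [← hs] at hs1 hs2
  have hlt : ∀ t : Fin (n / (k + 1)), s + t < n := by
    intro t
    have ht : (t : ℕ) + 1 ≤ n / (k + 1) := t.2
    have : (s + t) * (k + 1) + (k + 1) ≤ n * (k + 1) := by
      calc (s + t) * (k + 1) + (k + 1) = s * (k + 1) + (t + 1) * (k + 1) := by ring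
        _ ≤ n * a + n / (k + 1) * (k + 1) := by gcongr
        _ ≤ n * a + n := by gcongr
        _ = n * (a + 1) := by ring
        _ ≤ n * (k + 1) := by gcongr
    by_contra hcon
    push Not at hcon
    have := Nat.mul_le_mul_right (k + 1) hcon
    linarith
  rw [labelCount, ← Fintype.card_fin (n / (k + 1))]
  refine Fintype.card_le_of_injective
    (fun t => ⟨⟨s + t, hlt t⟩, ?_⟩) fun t t' htt => ?_
  · have hn : (0 : ℝ) < n := by
      have := hlt t
      exact_mod_cast (Nat.zero_le _).trans_lt this
    have ht : (t : ℕ) + 1 ≤ n / (k + 1) := t.2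
    rw [gridBlock, block_eq_iff (gridPt_pos _) (gridPt_le_one _), gridPt, ← mul_div_assoc,
      lt_div_iff₀ hn, div_le_iff₀ hn]
    have e1 : (a : ℕ) * n < (k + 1) * (s + t + 1) := by nlinarith
    have e2 : (k + 1) * (s + t + 1) ≤ ((a : ℕ) + 1) * n := by nlinarith
    constructor
    · exact_mod_cast e1
    · exact_mod_cast e2
  · simp only [Subtype.mk.injEq, Fin.mk.injEq, add_right_inj] at htt
    exact Fin.ext htt

lemma sum_labelCount_gridBlock (k n : ℕ) : ∑ a, labelCount (gridBlock k n) a = n := by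
  rw [sum_labelCount, Fintype.card_fin]

lemma tendsto_labelCount_gridBlock (k : ℕ) (a : Fin (k + 1)) :
    Tendsto (fun n : ℕ => (labelCount (gridBlock k n) a : ℝ) / n) atTop
      (𝓝 (1 / ((k : ℝ) + 1))) := by
  refine tendsto_div_of_sum_eq (fun n => labelCount (gridBlock k n))
    (fun _ => 1 / ((k : ℝ) + 1)) ?_ (sum_labelCount_gridBlock k) (fun (n : ℕ) b => ?_) a
  · simp; field_simp
  · have h1 := div_le_labelCount_gridBlock k n b
    have h2 := Nat.lt_div_mul_add (a := n) (b := k + 1) (Nat.succ_pos k)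
    have hk : (0 : ℝ) < (k : ℝ) + 1 := by positivity
    have h3 : (n : ℝ) < (n / (k + 1) : ℕ) * ((k : ℝ) + 1) + ((k : ℝ) + 1) := by exact_mod_cast h2
    have h4 : ((n / (k + 1) : ℕ) : ℝ) ≤ labelCount (gridBlock k n) b := by exact_mod_cast h1
    have : (n : ℝ) * (1 / ((k : ℝ) + 1)) < (n / (k + 1) : ℕ) + 1 := by
      rw [mul_one_div, div_lt_iff₀ hk]; linarith
    linarith

lemma labelCount_le {n : ℕ} {ι : Type*} [Fintype ι] [DecidableEq ι] (f : Fin n → ι) (c : ι) :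
    labelCount f c ≤ n := by
  simpa [labelCount] using Fintype.card_subtype_le (fun i => f i = c)

/-- The cell of the grid of mesh `1/(k+1)` containing a point of the unit square. -/
def cell (k : ℕ) (p : Ω2) : Fin (k + 1) × Fin (k + 1) := (block k p.1, block k p.2)

/-- The lower left corner of a cell. -/
def corner (k : ℕ) (q : Fin (k + 1) × Fin (k + 1)) : Ω2 :=
  ((q.1 : ℕ) / ((k : ℝ) + 1), (q.2 : ℕ) / ((k : ℝ) + 1))

/-- The points of the plot of a permutation, rescaled to the unit square. -/
def permPt {n : ℕ} (π : Equiv.Perm (Fin n)) (i : Fin n) : Ω2 := (gridPt i, gridPt (π i))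

lemma permPt_mem {n : ℕ} (π : Equiv.Perm (Fin n)) (i : Fin n) : permPt π i ∈ unitSq :=
  ⟨⟨(gridPt_pos _).le, gridPt_le_one _⟩, ⟨(gridPt_pos _).le, gridPt_le_one _⟩⟩

lemma EmM_eq {n : ℕ} (π : Equiv.Perm (Fin n)) :
    EmM π = (n : ℝ≥0∞)⁻¹ • ∑ i : Fin n, Measure.dirac (permPt π i) := rfl

lemma isProbabilityMeasure_EmM {n : ℕ} (hn : n ≠ 0) (π : Equiv.Perm (Fin n)) :
    IsProbabilityMeasure (EmM π) := by
  constructor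
  rw [EmM_eq]
  simp [Measure.finsetSum_apply]
  exact ENNReal.inv_mul_cancel (by exact_mod_cast hn) (ENNReal.natCast_ne_top n)

lemma coe_EmP {n : ℕ} (hn : n ≠ 0) (π : Equiv.Perm (Fin n)) :
    (EmP π : Measure Ω2) = EmM π := by
  have h : EmP π = ⟨EmM π, isProbabilityMeasure_EmM hn π⟩ := dif_pos _
  rw [h]
  rfl

lemma integral_EmP {n : ℕ} (hn : n ≠ 0) (π : Equiv.Perm (Fin n)) (f : Ω2 → ℝ) :
    ∫ p, f p ∂(EmP π : Measure Ω2) = (∑ i, f (permPt π i)) / n := by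
  rw [coe_EmP hn, EmM_eq, integral_smul_measure, integral_finsetSum_measure]
  · simp [div_eq_inv_mul]
  · intro i _
    exact integrable_dirac (by simp)

lemma EmP_mem_Pcal {n : ℕ} (hn : n ≠ 0) (π : Equiv.Perm (Fin n)) : EmP π ∈ Pcal := by
  have hm : MeasurableSet unitSq := measurableSet_Icc.prod measurableSet_Icc
  change (EmP π : Measure Ω2) unitSq = 1
  rw [coe_EmP hn, EmM_eq]
  simp [Measure.finsetSum_apply, Measure.dirac_apply' _ hm, permPt_mem]
  exact ENNReal.inv_mul_cancel (by exact_mod_cast hn) (ENNReal.natCast_ne_top n)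

lemma isCompact_unitSq : IsCompact unitSq := isCompact_Icc.prod isCompact_Icc

lemma measurableSet_unitSq : MeasurableSet unitSq := measurableSet_Icc.prod measurableSet_Icc

lemma corner_mem (k : ℕ) (q : Fin (k + 1) × Fin (k + 1)) : corner k q ∈ unitSq := by
  have h : ∀ a : Fin (k + 1), ((a : ℕ) : ℝ) / ((k : ℝ) + 1) ∈ Set.Icc (0 : ℝ) 1 := fun a =>
    ⟨by positivity, by
      rw [div_le_one (by positivity)]
      exact_mod_cast a.2.le⟩
  exact ⟨h _, h _⟩

lemma eventually_abs_sub_corner_le {f : Ω2 → ℝ} (hf : Continuous f) {ε : ℝ} (hε : 0 < ε) :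
    ∀ᶠ k in atTop, ∀ p ∈ unitSq, |f p - f (corner k (cell k p))| ≤ ε := by
  obtain ⟨δ, hδ, h⟩ := Metric.uniformContinuousOn_iff.1
    (isCompact_unitSq.uniformContinuousOn_of_continuous hf.continuousOn) ε hε
  have ht : Tendsto (fun k : ℕ => 1 / ((k : ℝ) + 1)) atTop (𝓝 0) :=
    tendsto_one_div_add_atTop_nhds_zero_nat
  filter_upwards [ht.eventually_lt_const hδ] with k hk p hp
  have := h p hp _ (corner_mem k (cell k p)) ?_
  · exact (Real.dist_eq _ _ ▸ this).le
  · rw [Prod.dist_eq, max_lt_iff, Real.dist_eq, Real.dist_eq]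
    exact ⟨(abs_sub_block_le k hp.1.1 hp.1.2).trans_lt hk,
      (abs_sub_block_le k hp.2.1 hp.2.2).trans_lt hk⟩

lemma measurable_block (k : ℕ) : Measurable (block k) := by
  have h : Measurable fun x : ℝ => ⌈((k : ℝ) + 1) * x⌉₊ :=
    Nat.measurable_ceil.comp (measurable_const_mul _)
  have e : block k = (fun m : ℕ => (⟨min (m - 1) k, by omega⟩ : Fin (k + 1))) ∘
      fun x : ℝ => ⌈((k : ℝ) + 1) * x⌉₊ := rfl
  rw [e]
  exact (measurable_from_top).comp h

lemma measurable_cell (k : ℕ) : Measurable (cell k) :=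
  ((measurable_block k).comp measurable_fst).prodMk ((measurable_block k).comp measurable_snd)

instance : IsProbabilityMeasure unif01 := ⟨by simp [unif01]⟩

lemma lebSq_eq_prod : lebSq = unif01.prod unif01 := by
  rw [lebSq, unif01, Measure.prod_restrict]; rfl

instance : IsProbabilityMeasure lebSq := by rw [lebSq_eq_prod]; infer_instance

lemma unif01_block (k : ℕ) (a : Fin (k + 1)) :
    unif01.real (block k ⁻¹' {a}) = 1 / ((k : ℝ) + 1) := by
  have hk : (0 : ℝ) < (k : ℝ) + 1 := by positivity
  have ha : ((a : ℕ) : ℝ) + 1 ≤ (k : ℝ) + 1 := by exact_mod_cast a.2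
  have e : block k ⁻¹' {a} ∩ Set.Ioc 0 1 =
      Set.Ioc (((a : ℕ) : ℝ) / ((k : ℝ) + 1)) ((((a : ℕ) : ℝ) + 1) / ((k : ℝ) + 1)) := by
    ext x
    simp only [Set.mem_inter_iff, Set.mem_preimage, Set.mem_singleton_iff, Set.mem_Ioc]
    rw [div_lt_iff₀' hk, le_div_iff₀' hk]
    constructor
    · rintro ⟨h, h0, h1⟩
      exact (block_eq_iff h0 h1 a).1 h
    · rintro ⟨h1, h2⟩
      have h0 : 0 < x := by
        have : (0 : ℝ) ≤ (a : ℕ) := by positivity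
        by_contra hx
        push Not at hx
        nlinarith
      have h3 : x ≤ 1 := by
        by_contra hx
        push Not at hx
        nlinarith
      exact ⟨(block_eq_iff h0 h3 a).2 ⟨h1, h2⟩, h0, h3⟩
  have hu : unif01 = volume.restrict (Set.Ioc (0 : ℝ) 1) :=
    (Measure.restrict_congr_set Ioc_ae_eq_Icc).symm
  rw [measureReal_def, hu, Measure.restrict_apply (measurable_block k (measurableSet_singleton a)), e,
    Real.volume_Ioc, ENNReal.toReal_ofReal]
  · field_simp; ring
  · rw [← sub_div]; simp; positivity

lemma cell_preimage (k : ℕ) (q : Fin (k + 1) × Fin (k + 1)) :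
    cell k ⁻¹' {q} = (block k ⁻¹' {q.1}) ×ˢ (block k ⁻¹' {q.2}) := by
  ext p; simp [cell, Prod.ext_iff]

lemma lebSq_cell (k : ℕ) (q : Fin (k + 1) × Fin (k + 1)) :
    lebSq.real (cell k ⁻¹' {q}) = 1 / ((k : ℝ) + 1) * (1 / ((k : ℝ) + 1)) := by
  rw [cell_preimage, lebSq_eq_prod, measureReal_prod_prod, unif01_block, unif01_block]

lemma integral_cell (μ : Measure Ω2) [IsFiniteMeasure μ] (k : ℕ)
    (F : Fin (k + 1) × Fin (k + 1) → ℝ) :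
    ∫ p, F (cell k p) ∂μ = ∑ q, μ.real (cell k ⁻¹' {q}) * F q := by
  have h := integral_map (μ := μ) (f := F) (measurable_cell k).aemeasurable
    Measurable.of_discrete.aestronglyMeasurable
  rw [← h, integral_fintype (by simp)]
  refine Finset.sum_congr rfl fun q _ => ?_
  rw [map_measureReal_apply (measurable_cell k) (measurableSet_singleton q), smul_eq_mul]

lemma sum_perm_exp_cell_le (k n : ℕ) (F : Fin (k + 1) × Fin (k + 1) → ℝ) :
    ∑ π : Equiv.Perm (Fin n), Real.exp (∑ i, F (cell k (permPt π i))) ≤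
      labelSymm (gridBlock k n) *
        Real.exp (∑ a, (labelCount (gridBlock k n) a : ℝ) *
          Real.log (∑ b, Real.exp (F (a, b)))) := by
  have h := sum_perm_prod_label_le (gridBlock k n)
    (fun i b => Real.exp (F (gridBlock k n i, b))) (fun _ _ => (Real.exp_pos _).le)
  refine (le_of_eq ?_).trans (h.trans (le_of_eq ?_))
  · refine Finset.sum_congr rfl fun π _ => ?_
    rw [Real.exp_sum]; rfl
  · congr 1
    rw [← sum_comp_label (gridBlock k n) (fun a => Real.log (∑ b, Real.exp (F (a, b)))),
      Real.exp_sum]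
    refine Finset.prod_congr rfl fun i _ => ?_
    rw [Real.exp_log (Finset.sum_pos (fun _ _ => Real.exp_pos _) Finset.univ_nonempty)]

lemma log_labelSymm {ι : Type*} [Fintype ι] [DecidableEq ι] {n : ℕ} (hn : n ≠ 0)
    (f : Fin n → ι) :
    Real.log (labelSymm f) = n * ∑ c, logFact n (labelCount f c) + n * Real.log n - n := by
  have hs : ∑ c, (labelCount f c : ℝ) = n := by
    have := sum_labelCount f
    rw [Fintype.card_fin] at this
    exact_mod_cast this
  rw [labelSymm, Nat.cast_prod, Real.log_prod (fun c _ => by positivity)]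
  simp_rw [log_factorial_eq hn]
  rw [Finset.sum_sub_distrib, Finset.sum_add_distrib, ← Finset.sum_mul, ← Finset.mul_sum, hs]

lemma tendsto_logFact_self : Tendsto (fun n : ℕ => logFact n n) atTop (𝓝 0) := by
  have h : Tendsto (fun n : ℕ => (n : ℝ) / n) atTop (𝓝 1) := by
    refine tendsto_const_nhds.congr' ?_
    filter_upwards [eventually_gt_atTop 0] with n hn
    rw [div_self]; exact_mod_cast hn.ne'
  simpa using tendsto_logFact (fun n => le_rfl) h

lemma tendsto_logFact_gridBlock (k : ℕ) :
    Tendsto (fun n => ∑ a, logFact n (labelCount (gridBlock k n) a)) atTop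
      (𝓝 (- Real.log ((k : ℝ) + 1))) := by
  have h := tendsto_finsetSum Finset.univ fun a _ =>
    tendsto_logFact (fun n => labelCount_le (gridBlock k n) a) (tendsto_labelCount_gridBlock k a)
  convert h using 2
  have : ((k : ℝ) + 1) ≠ 0 := by positivity
  simp [Real.log_inv]
  field_simp

/-- Asymptotic bound on the exponential moments of the empirical measure. -/
lemma eventually_sum_perm_exp_le (f : BoundedContinuousFunction Ω2 ℝ) {c : ℝ}
    (hc : ∫ p, (Real.exp (f p) - 1) ∂lebSq < c) :
    ∀ᶠ n : ℕ in atTop, ∑ π : Equiv.Perm (Fin n), Real.exp (∑ i, f (permPt π i)) ≤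
      (n ! : ℝ) * Real.exp (n * c) := by
  have hint : Integrable (fun p => Real.exp (f p)) lebSq := by
    refine Integrable.of_bound (by fun_prop) (Real.exp ‖f‖) (ae_of_all _ fun p => ?_)
    rw [Real.norm_eq_abs, Real.abs_exp]
    exact Real.exp_le_exp.2 ((le_abs_self _).trans (f.norm_coe_le_norm p))
  rw [integral_sub hint (integrable_const _)] at hc
  simp only [integral_const, probReal_univ, smul_eq_mul, mul_one] at hc
  set G := ∫ p, Real.exp (f p) ∂lebSq with hG
  obtain ⟨ε, hε, hεc⟩ : ∃ ε > 0, ε + (Real.exp ε * G - 1) < c := by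
    have : Tendsto (fun ε : ℝ => ε + (Real.exp ε * G - 1)) (𝓝[>] 0)
        (𝓝 (0 + (Real.exp 0 * G - 1))) :=
      tendsto_nhdsWithin_of_tendsto_nhds (Continuous.tendsto (by fun_prop) 0)
    obtain ⟨ε, h1, h2⟩ := ((this.eventually_lt_const (by simpa using hc)).and
      self_mem_nhdsWithin).exists
    exact ⟨ε, h2, h1⟩
  obtain ⟨k, hk⟩ := (eventually_abs_sub_corner_le f.continuous hε).exists
  set F : Fin (k + 1) × Fin (k + 1) → ℝ := fun q => f (corner k q) with hF
  set L : Fin (k + 1) → ℝ := fun a => Real.log (∑ b, Real.exp (F (a, b))) with hL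
  have hk0 : (0 : ℝ) < (k : ℝ) + 1 := by positivity
  have hlim : Tendsto (fun n : ℕ => ε + ∑ a, logFact n (labelCount (gridBlock k n) a)
      - logFact n n + ∑ a, (labelCount (gridBlock k n) a : ℝ) / n * L a) atTop
      (𝓝 (ε + (- Real.log ((k : ℝ) + 1)) - 0 + ∑ a, 1 / ((k : ℝ) + 1) * L a)) :=
    (((tendsto_logFact_gridBlock k).const_add ε).sub tendsto_logFact_self).add
      (tendsto_finsetSum _ fun a _ => (tendsto_labelCount_gridBlock k a).mul_const _)
  have hbound : ε + (- Real.log ((k : ℝ) + 1)) - 0 + ∑ a, 1 / ((k : ℝ) + 1) * L a < c := by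
    refine lt_of_le_of_lt ?_ hεc
    have h1 : ∑ q, lebSq.real (cell k ⁻¹' {q}) * Real.exp (F q) ≤ Real.exp ε * G := by
      rw [← integral_cell lebSq k (fun q => Real.exp (F q)), hG, ← integral_const_mul]
      refine integral_mono_ae ?_ (hint.const_mul _) ?_
      · refine Integrable.of_bound
          (((Measurable.of_discrete (f := fun q => Real.exp (F q))).comp
            (measurable_cell k)).aestronglyMeasurable)
          (Real.exp ‖f‖) (ae_of_all _ fun p => ?_)
        rw [Real.norm_eq_abs, Real.abs_exp]
        exact Real.exp_le_exp.2 ((le_abs_self _).trans (f.norm_coe_le_norm _))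
      · filter_upwards [ae_restrict_mem measurableSet_unitSq] with p hp
        rw [← Real.exp_add]
        have := abs_le.1 (hk p hp)
        exact Real.exp_le_exp.2 (by linarith [this.1])
    have h2 : ∀ a, L a ≤ Real.log ((k : ℝ) + 1) +
        ((∑ b, Real.exp (F (a, b))) / ((k : ℝ) + 1) - 1) := by
      intro a
      have hp : 0 < ∑ b, Real.exp (F (a, b)) :=
        Finset.sum_pos (fun _ _ => Real.exp_pos _) Finset.univ_nonempty
      have := Real.log_le_sub_one_of_pos (div_pos hp hk0)
      rw [Real.log_div hp.ne' hk0.ne'] at this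
      linarith
    simp_rw [lebSq_cell] at h1
    rw [Fintype.sum_prod_type] at h1
    have h3 : ∑ a, 1 / ((k : ℝ) + 1) * L a ≤ ∑ a : Fin (k + 1), 1 / ((k : ℝ) + 1) *
        (Real.log ((k : ℝ) + 1) + ((∑ b, Real.exp (F (a, b))) / ((k : ℝ) + 1) - 1)) :=
      Finset.sum_le_sum fun a _ => mul_le_mul_of_nonneg_left (h2 a) (by positivity)
    have h4 : ∑ a : Fin (k + 1), 1 / ((k : ℝ) + 1) *
        (Real.log ((k : ℝ) + 1) + ((∑ b, Real.exp (F (a, b))) / ((k : ℝ) + 1) - 1)) =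
        Real.log ((k : ℝ) + 1) - 1 +
          ∑ a, ∑ b, 1 / ((k : ℝ) + 1) * (1 / ((k : ℝ) + 1)) * Real.exp (F (a, b)) := by
      simp_rw [← Finset.mul_sum]
      rw [Finset.sum_add_distrib, Finset.sum_sub_distrib, ← Finset.sum_div]
      simp
      field_simp
      ring
    linarith
  filter_upwards [hlim.eventually_lt_const hbound, eventually_gt_atTop 0] with n hn hn0
  have hn' : (0 : ℝ) < n := by exact_mod_cast hn0
  have hstep : ∑ π : Equiv.Perm (Fin n), Real.exp (∑ i, f (permPt π i)) ≤
      Real.exp (n * ε) * ∑ π : Equiv.Perm (Fin n), Real.exp (∑ i, F (cell k (permPt π i))) := by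
    rw [Finset.mul_sum]
    refine Finset.sum_le_sum fun π _ => ?_
    rw [← Real.exp_add]
    refine Real.exp_le_exp.2 ?_
    have : ∑ i, f (permPt π i) ≤ ∑ i, (ε + F (cell k (permPt π i))) :=
      Finset.sum_le_sum fun i _ => by
        have := abs_le.1 (hk _ (permPt_mem π i))
        simp only [hF]
        linarith [this.2]
    simpa [Finset.sum_add_distrib] using this
  refine hstep.trans ((mul_le_mul_of_nonneg_left (sum_perm_exp_cell_le k n F)
    (Real.exp_pos _).le).trans ?_)
  have hpos : (0 : ℝ) < labelSymm (gridBlock k n) := by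
    exact_mod_cast Finset.prod_pos fun c _ => Nat.factorial_pos _
  rw [← Real.exp_log hpos, ← Real.exp_log (show (0 : ℝ) < (n ! : ℝ) by positivity),
    ← Real.exp_add, ← Real.exp_add, ← Real.exp_add, Real.exp_le_exp, log_labelSymm hn0.ne',
    log_factorial_eq hn0.ne']
  have h5 : ∑ a, (labelCount (gridBlock k n) a : ℝ) * L a =
      n * ∑ a, (labelCount (gridBlock k n) a : ℝ) / n * L a := by
    rw [Finset.mul_sum]
    exact Finset.sum_congr rfl fun a _ => by field_simp
  have h6 := mul_le_mul_of_nonneg_left hn.le hn'.le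
  simp only [hL] at h5 h6 ⊢
  rw [h5]
  linarith

lemma integrable_of_abs_le {μ : Measure Ω2} [IsFiniteMeasure μ] {h : Ω2 → ℝ} (hm : Measurable h)
    {M : ℝ} (hM : ∀ x, |h x| ≤ M) : Integrable h μ :=
  Integrable.of_bound hm.aestronglyMeasurable M (ae_of_all _ fun x => by simpa using hM x)

lemma integrable_exp_of_abs_le {μ : Measure Ω2} [IsFiniteMeasure μ] {h : Ω2 → ℝ}
    (hm : Measurable h) {M : ℝ} (hM : ∀ x, |h x| ≤ M) :
    Integrable (fun x => Real.exp (h x)) μ :=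
  integrable_of_abs_le (Real.measurable_exp.comp hm) (M := Real.exp M) fun x => by
    rw [Real.abs_exp]
    exact Real.exp_le_exp.2 ((le_abs_self _).trans (hM x))

lemma abs_exp_sub_exp_le {a b M : ℝ} (ha : a ≤ M) (hb : b ≤ M) :
    |Real.exp a - Real.exp b| ≤ Real.exp M * |a - b| := by
  wlog hab : b ≤ a generalizing a b
  · rw [abs_sub_comm, abs_sub_comm a]
    exact this hb ha (le_of_not_ge hab)
  rw [abs_of_nonneg (sub_nonneg.2 (Real.exp_le_exp.2 hab)), abs_of_nonneg (sub_nonneg.2 hab)]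
  have h1 : Real.exp a - Real.exp b = Real.exp a * (1 - Real.exp (b - a)) := by
    rw [mul_sub, ← Real.exp_add]; ring_nf
  have h2 := Real.add_one_le_exp (b - a)
  rw [h1]
  exact mul_le_mul (Real.exp_le_exp.2 ha) (by linarith)
    (by linarith [Real.exp_le_one_iff.2 (sub_nonpos.2 hab)]) (Real.exp_pos _).le

/-- Truncated logarithm. -/
def truncLog (M x : ℝ) : ℝ := if x = 0 then -M else max (-M) (min M (Real.log x))

lemma measurable_truncLog (M : ℝ) : Measurable (truncLog M) :=
  Measurable.ite (measurableSet_singleton 0) measurable_const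
    (measurable_const.max (measurable_const.min Real.measurable_log))

lemma abs_truncLog_le {M : ℝ} (hM : 0 ≤ M) (x : ℝ) : |truncLog M x| ≤ M := by
  unfold truncLog
  split_ifs
  · rw [abs_neg, abs_of_nonneg hM]
  · exact abs_le.2 ⟨le_max_left _ _, max_le (by linarith) (min_le_left _ _)⟩

lemma truncLog_nonneg {M x : ℝ} (hM : 0 ≤ M) (hx : 0 ≤ x) :
    0 ≤ x * truncLog M x - (Real.exp (truncLog M x) - 1) := by
  have key : ∀ t : ℝ, 0 ≤ (x - Real.exp t) * t → 0 ≤ x * t - (Real.exp t - 1) := by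
    intro t ht
    have h1 := mul_le_mul_of_nonneg_left (Real.add_one_le_exp (-t)) (Real.exp_pos t).le
    rw [← Real.exp_add, add_neg_cancel, Real.exp_zero] at h1
    linarith
  apply key
  unfold truncLog
  split_ifs with h
  · rw [h]
    have := mul_nonneg (Real.exp_pos (-M)).le hM
    linarith
  · have hx' : 0 < x := lt_of_le_of_ne hx (Ne.symm h)
    rcases le_total 0 (Real.log x) with h0 | h0
    · have h1 : 0 ≤ min M (Real.log x) := le_min hM h0
      rw [max_eq_right (by linarith)]
      refine mul_nonneg (sub_nonneg.2 ?_) h1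
      calc Real.exp (min M (Real.log x)) ≤ Real.exp (Real.log x) :=
            Real.exp_le_exp.2 (min_le_right _ _)
        _ = x := Real.exp_log hx'
    · rw [min_eq_right (h0.trans hM)]
      refine mul_nonneg_of_nonpos_of_nonpos (sub_nonpos.2 ?_) (max_le (by linarith) h0)
      calc x = Real.exp (Real.log x) := (Real.exp_log hx').symm
        _ ≤ _ := Real.exp_le_exp.2 (le_max_right _ _)

lemma tendsto_truncLog {x : ℝ} (hx : 0 ≤ x) :
    Tendsto (fun n : ℕ => x * truncLog n x - (Real.exp (truncLog n x) - 1)) atTop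
      (𝓝 (x * Real.log x + 1 - x)) := by
  rcases hx.eq_or_lt with rfl | hx
  · simp only [truncLog, if_true]
    have : Tendsto (fun n : ℕ => Real.exp (-(n : ℝ))) atTop (𝓝 0) :=
      Real.tendsto_exp_neg_atTop_nhds_zero.comp tendsto_natCast_atTop_atTop
    simpa using (this.sub_const 1).neg
  · refine tendsto_const_nhds.congr' ?_
    filter_upwards [tendsto_natCast_atTop_atTop.eventually_ge_atTop |Real.log x|] with n hn
    rw [truncLog, if_neg hx.ne', min_eq_right ((le_abs_self _).trans hn),
      max_eq_right (by linarith [neg_abs_le (Real.log x)]), Real.exp_log hx]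
    ring

lemma exists_measurable_dual (γ : Measure Ω2) [IsProbabilityMeasure γ] {β : ℝ}
    (hβ : ENNReal.ofReal β < KL γ lebSq) :
    ∃ h : Ω2 → ℝ, Measurable h ∧ (∃ M, ∀ x, |h x| ≤ M) ∧
      β < ∫ x, h x ∂γ - ∫ x, (Real.exp (h x) - 1) ∂lebSq := by
  by_cases hac : γ ≪ lebSq
  · rw [KL, if_pos hac] at hβ
    set g : Ω2 → ℝ := fun z => (γ.rnDeriv lebSq z).toReal with hg
    have hgm : Measurable g := (Measure.measurable_rnDeriv _ _).ennreal_toReal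
    have hg0 : ∀ z, 0 ≤ g z := fun _ => ENNReal.toReal_nonneg
    have hgi : Integrable g lebSq := Measure.integrable_toReal_rnDeriv
    set h : ℕ → Ω2 → ℝ := fun n z => truncLog n (g z) with hh
    have hhm : ∀ n, Measurable (h n) := fun n => (measurable_truncLog n).comp hgm
    have hhb : ∀ n z, |h n z| ≤ n := fun n z => abs_truncLog_le n.cast_nonneg _
    set H : ℕ → Ω2 → ℝ := fun n z => g z * h n z - (Real.exp (h n z) - 1) with hH
    have hHm : ∀ n, Measurable (H n) := fun n =>
      (hgm.mul (hhm n)).sub ((Real.measurable_exp.comp (hhm n)).sub_const 1)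
    have hfatou := lintegral_liminf_le (μ := lebSq) (u := atTop)
      (f := fun n z => ENNReal.ofReal (H n z)) fun n => (hHm n).ennreal_ofReal
    have hlim : ∀ z, liminf (fun n => ENNReal.ofReal (H n z)) atTop =
        ENNReal.ofReal (g z * Real.log (g z) + 1 - g z) := fun z =>
      ((ENNReal.continuous_ofReal.tendsto _).comp (tendsto_truncLog (hg0 z))).liminf_eq
    simp_rw [hlim] at hfatou
    obtain ⟨n, hn⟩ := (eventually_lt_of_lt_liminf (hβ.trans_le hfatou)).exists
    refine ⟨h n, hhm n, ⟨n, hhb n⟩, ?_⟩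
    have i1 : Integrable (fun z => g z * h n z) lebSq :=
      hgi.mul_bdd (c := n) (hhm n).aestronglyMeasurable (ae_of_all _ fun z => by
        simpa using hhb n z)
    have i2 : Integrable (fun z => Real.exp (h n z) - 1) lebSq :=
      (integrable_exp_of_abs_le (hhm n) (hhb n)).sub (integrable_const _)
    have e1 : ∫ x, h n x ∂γ = ∫ x, g x * h n x ∂lebSq :=
      (integral_rnDeriv_smul hac).symm
    rw [e1, ← integral_sub i1 i2]
    rw [← ofReal_integral_eq_lintegral_ofReal (f := H n) (i1.sub i2)
      (ae_of_all _ fun z => truncLog_nonneg n.cast_nonneg (hg0 z))] at hn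
    exact (ENNReal.ofReal_lt_ofReal_iff'.1 hn).1
  · obtain ⟨N, hNm, hN0, hN⟩ : ∃ N, MeasurableSet N ∧ lebSq N = 0 ∧ γ N ≠ 0 := by
      by_contra hcon
      push Not at hcon
      exact hac (Measure.AbsolutelyContinuous.mk fun s hs h0 => hcon s hs h0)
    have hpos : 0 < γ.real N := ENNReal.toReal_pos hN (measure_ne_top _ _)
    set c := (|β| + 1) / γ.real N with hc
    have hz : ∀ᵐ z ∂lebSq, N.indicator (fun _ => c) z = 0 := by
      have : ∀ᵐ z ∂lebSq, z ∉ N := measure_eq_zero_iff_ae_notMem.1 hN0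
      filter_upwards [this] with z hz using Set.indicator_of_notMem hz _
    refine ⟨N.indicator fun _ => c, measurable_const.indicator hNm, ⟨|c|, fun x => ?_⟩, ?_⟩
    · by_cases hx : x ∈ N
      · rw [Set.indicator_of_mem hx]
      · rw [Set.indicator_of_notMem hx]; simp
    · have e : ∫ x, (Real.exp (N.indicator (fun _ => c) x) - 1) ∂lebSq = 0 := by
        rw [integral_eq_zero_of_ae]
        filter_upwards [hz] with z hz
        simp [hz]
      rw [e, integral_indicator_const _ hNm, smul_eq_mul, hc, mul_div_cancel₀ _ hpos.ne']
      linarith [le_abs_self β]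

/-- The variational lower bound for the relative entropy, over bounded continuous functions. -/
lemma exists_boundedContinuous_dual (γ : Measure Ω2) [IsProbabilityMeasure γ] {β : ℝ}
    (hβ : ENNReal.ofReal β < KL γ lebSq) :
    ∃ f : BoundedContinuousFunction Ω2 ℝ,
      β < ∫ x, f x ∂γ - ∫ x, (Real.exp (f x) - 1) ∂lebSq := by
  obtain ⟨h, hm, ⟨M, hM⟩, hlt⟩ := exists_measurable_dual γ hβ
  obtain ⟨ε, hε, hεlt⟩ : ∃ ε > 0, ε + Real.exp M * ε <
      ∫ x, h x ∂γ - ∫ x, (Real.exp (h x) - 1) ∂lebSq - β := by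
    refine ⟨(∫ x, h x ∂γ - ∫ x, (Real.exp (h x) - 1) ∂lebSq - β) / 2 / (1 + Real.exp M),
      div_pos (by linarith) (by positivity), ?_⟩
    rw [← one_add_mul, mul_div_cancel₀ _ (by positivity)]
    linarith
  have hM0 : 0 ≤ M := (abs_nonneg _).trans (hM 0)
  obtain ⟨f₀, hf₀, hfi⟩ := (integrable_of_abs_le (μ := γ + lebSq) hm
    hM).exists_boundedContinuous_integral_sub_le hε
  have hclb : ∀ x, |max (-M) (min M (f₀ x))| ≤ M := fun x =>
    abs_le.2 ⟨le_max_left _ _, max_le (by linarith) (min_le_left _ _)⟩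
  set f : BoundedContinuousFunction Ω2 ℝ := BoundedContinuousFunction.ofNormedAddCommGroup
    (fun x => max (-M) (min M (f₀ x))) (by fun_prop) M hclb with hf
  have hfb : ∀ x, |f x| ≤ M := hclb
  have hfm : Measurable f := f.continuous.measurable
  have hcl : ∀ x, |h x - f x| ≤ ‖h x - f₀ x‖ := by
    intro x
    have h1 : h x = max (-M) (min M (h x)) := by
      rw [min_eq_right (abs_le.1 (hM x)).2, max_eq_right (abs_le.1 (hM x)).1]
    have h2 : f x = max (-M) (min M (f₀ x)) := rfl
    calc |h x - f x| = |max (-M) (min M (h x)) - max (-M) (min M (f₀ x))| := by rw [← h1, h2]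
      _ ≤ |min M (h x) - min M (f₀ x)| := by
        simpa using abs_max_sub_max_le_max (-M) (min M (h x)) (-M) (min M (f₀ x))
      _ ≤ ‖h x - f₀ x‖ := by simpa using abs_min_sub_min_le_max M (h x) M (f₀ x)
  have hd : ∀ μ : Measure Ω2, μ ≤ γ + lebSq → ∫ x, |h x - f x| ∂μ ≤ ε := by
    intro μ hμ
    have i0 : Integrable (fun x => ‖h x - f₀ x‖) (γ + lebSq) :=
      ((integrable_of_abs_le hm hM).sub hfi).norm
    have i1 : Integrable (fun x => |h x - f x|) (γ + lebSq) :=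
      ((integrable_of_abs_le hm hM).sub (integrable_of_abs_le hfm hfb)).abs
    calc ∫ x, |h x - f x| ∂μ ≤ ∫ x, |h x - f x| ∂(γ + lebSq) :=
          integral_mono_measure hμ (ae_of_all _ fun _ => abs_nonneg _) i1
      _ ≤ ∫ x, ‖h x - f₀ x‖ ∂(γ + lebSq) := integral_mono i1 i0 hcl
      _ ≤ ε := hf₀
  refine ⟨f, ?_⟩
  have d1 : ∫ x, h x ∂γ - ∫ x, f x ∂γ ≤ ε := by
    rw [← integral_sub (integrable_of_abs_le hm hM) (integrable_of_abs_le hfm hfb)]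
    refine le_trans ?_ (hd γ (Measure.le_add_right le_rfl))
    exact integral_mono ((integrable_of_abs_le hm hM).sub (integrable_of_abs_le hfm hfb))
      ((integrable_of_abs_le hm hM).sub (integrable_of_abs_le hfm hfb)).abs
      fun x => le_abs_self _
  have d2 : ∫ x, (Real.exp (f x) - 1) ∂lebSq - ∫ x, (Real.exp (h x) - 1) ∂lebSq ≤
      Real.exp M * ε := by
    have j1 := (integrable_exp_of_abs_le (μ := lebSq) hfm hfb).sub (integrable_const (1 : ℝ))
    have j2 := (integrable_exp_of_abs_le (μ := lebSq) hm hM).sub (integrable_const (1 : ℝ))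
    have := integral_sub j1 j2
    simp only [Pi.sub_apply] at this
    rw [← this]
    refine le_trans ?_ (mul_le_mul_of_nonneg_left (hd lebSq (Measure.le_add_left le_rfl))
      (Real.exp_pos M).le)
    rw [← integral_const_mul]
    refine integral_mono (j1.sub j2) (((integrable_of_abs_le hm hM).sub
      (integrable_of_abs_le hfm hfb)).abs.const_mul _) fun x => ?_
    have := abs_exp_sub_exp_le ((le_abs_self _).trans (hfb x)) ((le_abs_self _).trans (hM x))
    rw [abs_sub_comm (f x)] at this
    have h3 := (le_abs_self _).trans this
    linarith
  linarith

lemma ae_mem_unitSq {μ : Measure Ω2} [IsProbabilityMeasure μ] (hμ : μ unitSq = 1) :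
    ∀ᵐ p ∂μ, p ∈ unitSq := by
  rw [← mem_ae_iff_prob_eq_one measurableSet_unitSq] at hμ
  exact hμ

lemma lebSq_unitSq : lebSq unitSq = 1 := by
  rw [lebSq, Measure.restrict_apply_self]
  simpa [lebSq] using measure_univ (μ := lebSq)

lemma abs_integral_sub_corner_le {μ : Measure Ω2} [IsProbabilityMeasure μ] (hμ : μ unitSq = 1)
    (f : BoundedContinuousFunction Ω2 ℝ) {k : ℕ} {ω : ℝ}
    (h : ∀ p ∈ unitSq, |f p - f (corner k (cell k p))| ≤ ω) :
    |∫ p, f p ∂μ - ∫ p, f (corner k (cell k p)) ∂μ| ≤ ω := by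
  have i1 : Integrable f μ := f.integrable μ
  have i2 : Integrable (fun p => f (corner k (cell k p))) μ :=
    integrable_of_abs_le ((Measurable.of_discrete (f := fun q => f (corner k q))).comp
      (measurable_cell k)) (M := ‖f‖) fun p => f.norm_coe_le_norm _
  rw [← integral_sub i1 i2]
  have := norm_integral_le_of_norm_le_const (μ := μ) (C := ω)
    (f := fun p => f p - f (corner k (cell k p)))
    ((ae_mem_unitSq hμ).mono fun p hp => h p hp)
  simpa using this

lemma abs_integral_sub_integral_le {μ ν : Measure Ω2} [IsProbabilityMeasure μ]
    [IsProbabilityMeasure ν] (hμ : μ unitSq = 1) (hν : ν unitSq = 1)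
    (f : BoundedContinuousFunction Ω2 ℝ) {k : ℕ} {ω : ℝ}
    (h : ∀ p ∈ unitSq, |f p - f (corner k (cell k p))| ≤ ω) :
    |∫ p, f p ∂μ - ∫ p, f p ∂ν| ≤ 2 * ω +
      |∫ p, f (corner k (cell k p)) ∂μ - ∫ p, f (corner k (cell k p)) ∂ν| := by
  have h1 := abs_integral_sub_corner_le hμ f h
  have h2 := abs_integral_sub_corner_le hν f h
  rw [abs_le] at h1 h2 ⊢
  constructor <;> cases abs_cases (∫ p, f (corner k (cell k p)) ∂μ -
    ∫ p, f (corner k (cell k p)) ∂ν) <;> linarith [h1.1, h1.2, h2.1, h2.2]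

lemma map_fst_lebSq : lebSq.map Prod.fst = unif01 := by
  rw [lebSq_eq_prod, Measure.map_fst_prod]; simp

lemma tendsto_sum_gridPt (g : BoundedContinuousFunction ℝ ℝ) :
    Tendsto (fun n : ℕ => (∑ i : Fin n, g (gridPt i)) / n) atTop (𝓝 (∫ x, g x ∂unif01)) := by
  set f : BoundedContinuousFunction Ω2 ℝ := g.compContinuous ⟨Prod.fst, continuous_fst⟩ with hf
  have e1 : ∫ x, g x ∂unif01 = ∫ p, f p ∂lebSq := by
    rw [← map_fst_lebSq, integral_map measurable_fst.aemeasurable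
      g.continuous.measurable.aestronglyMeasurable]
    rfl
  rw [e1, Metric.tendsto_atTop']
  intro ε hε
  obtain ⟨k, hk⟩ := (eventually_abs_sub_corner_le f.continuous
    (show 0 < ε / 4 by positivity)).exists
  set G : Fin (k + 1) → ℝ := fun a => g ((a : ℕ) / ((k : ℝ) + 1)) with hG
  have hlim : Tendsto (fun n : ℕ => ∑ a, (labelCount (gridBlock k n) a : ℝ) / n * G a) atTop
      (𝓝 (∑ a, 1 / ((k : ℝ) + 1) * G a)) :=
    tendsto_finsetSum _ fun a _ => (tendsto_labelCount_gridBlock k a).mul_const _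
  have e2 : ∫ p, f (corner k (cell k p)) ∂lebSq = ∑ a, 1 / ((k : ℝ) + 1) * G a := by
    have := integral_cell lebSq k fun q => f (corner k q)
    rw [this, Fintype.sum_prod_type]
    refine Finset.sum_congr rfl fun a _ => ?_
    simp_rw [lebSq_cell]
    have : ∀ b, f (corner k (a, b)) = G a := fun b => rfl
    simp_rw [this]
    simp
    field_simp
  have hev := (Metric.tendsto_atTop'.1 hlim (ε / 4) (by positivity))
  obtain ⟨n₀, hn₀⟩ := hev
  refine ⟨n₀, fun n hn => ?_⟩
  have hn0 : n ≠ 0 := by omega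
  have e3 : (∑ i : Fin n, g (gridPt i)) / n =
      ∫ p, f p ∂(EmP (1 : Equiv.Perm (Fin n)) : Measure Ω2) := by
    rw [integral_EmP hn0]; rfl
  have e4 : ∫ p, f (corner k (cell k p)) ∂(EmP (1 : Equiv.Perm (Fin n)) : Measure Ω2) =
      ∑ a, (labelCount (gridBlock k n) a : ℝ) / n * G a := by
    rw [integral_EmP hn0]
    have : ∑ i, f (corner k (cell k (permPt (1 : Equiv.Perm (Fin n)) i))) =
      ∑ i, G (gridBlock k n i) := rfl
    rw [this, sum_comp_label, Finset.sum_div]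
    exact Finset.sum_congr rfl fun a _ => by ring
  have h := abs_integral_sub_integral_le (EmP_mem_Pcal hn0 1) lebSq_unitSq f hk
  have h' := hn₀ n hn
  rw [Real.dist_eq] at h' ⊢
  rw [e4, e2] at h
  rw [e3]
  linarith

open scoped Classical in
lemma probUnif_le_of_card {n : ℕ} {U : Set (ProbabilityMeasure Ω2)} {r : ℝ}
    (h : ((Finset.univ.filter fun π : Equiv.Perm (Fin n) => EmP π ∈ U).card : ℝ) ≤ (n ! : ℝ) * r)
    (hr : 0 ≤ r) : probUnif n U ≤ ENNReal.ofReal r := by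
  unfold probUnif
  rw [Fintype.card_perm, Fintype.card_fin]
  refine ENNReal.div_le_of_le_mul ?_
  rw [← ENNReal.ofReal_natCast (n !), ← ENNReal.ofReal_mul hr, mul_comm,
    ← ENNReal.ofReal_natCast]
  exact ENNReal.ofReal_le_ofReal h

lemma probUnif_mono {n : ℕ} {U V : Set (ProbabilityMeasure Ω2)}
    (h : ∀ π : Equiv.Perm (Fin n), EmP π ∈ U → EmP π ∈ V) : probUnif n U ≤ probUnif n V := by
  classical
  unfold probUnif
  refine ENNReal.div_le_div_right (Nat.cast_le.2 (Finset.card_le_card fun π hπ => ?_)) _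
  simp only [Finset.mem_filter, Finset.mem_univ, true_and] at hπ ⊢
  exact h π hπ

lemma probUnif_union (n : ℕ) (U V : Set (ProbabilityMeasure Ω2)) :
    probUnif n (U ∪ V) ≤ probUnif n U + probUnif n V := by
  classical
  unfold probUnif
  rw [← ENNReal.add_div]
  gcongr
  rw [← Nat.cast_add, Nat.cast_le]
  refine le_trans (Finset.card_le_card fun π hπ => ?_) (Finset.card_union_le _ _)
  simpa using hπ

lemma probUnif_eq_zero {n : ℕ} {U : Set (ProbabilityMeasure Ω2)}
    (h : ∀ π : Equiv.Perm (Fin n), EmP π ∉ U) : probUnif n U = 0 := by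
  classical
  unfold probUnif
  rw [Finset.filter_false_of_mem fun π _ => h π]
  simp

lemma exists_nhds_of_lt_KL {γ : ProbabilityMeasure Ω2} {β : ℝ}
    (hβ : ENNReal.ofReal β < KL (γ : Measure Ω2) lebSq) :
    ∃ U ∈ 𝓝 γ, ∀ᶠ n : ℕ in atTop, probUnif n U ≤ ENNReal.ofReal (Real.exp (-(n * β))) := by
  classical
  obtain ⟨f, hf⟩ := exists_boundedContinuous_dual (γ : Measure Ω2) hβ
  obtain ⟨c, hc1, hc2⟩ := exists_between
    (show ∫ x, (Real.exp (f x) - 1) ∂lebSq < ∫ x, f x ∂(γ : Measure Ω2) - β by linarith)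
  refine ⟨{μ | β + c < ∫ x, f x ∂(μ : Measure Ω2)}, ?_, ?_⟩
  · exact (isOpen_lt continuous_const
      (ProbabilityMeasure.continuous_integral_boundedContinuousFunction f)).mem_nhds
        (show β + c < _ by linarith)
  · filter_upwards [eventually_sum_perm_exp_le f hc1, eventually_gt_atTop 0] with n hn hn0
    have hn' : (0 : ℝ) < n := by exact_mod_cast hn0
    refine probUnif_le_of_card ?_ (Real.exp_pos _).le
    set S := Finset.univ.filter fun π : Equiv.Perm (Fin n) =>
      EmP π ∈ {μ : ProbabilityMeasure Ω2 | β + c < ∫ x, f x ∂(μ : Measure Ω2)} with hS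
    have h1 : (S.card : ℝ) * Real.exp (n * (β + c)) ≤
        ∑ π : Equiv.Perm (Fin n), Real.exp (∑ i, f (permPt π i)) := by
      calc (S.card : ℝ) * Real.exp (n * (β + c)) = ∑ π ∈ S, Real.exp (n * (β + c)) := by simp
        _ ≤ ∑ π ∈ S, Real.exp (∑ i, f (permPt π i)) := by
          refine Finset.sum_le_sum fun π hπ => Real.exp_le_exp.2 ?_
          have : β + c < ∫ x, f x ∂(EmP π : Measure Ω2) := (Finset.mem_filter.1 hπ).2
          rw [integral_EmP hn0.ne', lt_div_iff₀ hn'] at this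
          linarith
        _ ≤ _ := Finset.sum_le_sum_of_subset_of_nonneg (Finset.subset_univ _)
          fun _ _ _ => (Real.exp_pos _).le
    have h2 := h1.trans hn
    rw [← le_div_iff₀ (Real.exp_pos _), mul_div_assoc, ← Real.exp_sub] at h2
    rwa [show (n : ℝ) * c - n * (β + c) = -(n * β) by ring] at h2

lemma exists_nhds_of_integral_ne {γ : ProbabilityMeasure Ω2}
    (f : BoundedContinuousFunction Ω2 ℝ) {z : ℝ} {u : ℕ → ℝ} (hu : Tendsto u atTop (𝓝 z))
    (hf : ∀ n, n ≠ 0 → ∀ π : Equiv.Perm (Fin n), ∫ x, f x ∂(EmP π : Measure Ω2) = u n)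
    (hz : ∫ x, f x ∂(γ : Measure Ω2) ≠ z) :
    ∃ U ∈ 𝓝 γ, ∀ᶠ n : ℕ in atTop, probUnif n U = 0 := by
  obtain ⟨V, W, hV, hW, hγ, hzW, hd⟩ := t2_separation hz
  refine ⟨{μ | ∫ x, f x ∂(μ : Measure Ω2) ∈ V}, ?_, ?_⟩
  · exact (hV.preimage
      (ProbabilityMeasure.continuous_integral_boundedContinuousFunction f)).mem_nhds hγ
  · filter_upwards [hu.eventually_mem (hW.mem_nhds hzW), eventually_ne_atTop 0] with n hn hn0
    refine probUnif_eq_zero fun π hπ => ?_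
    have : ∫ x, f x ∂(EmP π : Measure Ω2) ∈ V := hπ
    rw [hf n hn0] at this
    exact hd.notMem_of_mem_left this hn

lemma exists_nhds_of_notMem {γ : ProbabilityMeasure Ω2} (hP : γ ∈ Pcal) (hM : γ ∉ Mtilde) :
    ∃ U ∈ 𝓝 γ, ∀ᶠ n : ℕ in atTop, probUnif n U = 0 := by
  have key : ∀ s : Ω2 → ℝ, Continuous s →
      (∀ n, ∀ π : Equiv.Perm (Fin n), ∀ g : ℝ → ℝ,
        ∑ i, g (s (permPt π i)) = ∑ i : Fin n, g (gridPt i)) →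
      (γ : Measure Ω2).map s ≠ unif01 → ∃ U ∈ 𝓝 γ, ∀ᶠ n : ℕ in atTop, probUnif n U = 0 := by
    intro s hs hsum hne
    have : IsProbabilityMeasure ((γ : Measure Ω2).map s) :=
      Measure.isProbabilityMeasure_map hs.measurable.aemeasurable
    obtain ⟨g, hg⟩ : ∃ g : BoundedContinuousFunction ℝ ℝ,
        ∫ x, g x ∂((γ : Measure Ω2).map s) ≠ ∫ x, g x ∂unif01 := by
      by_contra hcon
      push Not at hcon
      exact hne (ext_of_forall_integral_eq_of_IsFiniteMeasure hcon)
    rw [integral_map hs.measurable.aemeasurable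
      g.continuous.measurable.aestronglyMeasurable] at hg
    refine exists_nhds_of_integral_ne (g.compContinuous ⟨s, hs⟩) (tendsto_sum_gridPt g) ?_ hg
    intro n hn π
    rw [integral_EmP hn, ← hsum n π]
    rfl
  by_cases h1 : (γ : Measure Ω2).map Prod.fst = unif01
  · refine key Prod.snd continuous_snd (fun n π g => ?_) fun h2 => hM ⟨hP, h1, h2⟩
    exact Equiv.sum_comp π fun i => g (gridPt i)
  · exact key Prod.fst continuous_fst (fun n π g => rfl) h1

lemma exists_nhds_of_lt_IrateUnif {γ : ProbabilityMeasure Ω2} (hP : γ ∈ Pcal) {β : ℝ}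
    (hβ : ENNReal.ofReal β < IrateUnif γ) :
    ∃ U ∈ 𝓝 γ, ∀ᶠ n : ℕ in atTop, probUnif n U ≤ ENNReal.ofReal (Real.exp (-(n * β))) := by
  by_cases hM : γ ∈ Mtilde
  · rw [IrateUnif, if_pos hM] at hβ
    exact exists_nhds_of_lt_KL hβ
  · obtain ⟨U, hU, h⟩ := exists_nhds_of_notMem hP hM
    exact ⟨U, hU, h.mono fun n hn => hn.trans_le zero_le⟩

lemma isCompact_Pcal : IsCompact Pcal := by
  have h := isCompact_setOfPred_probabilityMeasure_mass_eq_compl_isCompact_le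
    (E := Ω2) (u := fun _ => 0) (K := fun _ => unitSq) tendsto_const_nhds
    (fun _ => isCompact_unitSq) (Or.inr fun _ _ _ => le_rfl)
  convert h using 1
  ext μ
  simp only [Pcal, Set.mem_ofPred_eq, forall_const]
  rw [← prob_compl_eq_zero_iff measurableSet_unitSq]
  simp [ProbabilityMeasure.null_iff_toMeasure_null]

lemma eventually_probUnif_le {A : Set (ProbabilityMeasure Ω2)} {β : ℝ}
    (hβ : ∀ γ ∈ closure A, ENNReal.ofReal β < IrateUnif γ) :
    ∃ C : NNReal, ∀ᶠ n : ℕ in atTop,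
      probUnif n A ≤ C * ENNReal.ofReal (Real.exp (-(n * β))) := by
  have hK : IsCompact (closure A ∩ Pcal) :=
    isCompact_Pcal.inter_left isClosed_closure
  have : ∃ C : NNReal, ∀ᶠ n : ℕ in atTop,
      probUnif n (closure A ∩ Pcal) ≤ C * ENNReal.ofReal (Real.exp (-(n * β))) := by
    refine hK.induction_on (p := fun S => ∃ C : NNReal, ∀ᶠ n : ℕ in atTop,
      probUnif n S ≤ C * ENNReal.ofReal (Real.exp (-(n * β)))) ?_ ?_ ?_ ?_
    · exact ⟨0, Eventually.of_forall fun n => by simp [probUnif_eq_zero]⟩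
    · rintro s t hst ⟨C, hC⟩
      exact ⟨C, hC.mono fun n hn => (probUnif_mono fun π hπ => hst hπ).trans hn⟩
    · rintro s t ⟨C, hC⟩ ⟨D, hD⟩
      refine ⟨C + D, ?_⟩
      filter_upwards [hC, hD] with n h1 h2
      push_cast
      rw [add_mul]
      exact (probUnif_union n s t).trans (add_le_add h1 h2)
    · rintro γ ⟨hγ, hP⟩
      obtain ⟨U, hU, h⟩ := exists_nhds_of_lt_IrateUnif hP (hβ γ hγ)
      exact ⟨U, mem_nhdsWithin_of_mem_nhds hU, 1, by simpa using h⟩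
  obtain ⟨C, hC⟩ := this
  refine ⟨C, ?_⟩
  filter_upwards [hC, eventually_ne_atTop 0] with n hn hn0
  exact (probUnif_mono (V := closure A ∩ Pcal) fun π hπ => ⟨subset_closure hπ, EmP_mem_Pcal hn0 π⟩).trans hn

lemma KL_eq_klDiv (γ μ : Measure Ω2) [IsFiniteMeasure γ] [IsFiniteMeasure μ] :
    KL γ μ = InformationTheory.klDiv γ μ := by
  rw [InformationTheory.klDiv_eq_lintegral_klFun]
  rfl

lemma toReal_rnDeriv_fintype {ι : Type*} [Fintype ι] [MeasurableSpace ι]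
    [MeasurableSingletonClass ι] {μ ν : Measure ι} [IsFiniteMeasure μ] [IsFiniteMeasure ν]
    (h : μ ≪ ν) (i : ι) (hi : ν {i} ≠ 0) :
    (μ.rnDeriv ν i).toReal = μ.real {i} / ν.real {i} := by
  have h1 := Measure.setLIntegral_rnDeriv h {i}
  rw [lintegral_singleton] at h1
  rw [measureReal_def, measureReal_def, ← h1, ENNReal.toReal_mul, mul_div_cancel_right₀]
  exact (ENNReal.toReal_pos hi (measure_ne_top _ _)).ne'

lemma sum_cell_eq_one (γ : Measure Ω2) [IsProbabilityMeasure γ] (k : ℕ) :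
    ∑ q, γ.real (cell k ⁻¹' {q}) = 1 := by
  have := integral_cell γ k fun _ => (1 : ℝ)
  simpa using this.symm

lemma sum_cell_mul_log_le (γ : Measure Ω2) [IsProbabilityMeasure γ] (h : KL γ lebSq ≠ ∞) (k : ℕ) :
    ∑ q, γ.real (cell k ⁻¹' {q}) * Real.log (γ.real (cell k ⁻¹' {q})) +
      2 * Real.log ((k : ℝ) + 1) ≤ (KL γ lebSq).toReal := by
  rw [KL_eq_klDiv] at h ⊢
  have hc := measurable_cell k
  obtain ⟨hac, hint⟩ := InformationTheory.klDiv_ne_top_iff.1 h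
  have hle := ENNReal.toReal_mono h (InformationTheory.klDiv_map_le γ lebSq hc)
  have : IsProbabilityMeasure (γ.map (cell k)) := Measure.isProbabilityMeasure_map hc.aemeasurable
  have : IsProbabilityMeasure (lebSq.map (cell k)) :=
    Measure.isProbabilityMeasure_map hc.aemeasurable
  have hac' := hac.map hc
  refine le_trans (le_of_eq ?_) hle
  rw [InformationTheory.toReal_klDiv_of_measure_eq hac' (by simp),
    integral_fintype (by simp)]
  have hk : ((k : ℝ) + 1) ≠ 0 := by positivity
  have hterm : ∀ q, (γ.map (cell k)).real {q} • llr (γ.map (cell k)) (lebSq.map (cell k)) q =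
      γ.real (cell k ⁻¹' {q}) * Real.log (γ.real (cell k ⁻¹' {q})) +
        γ.real (cell k ⁻¹' {q}) * (2 * Real.log ((k : ℝ) + 1)) := by
    intro q
    have e1 : (γ.map (cell k)).real {q} = γ.real (cell k ⁻¹' {q}) :=
      map_measureReal_apply hc (measurableSet_singleton q)
    have e2 : (lebSq.map (cell k)).real {q} = 1 / ((k : ℝ) + 1) * (1 / ((k : ℝ) + 1)) := by
      rw [map_measureReal_apply hc (measurableSet_singleton q), lebSq_cell]
    have h0 : lebSq.map (cell k) {q} ≠ 0 := by
      intro h0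
      rw [measureReal_def, h0, ENNReal.toReal_zero] at e2
      have : (0 : ℝ) < 1 / ((k : ℝ) + 1) * (1 / ((k : ℝ) + 1)) := by positivity
      exact this.ne e2
    rw [llr, toReal_rnDeriv_fintype hac' q h0, e1, e2, smul_eq_mul]
    rcases eq_or_ne (γ.real (cell k ⁻¹' {q})) 0 with hz | hz
    · simp [hz]
    · rw [Real.log_div hz (by positivity), Real.log_mul (by positivity) (by positivity),
        one_div, Real.log_inv]
      ring
  simp_rw [hterm]
  rw [Finset.sum_add_distrib, ← Finset.sum_mul, sum_cell_eq_one, one_mul]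

lemma sum_cell_row {γ : ProbabilityMeasure Ω2} (hγ : γ ∈ Mtilde) (k : ℕ) (a : Fin (k + 1)) :
    ∑ b, (γ : Measure Ω2).real (cell k ⁻¹' {(a, b)}) = 1 / ((k : ℝ) + 1) := by
  have hm := measurable_block k (measurableSet_singleton a)
  rw [← unif01_block k a, ← hγ.2.1, map_measureReal_apply measurable_fst hm]
  have := sum_measureReal_preimage_singleton (μ := (γ : Measure Ω2)) ({a} ×ˢ Finset.univ)
    (f := cell k) (fun q _ => measurable_cell k (measurableSet_singleton q))
  rw [Finset.sum_product, Finset.sum_singleton] at this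
  rw [this]
  congr 1
  ext p
  simp [cell, eq_comm]

lemma sum_cell_col {γ : ProbabilityMeasure Ω2} (hγ : γ ∈ Mtilde) (k : ℕ) (b : Fin (k + 1)) :
    ∑ a, (γ : Measure Ω2).real (cell k ⁻¹' {(a, b)}) = 1 / ((k : ℝ) + 1) := by
  have hm := measurable_block k (measurableSet_singleton b)
  rw [← unif01_block k b, ← hγ.2.2, map_measureReal_apply measurable_snd hm]
  have := sum_measureReal_preimage_singleton (μ := (γ : Measure Ω2)) (Finset.univ ×ˢ {b})
    (f := cell k) (fun q _ => measurable_cell k (measurableSet_singleton q))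
  rw [Finset.sum_product] at this
  simp only [Finset.sum_singleton] at this
  rw [this]
  congr 1
  ext p
  simp [cell, eq_comm]

lemma sum_floor_le {k n : ℕ} {x : Fin (k + 1) → ℝ} (hx : ∀ b, 0 ≤ x b)
    (h : ∑ b, x b = 1 / ((k : ℝ) + 1)) : ∑ b, ⌊n * x b⌋₊ ≤ n / (k + 1) := by
  rw [Nat.le_div_iff_mul_le (Nat.succ_pos k)]
  have : (∑ b, (⌊n * x b⌋₊ : ℝ)) ≤ ∑ b, n * x b :=
    Finset.sum_le_sum fun b _ => Nat.floor_le (mul_nonneg n.cast_nonneg (hx b))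
  rw [← Finset.mul_sum, h, mul_one_div, le_div_iff₀ (by positivity)] at this
  exact_mod_cast this

/-- Permutations whose cell counts on a fixed grid approximate the cell masses of a permuton. -/
lemma exists_perm_tendsto_labelCount {γ : ProbabilityMeasure Ω2} (hγ : γ ∈ Mtilde) (k : ℕ) :
    ∃ π : ∀ n, Equiv.Perm (Fin n), ∀ q,
      Tendsto (fun n => (labelCount (pairLabel (gridBlock k n) (π n)) q : ℝ) / n) atTop
        (𝓝 ((γ : Measure Ω2).real (cell k ⁻¹' {q}))) := by
  have h : ∀ n, ∃ π : Equiv.Perm (Fin n), ∀ q,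
      ⌊n * (γ : Measure Ω2).real (cell k ⁻¹' {q})⌋₊ ≤
        labelCount (pairLabel (gridBlock k n) π) q := fun n =>
    exists_perm_labelCount_ge _ _
      (fun a => (sum_floor_le (fun _ => measureReal_nonneg) (sum_cell_row hγ k a)).trans
        (div_le_labelCount_gridBlock k n a))
      (fun b => (sum_floor_le (fun _ => measureReal_nonneg) (sum_cell_col hγ k b)).trans
        (div_le_labelCount_gridBlock k n b))
  choose π hπ using h
  refine ⟨π, fun q => tendsto_div_of_sum_eq
    (fun n => labelCount (pairLabel (gridBlock k n) (π n))) _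
    (sum_cell_eq_one (γ : Measure Ω2) k) (fun n => ?_) (fun n x => ?_) q⟩
  · rw [sum_labelCount, Fintype.card_fin]
  · have h1 := Nat.lt_floor_add_one (n * (γ : Measure Ω2).real (cell k ⁻¹' {x}))
    have h2 : (⌊n * (γ : Measure Ω2).real (cell k ⁻¹' {x})⌋₊ : ℝ) ≤
        labelCount (pairLabel (gridBlock k n) (π n)) x := by exact_mod_cast hπ n x
    linarith

/-- The permutations with the same cell counts as a given one. -/
def sameCounts (k : ℕ) {n : ℕ} (π₀ : Equiv.Perm (Fin n)) : Finset (Equiv.Perm (Fin n)) :=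
  Finset.univ.filter fun π =>
    labelCount (pairLabel (gridBlock k n) π) = labelCount (pairLabel (gridBlock k n) π₀)

lemma eventually_exp_le_card_sameCounts {k : ℕ} {x : Fin (k + 1) × Fin (k + 1) → ℝ}
    {π : ∀ n, Equiv.Perm (Fin n)}
    (hπ : ∀ q, Tendsto (fun n => (labelCount (pairLabel (gridBlock k n) (π n)) q : ℝ) / n) atTop
      (𝓝 (x q))) {c : ℝ} (hc : ∑ q, x q * Real.log (x q) + 2 * Real.log ((k : ℝ) + 1) < c) :
    ∀ᶠ n : ℕ in atTop, (n ! : ℝ) * Real.exp (-(n * c)) ≤ (sameCounts k (π n)).card := by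
  have hlim : Tendsto (fun n : ℕ => ∑ q, logFact n (labelCount (pairLabel (gridBlock k n) (π n)) q)
      - 2 * ∑ a, logFact n (labelCount (gridBlock k n) a) + logFact n n) atTop
      (𝓝 (∑ q, x q * Real.log (x q) - 2 * (- Real.log ((k : ℝ) + 1)) + 0)) :=
    ((tendsto_finsetSum _ fun q _ => tendsto_logFact (fun n => labelCount_le _ q) (hπ q)).sub
      ((tendsto_logFact_gridBlock k).const_mul 2)).add tendsto_logFact_self
  filter_upwards [hlim.eventually_lt_const (u := c) (by linarith), eventually_gt_atTop 0]
    with n hn hn0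
  have hn' : (0 : ℝ) < n := by exact_mod_cast hn0
  have hpos : ∀ {ι : Type} [Fintype ι] [DecidableEq ι] (f : Fin n → ι),
      (0 : ℝ) < labelSymm f := fun f => by
    exact_mod_cast Finset.prod_pos fun c _ => Nat.factorial_pos _
  have hsq := labelSymm_sq_le (gridBlock k n) (π n)
  have hsq' : (labelSymm (gridBlock k n) : ℝ) * labelSymm (gridBlock k n) ≤
      labelSymm (pairLabel (gridBlock k n) (π n)) * (sameCounts k (π n)).card := by
    exact_mod_cast hsq
  rw [← div_le_iff₀' (hpos _)] at hsq'
  refine le_trans ?_ hsq'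
  rw [le_div_iff₀ (hpos _), ← Real.exp_log (hpos (gridBlock k n)),
    ← Real.exp_log (hpos (pairLabel (gridBlock k n) (π n))),
    ← Real.exp_log (show (0 : ℝ) < (n ! : ℝ) by positivity), ← Real.exp_add, ← Real.exp_add,
    ← Real.exp_add, Real.exp_le_exp, log_labelSymm hn0.ne', log_labelSymm hn0.ne',
    log_factorial_eq hn0.ne']
  have h6 := mul_le_mul_of_nonneg_left hn.le hn'.le
  linarith

lemma eventually_sameCounts_mem {γ : ProbabilityMeasure Ω2} (hγ : γ ∈ Pcal)
    {π : ∀ _k n : ℕ, Equiv.Perm (Fin n)}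
    (hπ : ∀ k q, Tendsto (fun n => (labelCount (pairLabel (gridBlock k n) (π k n)) q : ℝ) / n)
      atTop (𝓝 ((γ : Measure Ω2).real (cell k ⁻¹' {q}))))
    {U : Set (ProbabilityMeasure Ω2)} (hU : U ∈ 𝓝 γ) :
    ∀ᶠ k in atTop, ∀ᶠ n in atTop, ∀ τ ∈ sameCounts k (π k n), EmP τ ∈ U := by
  set L : Filter (ProbabilityMeasure Ω2) := (atTop : Filter ℕ).bind fun k =>
    (atTop : Filter ℕ).bind fun n => 𝓟 (EmP '' {τ | τ ∈ sameCounts k (π k n)}) with hL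
  have hmem : ∀ s, s ∈ L ↔ ∀ᶠ k in atTop, ∀ᶠ n in atTop, ∀ τ ∈ sameCounts k (π k n),
      EmP τ ∈ s := by
    intro s
    rw [hL, Filter.mem_bind']
    refine Filter.eventually_congr (Eventually.of_forall fun k => ?_)
    rw [Filter.mem_bind']
    refine Filter.eventually_congr (Eventually.of_forall fun n => ?_)
    exact Set.image_subset_iff
  suffices h : Tendsto id L (𝓝 γ) from (hmem U).1 (h hU)
  rw [ProbabilityMeasure.tendsto_iff_forall_integral_tendsto]
  intro f
  rw [Metric.tendsto_nhds]
  intro ε hε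
  refine (hmem _).2 ?_
  filter_upwards [eventually_abs_sub_corner_le f.continuous
    (show 0 < ε / 4 by positivity)] with k hk
  have hlim : Tendsto (fun n : ℕ => ∑ q,
      (labelCount (pairLabel (gridBlock k n) (π k n)) q : ℝ) / n * f (corner k q)) atTop
      (𝓝 (∑ q, (γ : Measure Ω2).real (cell k ⁻¹' {q}) * f (corner k q))) :=
    tendsto_finsetSum _ fun q _ => (hπ k q).mul_const _
  filter_upwards [Metric.tendsto_nhds.1 hlim (ε / 4) (by positivity), eventually_ne_atTop 0]
    with n hn hn0 τ hτ
  have hτ' := (Finset.mem_filter.1 hτ).2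
  have e : ∫ p, f (corner k (cell k p)) ∂(EmP τ : Measure Ω2) =
      ∑ q, (labelCount (pairLabel (gridBlock k n) (π k n)) q : ℝ) / n * f (corner k q) := by
    rw [integral_EmP hn0]
    have : ∑ i, f (corner k (cell k (permPt τ i))) =
      ∑ i, (fun q => f (corner k q)) (pairLabel (gridBlock k n) τ i) := rfl
    rw [this, sum_comp_label (pairLabel (gridBlock k n) τ) (fun q => f (corner k q)), hτ',
      Finset.sum_div]
    exact Finset.sum_congr rfl fun a _ => by ring
  have h := abs_integral_sub_integral_le (EmP_mem_Pcal hn0 τ) hγ f hk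
  have e' := integral_cell (γ : Measure Ω2) k fun q => f (corner k q)
  change dist (∫ p, f p ∂(EmP τ : Measure Ω2)) _ < ε
  rw [Real.dist_eq] at hn ⊢
  rw [e, e'] at h
  linarith

/-- The local lower bound at a permuton of finite relative entropy. -/
lemma eventually_exp_le_probUnif {γ : ProbabilityMeasure Ω2} (hγ : γ ∈ Mtilde)
    (hKL : KL (γ : Measure Ω2) lebSq ≠ ∞) {U : Set (ProbabilityMeasure Ω2)} (hU : U ∈ 𝓝 γ)
    {c : ℝ} (hc : (KL (γ : Measure Ω2) lebSq).toReal < c) :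
    ∀ᶠ n : ℕ in atTop, ENNReal.ofReal (Real.exp (-(n * c))) ≤ probUnif n U := by
  classical
  choose π hπ using exists_perm_tendsto_labelCount hγ
  obtain ⟨k, hk⟩ := (eventually_sameCounts_mem hγ.1 hπ hU).exists
  filter_upwards [hk, eventually_exp_le_card_sameCounts (hπ k)
    ((sum_cell_mul_log_le _ hKL k).trans_lt hc)] with n h1 h2
  unfold probUnif
  rw [Fintype.card_perm, Fintype.card_fin, ENNReal.le_div_iff_mul_le (by simp [n.factorial_ne_zero])
    (by simp), ← ENNReal.ofReal_natCast (n !), ← ENNReal.ofReal_mul (Real.exp_pos _).le, mul_comm]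
  refine (ENNReal.ofReal_le_ofReal h2).trans ?_
  rw [ENNReal.ofReal_natCast, Nat.cast_le]
  refine Finset.card_le_card fun τ hτ => ?_
  simpa using h1 τ hτ

lemma log_ofReal_exp (x : ℝ) : ENNReal.log (ENNReal.ofReal (Real.exp x)) = (x : EReal) := by
  rw [ENNReal.log_ofReal_of_pos (Real.exp_pos x), Real.log_exp]

lemma probUnif_le_one (n : ℕ) (A : Set (ProbabilityMeasure Ω2)) : probUnif n A ≤ 1 := by
  classical
  refine ENNReal.div_le_of_le_mul ?_
  rw [one_mul, Nat.cast_le, ← Finset.card_univ]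
  exact Finset.card_le_card (Finset.filter_subset _ _)

lemma inv_mul_neg_mul {n : ℕ} (hn : n ≠ 0) (c : ℝ) :
    (((n : ℝ)⁻¹ : ℝ) : EReal) * ((-(n * c) : ℝ) : EReal) = ((-c : ℝ) : EReal) := by
  have hn' : (n : ℝ) ≠ 0 := by exact_mod_cast hn
  rw [← EReal.coe_mul]
  congr 1
  field_simp

lemma neg_rate_le_liminf {A : Set (ProbabilityMeasure Ω2)} {γ : ProbabilityMeasure Ω2}
    (hA : A ∈ 𝓝 γ) :
    -((IrateUnif γ : ℝ≥0∞) : EReal) ≤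
      liminf (fun n : ℕ => (((n : ℝ)⁻¹ : ℝ) : EReal) * ENNReal.log (probUnif n A)) atTop := by
  by_cases hI : IrateUnif γ = ∞
  · simp [hI]
  have hγ : γ ∈ Mtilde := by
    by_contra h
    exact hI (if_neg h)
  have hK : IrateUnif γ = KL (γ : Measure Ω2) lebSq := if_pos hγ
  rw [hK] at hI ⊢
  rw [← ENNReal.ofReal_toReal hI, EReal.coe_ennreal_ofReal, max_eq_left ENNReal.toReal_nonneg]
  rw [← EReal.coe_neg]
  refine EReal.ge_of_forall_gt_iff_ge.1 fun z hz => ?_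
  have hz' : (KL (γ : Measure Ω2) lebSq).toReal < -z := by
    have := EReal.coe_lt_coe_iff.1 hz
    linarith
  refine le_liminf_of_le ?_ ?_
  · isBoundedDefault
  filter_upwards [eventually_exp_le_probUnif hγ hI hA hz', eventually_ne_atTop 0] with n hn hn0
  have h := ENNReal.log_monotone hn
  rw [log_ofReal_exp] at h
  have h2 := mul_le_mul_of_nonneg_left h
    (show (0 : EReal) ≤ (((n : ℝ)⁻¹ : ℝ) : EReal) by exact_mod_cast inv_nonneg.2 n.cast_nonneg)
  rw [inv_mul_neg_mul hn0, neg_neg] at h2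
  exact h2

lemma limsup_le_zero (A : Set (ProbabilityMeasure Ω2)) :
    limsup (fun n : ℕ => (((n : ℝ)⁻¹ : ℝ) : EReal) * ENNReal.log (probUnif n A)) atTop ≤ 0 := by
  refine limsup_le_of_le (by isBoundedDefault) (Eventually.of_forall fun n => ?_)
  have h := ENNReal.log_monotone (probUnif_le_one n A)
  rw [ENNReal.log_one] at h
  simpa using mul_le_mul_of_nonneg_left h
    (show (0 : EReal) ≤ (((n : ℝ)⁻¹ : ℝ) : EReal) by exact_mod_cast inv_nonneg.2 n.cast_nonneg)

lemma limsup_le_neg {A : Set (ProbabilityMeasure Ω2)} {β : ℝ}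
    (hβ : ∀ γ ∈ closure A, ENNReal.ofReal β < IrateUnif γ) :
    limsup (fun n : ℕ => (((n : ℝ)⁻¹ : ℝ) : EReal) * ENNReal.log (probUnif n A)) atTop ≤
      ((-β : ℝ) : EReal) := by
  obtain ⟨C, hC⟩ := eventually_probUnif_le hβ
  have hlim : Tendsto (fun n : ℕ => (((n : ℝ)⁻¹ * Real.log (C + 1) + -β : ℝ) : EReal)) atTop
      (𝓝 ((-β : ℝ) : EReal)) := by
    rw [EReal.tendsto_coe]
    simpa using ((tendsto_inv_atTop_nhds_zero_nat (𝕜 := ℝ)).mul_const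
      (Real.log (C + 1))).add_const (-β)
  rw [← hlim.limsup_eq]
  refine limsup_le_limsup ?_ (by isBoundedDefault) (by isBoundedDefault)
  filter_upwards [hC, eventually_ne_atTop 0] with n hn hn0
  have hn' : (n : ℝ) ≠ 0 := by exact_mod_cast hn0
  have hC0 : (0 : ℝ) < C + 1 := by positivity
  have h1 : probUnif n A ≤ ENNReal.ofReal (Real.exp (Real.log (C + 1) + -(n * β))) := by
    refine hn.trans ?_
    rw [Real.exp_add, Real.exp_log hC0, ENNReal.ofReal_mul hC0.le]
    gcongr
    rw [← ENNReal.ofReal_coe_nnreal]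
    exact ENNReal.ofReal_le_ofReal (by linarith)
  have h := ENNReal.log_monotone h1
  rw [log_ofReal_exp] at h
  refine (mul_le_mul_of_nonneg_left h
    (show (0 : EReal) ≤ (((n : ℝ)⁻¹ : ℝ) : EReal) by
      exact_mod_cast inv_nonneg.2 n.cast_nonneg)).trans_eq ?_
  rw [← EReal.coe_mul]
  congr 1
  field_simp

lemma limsup_le_neg_iInf (A : Set (ProbabilityMeasure Ω2)) :
    limsup (fun n : ℕ => (((n : ℝ)⁻¹ : ℝ) : EReal) * ENNReal.log (probUnif n A)) atTop ≤
      -(⨅ γ ∈ closure A, ((IrateUnif γ : ℝ≥0∞) : EReal)) := by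
  rw [EReal.le_neg]
  refine EReal.ge_of_forall_gt_iff_ge.1 fun β hβ => ?_
  rw [EReal.le_neg]
  rcases lt_or_ge β 0 with h0 | h0
  · refine (limsup_le_zero A).trans ?_
    rw [← EReal.coe_neg]
    exact_mod_cast (neg_pos.2 h0).le
  refine limsup_le_neg fun γ hγ => ?_
  have h := hβ.trans_le (iInf₂_le γ hγ)
  rwa [← max_eq_left h0, ← EReal.coe_ennreal_ofReal, EReal.coe_ennreal_lt_coe_ennreal_iff] at h

end PermutonLDP

/-- Corollary 1.6: LDP for uniformly random permutations with rate
`γ ↦ D(γ|λ)` on permutons and `∞` otherwise. -/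
theorem ldp_uniform_permutations :
    ∀ A : Set (ProbabilityMeasure Ω2), MeasurableSet[borel (ProbabilityMeasure Ω2)] A →
      (-(⨅ γ ∈ interior A, ((IrateUnif γ : ℝ≥0∞) : EReal)) ≤
          liminf (fun n : ℕ => (((n : ℝ)⁻¹ : ℝ) : EReal) * ENNReal.log (probUnif n A)) atTop) ∧
      limsup (fun n : ℕ => (((n : ℝ)⁻¹ : ℝ) : EReal) * ENNReal.log (probUnif n A)) atTop ≤
        -(⨅ γ ∈ closure A, ((IrateUnif γ : ℝ≥0∞) : EReal)) := by
  intro A _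
  exact ⟨EReal.neg_le_of_neg_le (le_iInf₂ fun γ hγ => EReal.neg_le_of_neg_le
    (PermutonLDP.neg_rate_le_liminf (mem_interior_iff_mem_nhds.1 hγ))),
    PermutonLDP.limsup_le_neg_iInf A⟩

end
end
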